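/- arXiv:1912.13328 — 6 statements merged into one kernel-verified Lean document; each statement's English description precedes it below -/
import Mathlib

section
/- For each integer r ≥ 3, every K_r-free graph G of chromatic number χ, equipped with any proper colouring, contains a rainbow independent set of size at least ⌈(1/2)·χ^{1/(r−2)}⌉. -/
/-- The neighbourhood of a vertex of a `K_{n+1}`-free graph induces a `K_n`-free graph. -/
theorem SimpleGraph.CliqueFree.induce_neighborSet {V : Type*} {G : SimpleGraph V} {n : ℕ}
    (h : G.CliqueFree (n + 1)) (v : V) : (G.induce (G.neighborSet v)).CliqueFree n := by
  classical
  intro t ht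
  have ht' := (ht.map (f := Function.Embedding.subtype _)).mono
    ((SimpleGraph.map_le_iff_le_comap (Function.Embedding.subtype _) _ _).2 le_rfl)
  refine h _ (ht'.insert (a := v) ?_)
  intro b hb
  obtain ⟨x, -, rfl⟩ := Finset.mem_map.1 hb
  exact x.2

/-- A finite graph with a vertex labelling has a rainbow independent set of maximum size. -/
theorem SimpleGraph.exists_max_rainbow_indep {V α : Type*} [Fintype V] (G : SimpleGraph V)
    (c : V → α) :
    ∃ S : Finset V, ((∀ u ∈ S, ∀ v ∈ S, ¬ G.Adj u v) ∧ Set.InjOn c ↑S) ∧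
      ∀ T : Finset V, (∀ u ∈ T, ∀ v ∈ T, ¬ G.Adj u v) → Set.InjOn c ↑T → T.card ≤ S.card := by
  classical
  obtain ⟨S, hS, hmax⟩ := Finset.exists_max_image
    (Finset.univ.filter fun S : Finset V =>
      (∀ u ∈ S, ∀ v ∈ S, ¬ G.Adj u v) ∧ Set.InjOn c ↑S) Finset.card ⟨∅, by simp⟩
  refine ⟨S, (Finset.mem_filter.1 hS).2, fun T h₁ h₂ => hmax T ?_⟩
  exact Finset.mem_filter.2 ⟨Finset.mem_univ _, h₁, h₂⟩

/-- If all rainbow independent sets of a properly coloured `K_{n+2}`-free graph have size at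
most `s`, then the graph is `(2s)^n`-colourable. -/
theorem SimpleGraph.CliqueFree.colorable_of_rainbow_indep_card_le {α : Type*} (s n : ℕ) :
    ∀ {V : Type*} [Fintype V] (G : SimpleGraph V), G.CliqueFree (n + 2) →
      ∀ c : V → α, (∀ {u v : V}, G.Adj u v → c u ≠ c v) →
      (∀ T : Finset V, (∀ u ∈ T, ∀ v ∈ T, ¬ G.Adj u v) → Set.InjOn c ↑T → T.card ≤ s) →
      G.Colorable ((2 * s) ^ n) := by
  classical
  induction n with
  | zero =>
    intro V _ G hG c _ _
    rw [zero_add, SimpleGraph.cliqueFree_two] at hG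
    subst hG
    exact ⟨SimpleGraph.Coloring.mk (fun _ => ⟨0, by simp⟩) (by simp)⟩
  | succ n ih =>
    intro V _ G hG c hc hs
    obtain ⟨S, ⟨hSi, hSr⟩, hmax⟩ := G.exists_max_rainbow_indep c
    have hcol : ∀ u : V, (G.induce (G.neighborSet u)).Colorable ((2 * s) ^ n) := by
      intro u
      refine ih _ (hG.induce_neighborSet u) (fun v => c v) (fun h => hc h) ?_
      intro T hTi hTr
      rw [← Finset.card_map (Function.Embedding.subtype _)]
      refine hs _ ?_ ?_
      · simp only [Finset.mem_map]
        rintro _ ⟨x, hx, rfl⟩ _ ⟨y, hy, rfl⟩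
        exact hTi x hx y hy
      · intro _ hx _ hy hxy
        obtain ⟨x, hxT, rfl⟩ := Finset.mem_map.1 (Finset.mem_coe.1 hx)
        obtain ⟨y, hyT, rfl⟩ := Finset.mem_map.1 (Finset.mem_coe.1 hy)
        exact congrArg _ (hTr hxT hyT hxy)
    have hdom : ∀ v : V, (¬ ∃ u : S, c u = c v) → ∃ u : S, G.Adj u v := by
      intro v hv
      by_contra! hadj
      have hvS : v ∉ S := fun h => hv ⟨⟨v, h⟩, rfl⟩
      have hle := hmax (insert v S) ?_ ?_
      · rw [Finset.card_insert_of_notMem hvS] at hle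
        omega
      · intro x hx y hy hxy
        rcases Finset.mem_insert.1 hx with rfl | hxS <;>
          rcases Finset.mem_insert.1 hy with rfl | hyS
        · exact G.irrefl hxy
        · exact hadj ⟨y, hyS⟩ hxy.symm
        · exact hadj ⟨x, hxS⟩ hxy
        · exact hSi x hxS y hyS hxy
      · rw [Finset.coe_insert, Set.injOn_insert (by simpa using hvS)]
        refine ⟨hSr, ?_⟩
        rintro ⟨u, hu, huv⟩
        exact hv ⟨⟨u, hu⟩, huv⟩
    choose nbr hnbr using hdom
    let C := fun u : V => (hcol u).some
    let f : V → S ⊕ (S × Fin ((2 * s) ^ n)) := fun v =>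
      if h : ∃ u : S, c u = c v then Sum.inl h.choose
      else Sum.inr (nbr v h, C (nbr v h) ⟨v, hnbr v h⟩)
    have hf : ∀ {v w : V}, G.Adj v w → f v ≠ f w := by
      intro v w hvw heq
      by_cases hv : ∃ u : S, c u = c v <;> by_cases hw : ∃ u : S, c u = c w
      · simp only [f, dif_pos hv, dif_pos hw, Sum.inl.injEq] at heq
        apply hc hvw
        rw [← hv.choose_spec, heq, hw.choose_spec]
      · simp only [f, dif_pos hv, dif_neg hw, reduceCtorEq] at heq
      · simp only [f, dif_neg hv, dif_pos hw, reduceCtorEq] at heq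
      · simp only [f, dif_neg hv, dif_neg hw, Sum.inr.injEq, Prod.mk.injEq] at heq
        obtain ⟨h₁, h₂⟩ := heq
        have key : ∀ (a b : S) (ha : G.Adj a v) (hb : G.Adj b w), a = b →
            C a ⟨v, ha⟩ ≠ C b ⟨w, hb⟩ := by
          rintro a _ ha hb rfl
          exact (C a).valid hvw
        exact key _ _ _ _ h₁ h₂
    have hcolG := (SimpleGraph.Coloring.mk f hf).colorable
    refine hcolG.mono ?_
    have hS := hs S hSi hSr
    simp only [Fintype.card_sum, Fintype.card_prod, Fintype.card_coe, Fintype.card_fin]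
    rcases Nat.eq_zero_or_pos s with rfl | hpos
    · simp [Nat.le_zero.1 hS]
    · have h1 : 1 ≤ (2 * s) ^ n := Nat.one_le_pow _ _ (by omega)
      calc S.card + S.card * (2 * s) ^ n ≤ s * (2 * s) ^ n + s * (2 * s) ^ n := by
            gcongr
            nlinarith
        _ = (2 * s) ^ (n + 1) := by ring

/-- For each integer r ≥ 3, every K_r-free graph G of chromatic number χ,
equipped with any proper colouring, contains a rainbow independent set of size at least
⌈(1/2)·χ^{1/(r−2)}⌉. -/
theorem rainbow_indep_of_cliqueFree (r : ℕ) (hr : 3 ≤ r)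
    {V : Type} [Fintype V] (G : SimpleGraph V) (hKr : G.CliqueFree r)
    (χ : ℕ) (hχ : G.chromaticNumber = χ)
    {α : Type} (c : V → α) (hc : ∀ {u v : V}, G.Adj u v → c u ≠ c v) :
    ∃ S : Finset V, (∀ u ∈ S, ∀ v ∈ S, ¬ G.Adj u v) ∧ Set.InjOn c ↑S ∧
      ⌈(χ : ℝ) ^ (((r : ℝ) - 2)⁻¹) / 2⌉₊ ≤ S.card := by
  obtain ⟨S, ⟨hSi, hSr⟩, hmax⟩ := G.exists_max_rainbow_indep c
  refine ⟨S, hSi, hSr, ?_⟩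
  obtain ⟨n, rfl⟩ : ∃ n, r = n + 3 := ⟨r - 3, by omega⟩
  have hcol := SimpleGraph.CliqueFree.colorable_of_rainbow_indep_card_le S.card (n + 1) G hKr c
    hc hmax
  have hle : χ ≤ (2 * S.card) ^ (n + 1) := by
    have h := hcol.chromaticNumber_le
    rw [hχ] at h
    exact_mod_cast h
  have hexp : ((n + 3 : ℕ) : ℝ) - 2 = ((n + 1 : ℕ) : ℝ) := by
    push_cast
    ring
  rw [Nat.ceil_le, hexp, div_le_iff₀ two_pos]
  calc (χ : ℝ) ^ (((n + 1 : ℕ) : ℝ)⁻¹)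
      ≤ ((2 * (S.card : ℝ)) ^ (n + 1)) ^ (((n + 1 : ℕ) : ℝ)⁻¹) := by
        gcongr
        exact_mod_cast hle
    _ = 2 * S.card := Real.pow_rpow_inv_natCast (by positivity) n.succ_ne_zero
    _ = S.card * 2 := mul_comm _ _
end

section
/- For each integer r ≥ 3 there exists a constant c₂ > 0 such that every K_r-free graph G with chromatic number χ = χ(G) ≥ 2 contains an independent set of size at least c₂·χ^{1/(r−2)}·log χ. -/
open Finset Real in
/-- Hard-core weights: replacing each set `I ∈ 𝓕` by `insert u (I \ B)`, where `u ∈ B`. -/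
lemma Finset.sum_hardCore_le {V : Type*} [DecidableEq V] (𝓘 𝓕 : Finset (Finset V)) (lam : ℝ) (hlam : 0 < lam) (u : V) (B : Finset V) (hu : u ∈ B)
    (Y : Finset V → Finset V) (hY : ∀ I ∈ 𝓕, I ∩ B ⊆ Y (I \ B))
    (h𝓕 : ∀ I ∈ 𝓕, insert u (I \ B) ∈ 𝓘) :
    ∑ I ∈ 𝓕, lam ^ #I * ((1 + lam) ^ #(Y (I \ B)))⁻¹ ≤
      lam⁻¹ * ∑ I ∈ 𝓘 with u ∈ I, lam ^ #I := by
  have hmaps : ∀ I ∈ 𝓕, insert u (I \ B) ∈ {I ∈ 𝓘 | u ∈ I} := fun I hI =>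
    mem_filter.2 ⟨h𝓕 I hI, mem_insert_self _ _⟩
  rw [← sum_fiberwise_of_maps_to hmaps, mul_sum]
  refine sum_le_sum fun I' hI' => ?_
  have huI' := (mem_filter.1 hI').2
  set J := I'.erase u with hJ
  have hJc : #I' = #J + 1 := (card_erase_add_one huI').symm
  have hfib : ∀ I ∈ {I ∈ 𝓕 | insert u (I \ B) = I'}, I \ B = J := by
    intro I hI
    rw [hJ, ← (mem_filter.1 hI).2, erase_insert]
    simp [hu]
  have hcard : ∀ I : Finset V, #I = #(I \ B) + #(I ∩ B) := fun I =>
    (card_sdiff_add_card_inter I B).symm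
  calc ∑ I ∈ 𝓕 with insert u (I \ B) = I', lam ^ #I * ((1 + lam) ^ #(Y (I \ B)))⁻¹
      = lam ^ #J * ((1 + lam) ^ #(Y J))⁻¹ *
          ∑ I ∈ 𝓕 with insert u (I \ B) = I', lam ^ #(I ∩ B) := by
        rw [mul_sum]
        refine sum_congr rfl fun I hI => ?_
        rw [hcard I, hfib I hI, pow_add]
        ring
    _ ≤ lam ^ #J * ((1 + lam) ^ #(Y J))⁻¹ * ∑ A ∈ (Y J).powerset, lam ^ #A := by
        gcongr
        have hinj : Set.InjOn (fun I => I ∩ B)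
            (({I ∈ 𝓕 | insert u (I \ B) = I'} : Finset (Finset V)) : Set (Finset V)) := by
          intro I₁ h₁ I₂ h₂ h
          rw [← sdiff_union_inter I₁ B, ← sdiff_union_inter I₂ B, hfib _ h₁, hfib _ h₂]
          exact congrArg (J ∪ ·) h
        rw [← sum_image (f := fun A => lam ^ #A) hinj]
        refine sum_le_sum_of_subset_of_nonneg ?_ fun _ _ _ => by positivity
        intro A hA
        obtain ⟨I, hI, rfl⟩ := mem_image.1 hA
        rw [mem_powerset, ← hfib I hI]
        exact hY I (mem_filter.1 hI).1
    _ = lam⁻¹ * lam ^ #I' := by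
        have h : ∑ A ∈ (Y J).powerset, lam ^ #A = (1 + lam) ^ #(Y J) := by
          have := sum_pow_mul_eq_add_pow lam 1 (Y J)
          simpa [add_comm] using this
        rw [h, hJc, pow_succ]
        field_simp

lemma Real.log_div_le_mul_exp_neg_add (a s : ℝ) (ha : 0 < a) :
    Real.log a / 3 ≤ a / 2 * Real.exp (-s) + s / 3 := by
  have h1 := Real.add_one_le_exp (Real.log a - s)
  have h2 : Real.exp (Real.log a - s) = a * Real.exp (-s) := by
    rw [sub_eq_add_neg, Real.exp_add, Real.exp_log ha]
  have h3 : 0 < a * Real.exp (-s) := by positivity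
  linarith

open Finset Real in
/-- Graphs of maximum degree at most `D` all of whose codegrees of adjacent vertices are at most
`k - 2` have independence number of order at least `(n / D) * log (D / k)`. -/
lemma SimpleGraph.card_mul_log_le_of_codegree_le {V : Type*} [DecidableEq V] (G : SimpleGraph V)
    [DecidableRel G.Adj] (U : Finset V) (D k t : ℝ) (hD : 0 < D) (hk : 1 ≤ k)
    (hdeg : ∀ v ∈ U, (#{u ∈ U | G.Adj v u} : ℝ) ≤ D)
    (hcodeg : ∀ v ∈ U, ∀ u ∈ U, G.Adj v u →
      (#{w ∈ U | G.Adj v w ∧ G.Adj u w} : ℝ) + 2 ≤ k)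
    (hind : ∀ S ⊆ U, G.IsIndepSet (S : Set V) → (#S : ℝ) ≤ t) :
    #U * Real.log (D / k) ≤ 6 * D * t := by
  classical
  set lam : ℝ := k⁻¹ with hlam
  have hk0 : 0 < k := by linarith
  have hl0 : 0 < lam := by positivity
  have hl1 : lam ≤ 1 := inv_le_one_of_one_le₀ hk
  set 𝓘 : Finset (Finset V) := {I ∈ U.powerset | G.IsIndepSet (I : Set V)} with h𝓘
  have mem𝓘 : ∀ I, I ∈ 𝓘 ↔ I ⊆ U ∧ G.IsIndepSet (I : Set V) := by simp [h𝓘]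
  set P : V → ℝ := fun v => ∑ I ∈ 𝓘 with v ∈ I, lam ^ #I with hP
  set Z : ℝ := ∑ I ∈ 𝓘, lam ^ #I with hZ
  set N : V → Finset V := fun v => {u ∈ U | G.Adj v u} with hN
  have hP0 : ∀ v, 0 ≤ P v := fun v => sum_nonneg fun _ _ => by positivity
  have hZ0 : 0 < Z := by
    refine sum_pos (fun _ _ => by positivity) ⟨∅, ?_⟩
    rw [mem𝓘]
    simp [SimpleGraph.IsIndepSet]
  have hins : ∀ I ∈ 𝓘, ∀ u ∈ U, ∀ B : Finset V, (∀ x ∈ I, x ∉ B → ¬ G.Adj u x) →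
      insert u (I \ B) ∈ 𝓘 := by
    intro I hI u hu B h
    obtain ⟨h1, h2⟩ := (mem𝓘 I).1 hI
    refine (mem𝓘 _).2 ⟨insert_subset hu (sdiff_subset.trans h1), ?_⟩
    intro x hx y hy hxy
    simp only [coe_insert, coe_sdiff, Set.mem_insert_iff, Set.mem_sdiff, mem_coe] at hx hy
    rcases hx with rfl | hx <;> rcases hy with rfl | hy
    · exact absurd rfl hxy
    · exact h y hy.1 hy.2
    · exact fun hh => h x hx.1 hx.2 hh.symm
    · exact h2 hx.1 hy.1 hxy
  have key : ∀ v ∈ U, Z * (Real.log (D / k) / 3) ≤ D * P v + ∑ u ∈ N v, P u := by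
    intro v hv
    set B : Finset V := insert v (N v) with hB
    set X : Finset V → Finset V := fun J => {u ∈ N v | ∀ x ∈ J, ¬ G.Adj u x} with hX
    have h1 : ∑ I ∈ 𝓘, lam ^ #I * (lam / 2 * Real.exp (-(lam * #(X (I \ B))))) ≤ P v := by
      have := sum_hardCore_le 𝓘 𝓘 lam hl0 v B (mem_insert_self _ _)
        (fun J => insert v (X J)) ?_ ?_
      · have h2 : ∑ I ∈ 𝓘, lam ^ #I * (lam / 2 * Real.exp (-(lam * #(X (I \ B))))) ≤
            lam * ∑ I ∈ 𝓘, lam ^ #I * ((1 + lam) ^ #(insert v (X (I \ B))))⁻¹ := by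
          rw [mul_sum]
          refine sum_le_sum fun I _ => ?_
          have hc : #(insert v (X (I \ B))) ≤ #(X (I \ B)) + 1 := card_insert_le _ _
          have he : (1 + lam) ^ #(insert v (X (I \ B))) ≤
              2 * Real.exp (lam * #(X (I \ B))) := by
            calc (1 + lam) ^ #(insert v (X (I \ B)))
                ≤ (1 + lam) ^ (#(X (I \ B)) + 1) := pow_le_pow_right₀ (by linarith) hc
              _ = (1 + lam) * (1 + lam) ^ #(X (I \ B)) := pow_succ' _ _
              _ ≤ 2 * Real.exp lam ^ #(X (I \ B)) := by
                  gcongr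
                  · linarith
                  · linarith [Real.add_one_le_exp lam]
              _ = 2 * Real.exp (lam * #(X (I \ B))) := by
                  rw [← Real.exp_nat_mul, mul_comm lam]
          have hi : (2 * Real.exp (lam * #(X (I \ B))))⁻¹ ≤
              ((1 + lam) ^ #(insert v (X (I \ B))))⁻¹ := by
            gcongr
          rw [mul_inv, ← Real.exp_neg] at hi
          calc _ = lam * (lam ^ #I * (2⁻¹ * Real.exp (-(lam * #(X (I \ B)))))) := by ring
            _ ≤ _ := by gcongr
        refine h2.trans ?_
        calc _ ≤ lam * (lam⁻¹ * P v) := by gcongr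
          _ = P v := by field_simp
      · intro I hI x hx
        obtain ⟨hxI, hxB⟩ := mem_inter.1 hx
        rcases mem_insert.1 hxB with rfl | hxN
        · exact mem_insert_self _ _
        · refine mem_insert_of_mem (mem_filter.2 ⟨hxN, fun y hy hxy => ?_⟩)
          exact ((mem𝓘 I).1 hI).2 hxI (mem_sdiff.1 hy).1 hxy.ne hxy
      · intro I hI
        refine hins I hI v hv B fun x hx hxB hvx => hxB ?_
        exact mem_insert_of_mem (mem_filter.2 ⟨((mem𝓘 I).1 hI).1 hx, hvx⟩)
    have h2 : ∑ I ∈ 𝓘, lam ^ #I * (lam / 3 * #(X (I \ B))) ≤ ∑ u ∈ N v, P u := by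
      have h3 : ∀ u ∈ N v, ∑ I ∈ 𝓘 with u ∈ X (I \ B), lam ^ #I * (lam / 3) ≤ P u := by
        intro u huN
        obtain ⟨huU, hvu⟩ := mem_filter.1 huN
        set B' : Finset V := insert u (insert v {w ∈ U | G.Adj v w ∧ G.Adj u w}) with hB'
        have := sum_hardCore_le 𝓘 {I ∈ 𝓘 | u ∈ X (I \ B)} lam hl0 u B'
          (mem_insert_self _ _) (fun _ => B') (fun I _ => inter_subset_right) ?_
        · have hc : (#B' : ℝ) ≤ k := by
            refine le_trans ?_ (hcodeg v hv u huU hvu)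
            have h4 : #B' ≤ #{w ∈ U | G.Adj v w ∧ G.Adj u w} + 1 + 1 :=
              (card_insert_le _ _).trans (Nat.succ_le_succ (card_insert_le _ _))
            have h5 : (#B' : ℝ) ≤ #{w ∈ U | G.Adj v w ∧ G.Adj u w} + 1 + 1 := by
              exact_mod_cast h4
            linarith
          have he : (1 + lam) ^ #B' ≤ 3 := by
            calc (1 + lam) ^ #B' ≤ Real.exp lam ^ #B' := by
                  gcongr
                  linarith [Real.add_one_le_exp lam]
              _ = Real.exp (#B' * lam) := by rw [← Real.exp_nat_mul]
              _ ≤ Real.exp 1 := by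
                  gcongr
                  rw [hlam, ← div_eq_mul_inv]
                  exact (div_le_one hk0).2 hc
              _ ≤ 3 := by linarith [Real.exp_one_lt_d9]
          have hi : (3 : ℝ)⁻¹ ≤ ((1 + lam) ^ #B')⁻¹ := by gcongr
          calc ∑ I ∈ 𝓘 with u ∈ X (I \ B), lam ^ #I * (lam / 3)
              ≤ lam * ∑ I ∈ 𝓘 with u ∈ X (I \ B), lam ^ #I * ((1 + lam) ^ #B')⁻¹ := by
                rw [mul_sum]
                refine sum_le_sum fun I _ => ?_
                calc _ = lam * (lam ^ #I * 3⁻¹) := by ring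
                  _ ≤ _ := by gcongr
            _ ≤ lam * (lam⁻¹ * P u) := by gcongr
            _ = P u := by field_simp
        · intro I hI
          obtain ⟨hI, huX⟩ := mem_filter.1 hI
          refine hins I hI u huU B' fun x hx hxB hux => ?_
          by_cases hxv : x ∈ B
          · rcases mem_insert.1 hxv with rfl | hxN
            · exact hxB (by simp [hB'])
            · obtain ⟨hxU, hvx⟩ := mem_filter.1 hxN
              exact hxB (by simp [hB', hxU, hvx, hux])
          · exact (mem_filter.1 huX).2 x (mem_sdiff.2 ⟨hx, hxv⟩) hux
      refine le_trans (le_of_eq ?_) (sum_le_sum h3)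
      simp_rw [sum_filter]
      rw [sum_comm]
      refine sum_congr rfl fun I _ => ?_
      rw [← sum_filter, sum_const, nsmul_eq_mul]
      have : ({u ∈ N v | u ∈ X (I \ B)} : Finset V) = X (I \ B) := by
        ext u
        simp only [hX, mem_filter]
        tauto
      rw [this]
      ring
    calc Z * (Real.log (D / k) / 3)
        = ∑ I ∈ 𝓘, lam ^ #I * (Real.log (D / k) / 3) := by rw [hZ, sum_mul]
      _ ≤ ∑ I ∈ 𝓘, (D * (lam ^ #I * (lam / 2 * Real.exp (-(lam * #(X (I \ B)))))) +
            lam ^ #I * (lam / 3 * #(X (I \ B)))) := by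
          refine sum_le_sum fun I _ => ?_
          have := Real.log_div_le_mul_exp_neg_add (D / k) (lam * #(X (I \ B))) (by positivity)
          calc _ ≤ lam ^ #I * (D / k / 2 * Real.exp (-(lam * #(X (I \ B)))) +
                lam * #(X (I \ B)) / 3) := by gcongr
            _ = _ := by rw [hlam]; ring
      _ ≤ D * P v + ∑ u ∈ N v, P u := by
          rw [sum_add_distrib, ← mul_sum]
          gcongr
  have hsumP : ∑ v ∈ U, P v ≤ t * Z := by
    simp only [hP, hZ, sum_filter]
    rw [sum_comm, mul_sum]
    refine sum_le_sum fun I hI => ?_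
    rw [← sum_filter, sum_const, nsmul_eq_mul]
    gcongr
    obtain ⟨h1, h2⟩ := (mem𝓘 I).1 hI
    refine le_trans ?_ (hind I h1 h2)
    exact_mod_cast card_le_card fun x hx => (mem_filter.1 hx).2
  have hsumN : ∑ v ∈ U, ∑ u ∈ N v, P u ≤ D * ∑ v ∈ U, P v := by
    simp only [hN, sum_filter]
    rw [sum_comm, mul_sum]
    refine sum_le_sum fun u hu => ?_
    rw [← sum_filter, sum_const, nsmul_eq_mul]
    refine mul_le_mul_of_nonneg_right ?_ (hP0 u)
    simpa only [G.adj_comm u] using hdeg u hu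
  have htotal : #U * (Z * (Real.log (D / k) / 3)) ≤ 2 * D * (t * Z) := by
    calc #U * (Z * (Real.log (D / k) / 3)) = ∑ v ∈ U, Z * (Real.log (D / k) / 3) := by
          rw [sum_const, nsmul_eq_mul]
      _ ≤ ∑ v ∈ U, (D * P v + ∑ u ∈ N v, P u) := sum_le_sum key
      _ = D * ∑ v ∈ U, P v + ∑ v ∈ U, ∑ u ∈ N v, P u := by rw [sum_add_distrib, ← mul_sum]
      _ ≤ D * ∑ v ∈ U, P v + D * ∑ v ∈ U, P v := by gcongr
      _ = 2 * D * ∑ v ∈ U, P v := by ring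
      _ ≤ 2 * D * (t * Z) := by gcongr
  have : (#U * Real.log (D / k)) * Z ≤ (6 * D * t) * Z := by linarith
  exact le_of_mul_le_mul_right this hZ0

open Finset in
lemma SimpleGraph.CliqueFreeOn.filter_adj {V : Type*} [DecidableEq V] {G : SimpleGraph V}
    [DecidableRel G.Adj] {U : Finset V} {s : ℕ} (h : G.CliqueFreeOn (U : Set V) (s + 1))
    {v : V} (hv : v ∈ U) : G.CliqueFreeOn ({u ∈ U | G.Adj v u} : Finset V) s := by
  intro T hT hc
  refine h (t := insert v T) ?_ (hc.insert fun b hb => ?_)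
  · intro x hx
    rcases mem_insert.1 hx with rfl | hx
    · exact hv
    · exact (mem_filter.1 (hT hx)).1
  · exact (mem_filter.1 (hT hb)).2

open Finset in
/-- A polynomial bound on the Ramsey numbers `R(s + 1, t)`. -/
lemma SimpleGraph.CliqueFreeOn.card_le_pow {V : Type*} [DecidableEq V] {G : SimpleGraph V}
    [DecidableRel G.Adj] {t : ℝ} (ht : 1 ≤ t) (s : ℕ) :
    ∀ U : Finset V, G.CliqueFreeOn (U : Set V) (s + 1) →
      (∀ S ⊆ U, G.IsIndepSet (S : Set V) → (#S : ℝ) ≤ t) → (#U : ℝ) ≤ (2 * t) ^ s := by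
  classical
  induction s with
  | zero =>
    intro U hU _
    have : U = ∅ := by
      rw [eq_empty_iff_forall_notMem]
      intro x hx
      exact hU (t := {x}) (by simpa using hx) (by simp)
    simp [this]
  | succ s ih =>
    intro U hU hind
    obtain ⟨S, hS, hmax⟩ := exists_max_image
      ({S ∈ U.powerset | G.IsIndepSet (S : Set V)} : Finset (Finset V)) card ⟨∅, by simp [SimpleGraph.IsIndepSet]⟩
    simp only [mem_filter, mem_powerset] at hS hmax
    have hcover : U ⊆ S.biUnion fun v => insert v {u ∈ U | G.Adj v u} := by
      intro x hx
      rw [mem_biUnion]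
      by_contra! hcon
      have hxS : x ∉ S := fun h => hcon x h (mem_insert_self _ _)
      have hadj : ∀ v ∈ S, ¬ G.Adj v x := fun v hv hvx =>
        hcon v hv (mem_insert_of_mem (mem_filter.2 ⟨hx, hvx⟩))
      have := hmax (insert x S) ⟨insert_subset hx hS.1, by
        intro a ha b hb hab
        simp only [coe_insert, Set.mem_insert_iff, mem_coe] at ha hb
        rcases ha with rfl | ha <;> rcases hb with rfl | hb
        · exact absurd rfl hab
        · exact fun h => hadj b hb h.symm
        · exact hadj a ha
        · exact hS.2 ha hb hab⟩
      rw [card_insert_of_notMem hxS] at this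
      omega
    have h1 : (#U : ℝ) ≤ ∑ v ∈ S, (#(insert v {u ∈ U | G.Adj v u}) : ℝ) := by
      exact_mod_cast (card_le_card hcover).trans card_biUnion_le
    have hp : (1 : ℝ) ≤ (2 * t) ^ s := one_le_pow₀ (by linarith)
    calc (#U : ℝ) ≤ ∑ v ∈ S, (#(insert v {u ∈ U | G.Adj v u}) : ℝ) := h1
      _ ≤ ∑ v ∈ S, (2 * (2 * t) ^ s) := by
          refine sum_le_sum fun v hv => ?_
          have h2 : (#(insert v {u ∈ U | G.Adj v u}) : ℝ) ≤ #{u ∈ U | G.Adj v u} + 1 := by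
            exact_mod_cast card_insert_le _ _
          have h3 := ih {u ∈ U | G.Adj v u} (hU.filter_adj (hS.1 hv))
            fun T hT => hind T (hT.trans (filter_subset _ _))
          linarith
      _ = #S * (2 * (2 * t) ^ s) := by rw [sum_const, nsmul_eq_mul]
      _ ≤ t * (2 * (2 * t) ^ s) := by
          gcongr
          exact hind S hS.1 hS.2
      _ = (2 * t) ^ (s + 1) := by ring

lemma Real.log_pow_le_mul_sqrt (k : ℕ) {t : ℝ} (ht : 1 ≤ t) :
    Real.log t ^ k ≤ 2 ^ k * k.factorial * √t := by
  have h0 : 0 ≤ Real.log t := Real.log_nonneg ht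
  have h := Real.pow_div_factorial_le_exp (Real.log t / 2) (by positivity) k
  rw [← Real.log_sqrt (by linarith), Real.exp_log (by positivity),
    Real.log_sqrt (by linarith), div_pow, div_div, div_le_iff₀ (by positivity)] at h
  linarith

open Finset in
/-- The Ajtai–Komlós–Szemerédi bound on the Ramsey numbers `R(k + 2, t)`. -/
lemma SimpleGraph.exists_card_mul_log_pow_le (k : ℕ) :
    ∃ C : ℝ, 1 ≤ C ∧ ∀ (V : Type) (G : SimpleGraph V) (t : ℝ) (U : Finset V), 2 ≤ t →
      G.CliqueFreeOn (U : Set V) (k + 2) →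
      (∀ S ⊆ U, G.IsIndepSet (S : Set V) → (#S : ℝ) ≤ t) →
      #U * Real.log t ^ k ≤ C * t ^ (k + 1) := by
  classical
  induction k with
  | zero =>
    refine ⟨1, le_rfl, fun V G t U ht hU hind => ?_⟩
    have := hind U Subset.rfl (by
      intro a ha b hb _ hadj
      exact hU (t := {a, b}) (by simp [Set.insert_subset_iff, mem_coe.1 ha, mem_coe.1 hb])
        ⟨by simpa [SimpleGraph.isClique_pair] using fun _ => hadj, card_pair hadj.ne⟩)
    simpa using this
  | succ k ih =>
    obtain ⟨C₀, hC₀, ih⟩ := ih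
    set C : ℝ := max C₀ (3 * 4 ^ k * k.factorial) with hC
    have hC1 : 1 ≤ C := hC₀.trans (le_max_left _ _)
    refine ⟨12 * C, by linarith, fun V G t U ht hU hind => ?_⟩
    have hlog : 0 < Real.log t := Real.log_pos (by linarith)
    have ht0 : 0 < t := by linarith
    set D : ℝ := C * t ^ (k + 1) / Real.log t ^ k with hD
    have hmain := G.card_mul_log_le_of_codegree_le U D (3 * (2 * t) ^ k) t (by positivity)
      (by
        have : (1 : ℝ) ≤ (2 * t) ^ k := one_le_pow₀ (by linarith)
        linarith)
      (by
        intro v hv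
        rw [hD, le_div_iff₀ (by positivity)]
        refine (ih V G t _ ht (hU.filter_adj hv)
          fun T hT => hind T (hT.trans (filter_subset _ _))).trans ?_
        gcongr
        exact le_max_left _ _)
      (by
        intro v hv u hu hvu
        have h1 : (1 : ℝ) ≤ (2 * t) ^ k := one_le_pow₀ (by linarith)
        have h2 := SimpleGraph.CliqueFreeOn.card_le_pow (G := G) (t := t) (by linarith) k
          {w ∈ {w ∈ U | G.Adj v w} | G.Adj u w}
          ((hU.filter_adj hv).filter_adj (mem_filter.2 ⟨hu, hvu⟩))
          fun T hT => hind T ((hT.trans (filter_subset _ _)).trans (filter_subset _ _))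
        rw [filter_filter] at h2
        linarith)
      hind
    have hsqrt : √t ≤ D / (3 * (2 * t) ^ k) := by
      have hl := Real.log_pow_le_mul_sqrt k (t := t) (by linarith)
      have hss : √t * √t = t := Real.mul_self_sqrt ht0.le
      rw [hD, div_div, le_div_iff₀ (by positivity)]
      calc √t * (Real.log t ^ k * (3 * (2 * t) ^ k))
          ≤ √t * ((2 ^ k * k.factorial * √t) * (3 * (2 * t) ^ k)) := by gcongr
        _ = (√t * √t) * (3 * (2 ^ k * 2 ^ k) * k.factorial) * t ^ k := by rw [mul_pow]; ring
        _ = (3 * 4 ^ k * k.factorial) * t ^ (k + 1) := by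
            rw [hss, ← mul_pow]; norm_num; ring
        _ ≤ C * t ^ (k + 1) := by
            gcongr
            exact le_max_right _ _
    have hlogle : Real.log t / 2 ≤ Real.log (D / (3 * (2 * t) ^ k)) := by
      rw [← Real.log_sqrt ht0.le]
      exact Real.log_le_log (by positivity) hsqrt
    have h3 : #U * (Real.log t / 2) ≤ 6 * D * t :=
      le_trans (by gcongr) hmain
    have h4 : D * Real.log t ^ k = C * t ^ (k + 1) := by
      rw [hD]; field_simp
    calc #U * Real.log t ^ (k + 1) = 2 * (#U * (Real.log t / 2)) * Real.log t ^ k := by ring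
      _ ≤ 2 * (6 * D * t) * Real.log t ^ k := by gcongr
      _ = 12 * t * (D * Real.log t ^ k) := by ring
      _ = 12 * C * t ^ (k + 1 + 1) := by rw [h4]; ring

/-- The subgraph induced on `U` can be properly coloured with `c` colours. -/
def SimpleGraph.ColorableOn {V : Type*} (G : SimpleGraph V) (U : Finset V) (c : ℕ) : Prop :=
  ∃ f : V → ℕ, (∀ u ∈ U, f u < c) ∧ ∀ u ∈ U, ∀ v ∈ U, G.Adj u v → f u ≠ f v

lemma SimpleGraph.ColorableOn.colorable {V : Type*} [Fintype V] {G : SimpleGraph V} {c : ℕ}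
    (h : G.ColorableOn Finset.univ c) : G.Colorable c := by
  obtain ⟨f, h1, h2⟩ := h
  exact ⟨SimpleGraph.Coloring.mk (fun v => (⟨f v, h1 v (Finset.mem_univ v)⟩ : Fin c))
    fun {u v} huv he => h2 u (Finset.mem_univ u) v (Finset.mem_univ v) huv (Fin.mk.inj he)⟩

open Finset in
lemma SimpleGraph.colorableOn_card {V : Type*} (G : SimpleGraph V) (U : Finset V) :
    G.ColorableOn U #U := by
  classical
  refine ⟨fun v => if h : v ∈ U then U.equivFin ⟨v, h⟩ else 0, ?_, ?_⟩
  · intro u hu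
    simp [hu]
  · intro u hu v hv huv he
    simp only [hu, hv, dite_true] at he
    have := U.equivFin.injective (Fin.ext he)
    exact huv.ne (congrArg Subtype.val this)

open Finset in
lemma SimpleGraph.ColorableOn.of_sdiff {V : Type*} [DecidableEq V] {G : SimpleGraph V}
    {U S : Finset V} {c : ℕ} (hS : G.IsIndepSet (S : Set V)) (h : G.ColorableOn (U \ S) c) :
    G.ColorableOn U (c + 1) := by
  obtain ⟨f, h1, h2⟩ := h
  refine ⟨fun v => if v ∈ S then c else f v, ?_, ?_⟩
  · intro u hu
    by_cases huS : u ∈ S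
    · simp [huS]
    · simpa [huS] using (h1 u (mem_sdiff.2 ⟨hu, huS⟩)).trans (Nat.lt_succ_self c)
  · intro u hu v hv huv
    by_cases huS : u ∈ S <;> by_cases hvS : v ∈ S
    · exact absurd huv (hS huS hvS huv.ne)
    · simpa [huS, hvS] using (h1 v (mem_sdiff.2 ⟨hv, hvS⟩)).ne'
    · simpa [huS, hvS] using (h1 u (mem_sdiff.2 ⟨hu, huS⟩)).ne
    · simpa [huS, hvS] using h2 u (mem_sdiff.2 ⟨hu, huS⟩) v (mem_sdiff.2 ⟨hv, hvS⟩) huv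

open Finset in
/-- Greedily removing independent sets of size at least `a` until at most `M` vertices remain. -/
lemma SimpleGraph.exists_colorableOn_of_extract {V : Type*} (G : SimpleGraph V) (M a q : ℝ)
    (ha : 0 < a) (hq : ∀ W : Finset V, (#W : ℝ) ≤ M → ∃ c : ℕ, G.ColorableOn W c ∧ (c : ℝ) ≤ q)
    (hext : ∀ W : Finset V, M < #W → ∃ S ⊆ W, G.IsIndepSet (S : Set V) ∧ a ≤ #S)
    (U : Finset V) : ∃ c : ℕ, G.ColorableOn U c ∧ (c : ℝ) ≤ #U / a + q := by
  classical
  induction U using Finset.strongInduction with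
  | H U ih =>
    by_cases hU : (#U : ℝ) ≤ M
    · obtain ⟨c, h1, h2⟩ := hq U hU
      have : 0 ≤ (#U : ℝ) / a := by positivity
      exact ⟨c, h1, by linarith⟩
    · obtain ⟨S, hSU, hS, haS⟩ := hext U (not_le.1 hU)
      have hS0 : S.Nonempty := by
        rw [← card_pos]
        exact_mod_cast ha.trans_le haS
      obtain ⟨c, h1, h2⟩ := ih (U \ S) (sdiff_ssubset hSU hS0)
      refine ⟨c + 1, h1.of_sdiff hS, ?_⟩
      have hc : (#(U \ S) : ℝ) = #U - #S := by
        rw [card_sdiff_of_subset hSU, Nat.cast_sub (card_le_card hSU)]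
      rw [hc, sub_div] at h2
      have : 1 ≤ (#S : ℝ) / a := (one_le_div ha).2 haS
      push_cast
      linarith

lemma Real.half_div_log_half_le {s : ℝ} (hs : 8 ≤ s) :
    s / 2 / Real.log (s / 2) ≤ 3 / 4 * (s / Real.log s) := by
  have h1 : 0 < Real.log s := Real.log_pos (by linarith)
  have h2 : 0 < Real.log (s / 2) := Real.log_pos (by linarith)
  have h3 : 2 * Real.log s ≤ 3 * Real.log (s / 2) := by
    have h4 : Real.log (s ^ 2) ≤ Real.log ((s / 2) ^ 3) :=
      Real.log_le_log (by positivity) (by nlinarith [sq_nonneg s])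
    rw [Real.log_pow, Real.log_pow] at h4
    exact_mod_cast h4
  rw [mul_div_assoc', div_le_div_iff₀ h2 h1]
  nlinarith

open Finset in
lemma SimpleGraph.exists_colorableOn_le (k : ℕ) :
    ∃ A : ℝ, 1 ≤ A ∧ ∀ (V : Type) [Fintype V] (G : SimpleGraph V) (t : ℝ), 2 ≤ t →
      G.CliqueFree (k + 3) →
      (∀ S : Finset V, G.IsIndepSet (S : Set V) → (#S : ℝ) ≤ t) →
      ∃ c : ℕ, G.Colorable c ∧ (c : ℝ) ≤ A * (t / Real.log t) ^ (k + 1) := by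
  obtain ⟨C, hC, hR⟩ := SimpleGraph.exists_card_mul_log_pow_le (k + 1)
  refine ⟨8 * C, by linarith, fun V _ G t ht hG hind => ?_⟩
  have hfree : ∀ U : Finset V, G.CliqueFreeOn (U : Set V) (k + 1 + 2) := fun U T _ hT => hG T hT
  have key : ∀ n : ℕ, ∀ s : ℝ, 2 ≤ s → s ≤ 8 * 2 ^ n → ∀ U : Finset V,
      (#U : ℝ) * Real.log s ^ (k + 1) ≤ C * s ^ (k + 1 + 1) →
      ∃ c : ℕ, G.ColorableOn U c ∧ (c : ℝ) ≤ 8 * C * (s / Real.log s) ^ (k + 1) := by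
    have small : ∀ s : ℝ, 2 ≤ s → s ≤ 8 → ∀ U : Finset V,
        (#U : ℝ) * Real.log s ^ (k + 1) ≤ C * s ^ (k + 1 + 1) →
        ∃ c : ℕ, G.ColorableOn U c ∧ (c : ℝ) ≤ 8 * C * (s / Real.log s) ^ (k + 1) := by
      intro s hs hs8 U hU
      have hl : 0 < Real.log s := Real.log_pos (by linarith)
      refine ⟨#U, G.colorableOn_card U, ?_⟩
      rw [div_pow, mul_div_assoc', le_div_iff₀ (by positivity)]
      calc _ ≤ C * s ^ (k + 1 + 1) := hU
        _ = s * (C * s ^ (k + 1)) := by ring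
        _ ≤ 8 * (C * s ^ (k + 1)) := by gcongr
        _ = _ := by ring
    intro n
    induction n with
    | zero => intro s hs hs8; exact small s hs (by simpa using hs8)
    | succ n ih =>
      intro s hs hsn U hU
      rcases le_total s 8 with hs8 | hs8
      · exact small s hs hs8 U hU
      have hl : 0 < Real.log s := Real.log_pos (by linarith)
      have hl2 : 0 < Real.log (s / 2) := Real.log_pos (by linarith)
      obtain ⟨c, hc, hcle⟩ := G.exists_colorableOn_of_extract
        (C * (s / 2) ^ (k + 1 + 1) / Real.log (s / 2) ^ (k + 1)) (s / 2)
        (8 * C * (s / 2 / Real.log (s / 2)) ^ (k + 1)) (by linarith)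
        (fun W hW => ih (s / 2) (by linarith) (by rw [pow_succ] at hsn; linarith) W
          ((le_div_iff₀ (by positivity)).1 hW))
        (fun W hW => by
          by_contra! hcon
          refine absurd ((div_lt_iff₀ (by positivity)).1 hW) (not_lt.2 ?_)
          exact hR V G (s / 2) W (by linarith) (hfree W) fun S hS h => (hcon S hS h).le)
        U
      refine ⟨c, hc, hcle.trans ?_⟩
      have h1 : (#U : ℝ) / (s / 2) ≤ 2 * C * (s / Real.log s) ^ (k + 1) := by
        rw [div_le_iff₀ (by linarith)]
        refine ((le_div_iff₀ (by positivity)).2 hU).trans (le_of_eq ?_)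
        rw [div_pow]
        ring
      have h2 : (s / 2 / Real.log (s / 2)) ^ (k + 1) ≤ 3 / 4 * (s / Real.log s) ^ (k + 1) := by
        calc _ ≤ (3 / 4 * (s / Real.log s)) ^ (k + 1) :=
              pow_le_pow_left₀ (by positivity) (Real.half_div_log_half_le hs8) _
          _ = (3 / 4) ^ (k + 1) * (s / Real.log s) ^ (k + 1) := mul_pow _ _ _
          _ ≤ 3 / 4 * (s / Real.log s) ^ (k + 1) := by
              gcongr
              exact pow_le_of_le_one (by norm_num) (by norm_num) (by omega)
      have h3 : 8 * C * (s / 2 / Real.log (s / 2)) ^ (k + 1) ≤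
          8 * C * (3 / 4 * (s / Real.log s) ^ (k + 1)) := by gcongr
      linarith
  obtain ⟨n, hn⟩ := pow_unbounded_of_one_lt t (by norm_num : (1 : ℝ) < 2)
  have hn8 : t ≤ 8 * 2 ^ n := by linarith
  obtain ⟨c, hc, hcle⟩ := key n t ht hn8 univ
    (hR V G t univ ht (hfree univ) fun S _ hS => hind S hS)
  exact ⟨c, hc.colorable, hcle⟩

/-- For each integer r ≥ 3 there exists c₂ > 0 such that every K_r-free graph G
with chromatic number χ ≥ 2 contains an independent set of size at least c₂·χ^{1/(r−2)}·log χ. -/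
theorem cliqueFree_large_independent_set (r : ℕ) (hr : 3 ≤ r) :
    ∃ c₂ : ℝ, 0 < c₂ ∧ ∀ (V : Type) [Fintype V] (G : SimpleGraph V) (χ : ℕ),
      G.CliqueFree r → G.chromaticNumber = χ → 2 ≤ χ →
      ∃ S : Finset V, (∀ u ∈ S, ∀ v ∈ S, ¬ G.Adj u v) ∧
        c₂ * (χ : ℝ) ^ (((r : ℝ) - 2)⁻¹) * Real.log χ ≤ S.card := by
  classical
  obtain ⟨k, rfl⟩ := Nat.exists_eq_add_of_le' hr
  obtain ⟨A, hA, hcol⟩ := SimpleGraph.exists_colorableOn_le k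
  have hexp : (((k + 3 : ℕ) : ℝ) - 2)⁻¹ = ((k + 1 : ℕ) : ℝ)⁻¹ := by
    push_cast
    congr 1
    ring
  rw [hexp]
  have hl2 : 0 < Real.log 2 := Real.log_pos (by norm_num)
  set K : ℝ := Real.log A / Real.log 2 + 2 * (k + 1 : ℕ) with hK
  have hlA : 0 ≤ Real.log A := Real.log_nonneg hA
  have hK0 : 0 < K := by positivity
  refine ⟨(2 * A * K)⁻¹, by positivity, fun V _ G χ hG hχ hχ2 => ?_⟩
  obtain ⟨S, hS, hmax⟩ := Finset.exists_max_image {S : Finset V | G.IsIndepSet (S : Set V)} Finset.card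
    ⟨∅, by simp [SimpleGraph.IsIndepSet]⟩
  simp only [Finset.mem_filter, Finset.mem_univ, true_and] at hS hmax
  refine ⟨S, fun u hu v hv huv => hS hu hv huv.ne huv, ?_⟩
  have hS1 : 1 ≤ S.card := by
    by_cases hV : Nonempty V
    · obtain ⟨v⟩ := hV
      simpa using hmax {v} (by simp [SimpleGraph.IsIndepSet])
    · have : IsEmpty V := not_nonempty_iff.1 hV
      rw [SimpleGraph.chromaticNumber_eq_zero_of_isEmpty] at hχ
      have : χ = 0 := by exact_mod_cast hχ.symm
      omega
  have hS1' : (1 : ℝ) ≤ S.card := by exact_mod_cast hS1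
  set t : ℝ := max S.card 2 with ht
  have ht2 : 2 ≤ t := le_max_right _ _
  have htS : t ≤ 2 * S.card := max_le (by linarith) (by linarith)
  obtain ⟨c, hc, hcle⟩ := hcol V G t ht2 hG fun T hT =>
    le_trans (by exact_mod_cast hmax T hT) (le_max_left _ _)
  have hlt : 0 < Real.log t := Real.log_pos (by linarith)
  have hl2t : Real.log 2 ≤ Real.log t := Real.log_le_log (by norm_num) ht2
  have hχc : (χ : ℝ) ≤ A * (t / Real.log t) ^ (k + 1) := by
    refine le_trans ?_ hcle
    have := hc.chromaticNumber_le
    rw [hχ] at this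
    exact_mod_cast this
  have hχ0 : (0 : ℝ) < χ := by
    have : 0 < χ := by omega
    exact_mod_cast this
  have hroot : (χ : ℝ) ^ ((k + 1 : ℕ) : ℝ)⁻¹ ≤ A * (t / Real.log t) := by
    have h1 : (χ : ℝ) ≤ (A * (t / Real.log t)) ^ (k + 1) := by
      rw [mul_pow]
      refine hχc.trans ?_
      gcongr
      exact le_self_pow₀ hA (by omega)
    calc (χ : ℝ) ^ ((k + 1 : ℕ) : ℝ)⁻¹
        ≤ ((A * (t / Real.log t)) ^ (k + 1)) ^ ((k + 1 : ℕ) : ℝ)⁻¹ :=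
          Real.rpow_le_rpow hχ0.le h1 (by positivity)
      _ = A * (t / Real.log t) :=
          Real.pow_rpow_inv_natCast (by positivity) (by omega)
  have hlogχ : Real.log χ ≤ K * Real.log t := by
    have h1 : t / Real.log t ≤ t ^ 2 := by
      rw [div_le_iff₀ hlt]
      have : 1 ≤ t * Real.log t := by
        have := Real.log_two_gt_d9
        nlinarith
      nlinarith
    have h2 : (χ : ℝ) ≤ A * (t ^ 2) ^ (k + 1) := hχc.trans (by gcongr)
    have h3 := Real.log_le_log hχ0 h2
    rw [Real.log_mul (by positivity) (by positivity), ← pow_mul, Real.log_pow] at h3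
    have h4 : Real.log A ≤ Real.log A / Real.log 2 * Real.log t := by
      rw [div_mul_eq_mul_div, le_div_iff₀ hl2]
      gcongr
    rw [hK, add_mul]
    push_cast at h3 ⊢
    linarith
  have hlogχ0 : 0 ≤ Real.log χ := Real.log_natCast_nonneg χ
  calc (2 * A * K)⁻¹ * (χ : ℝ) ^ ((k + 1 : ℕ) : ℝ)⁻¹ * Real.log χ
      ≤ (2 * A * K)⁻¹ * (A * (t / Real.log t)) * (K * Real.log t) := by gcongr
    _ = t / 2 := by field_simp
    _ ≤ S.card := by linarith
end

section
/- There exists a constant c > 0 such that every regular graph G that contains no cycle of length 4 as a subgraph and has chromatic number χ(G) > 2 contains an induced cycle of length at least c·χ(G)·log χ(G). -/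
/-- `G` has an induced cycle of length `ℓ`: a cycle whose support induces exactly the cycle. -/
def HasInducedCycleLen {V : Type} (G : SimpleGraph V) (ℓ : ℕ) : Prop :=
  ∃ (v : V) (w : G.Walk v v), w.IsCycle ∧ w.toSubgraph.IsInduced ∧ w.length = ℓ

namespace InducedCycle

open Finset SimpleGraph

section Sequences

variable {V : Type} {G : SimpleGraph V}

lemma cycleGraph_adj_of_lt {n : ℕ} {i j : Fin (n + 3)} (h : i < j) :
    (cycleGraph (n + 3)).Adj i j ↔ (j : ℕ) = i + 1 ∨ ((i : ℕ) = 0 ∧ (j : ℕ) = n + 2) := by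
  rw [cycleGraph_adj', Fin.sub_val_of_le h.le, Fin.coe_sub_iff_lt.mpr h]
  have := j.isLt
  have : (i : ℕ) < j := h
  omega

lemma cycleGraph_cycle_toSubgraph_adj {n : ℕ} {i j : Fin (n + 3)}
    (h : (cycleGraph (n + 3)).Adj i j) : (cycleGraph.cycle n).toSubgraph.Adj i j := by
  wlog hij : i < j generalizing i j
  · exact (this h.symm (lt_of_le_of_ne (not_lt.mp hij) h.ne')).symm
  rw [cycleGraph_adj_of_lt hij] at h
  have hj := j.isLt
  rcases h with h | ⟨h0, h1⟩
  · have key := (cycleGraph.cycle n).toSubgraph_adj_getVert (i := n + 3 - j)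
      (by rw [cycleGraph.length_cycle]; omega)
    rw [cycleGraph.getVert_cycle (by omega), cycleGraph.getVert_cycle (by omega)] at key
    convert key.symm using 1
    · ext
      simp only
      rw [Nat.mod_eq_of_lt (by omega)]
      omega
    · ext
      simp only
      rw [Nat.mod_eq_of_lt (by omega)]
      omega
  · have key := (cycleGraph.cycle n).toSubgraph_adj_getVert (i := 0)
      (by rw [cycleGraph.length_cycle]; omega)
    rw [cycleGraph.getVert_cycle (by omega), cycleGraph.getVert_cycle (by omega)] at key
    convert key using 1
    · ext
      simp [h0]
    · ext
      simp only
      rw [Nat.mod_eq_of_lt (by omega)]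
      omega

lemma hasInducedCycleLen_of_embedding {n : ℕ} (φ : cycleGraph (n + 3) ↪g G) :
    HasInducedCycleLen G (n + 3) := by
  refine ⟨_, (cycleGraph.cycle n).map φ.toHom,
    Walk.IsCycle.map φ.injective cycleGraph.isCycle_cycle, ?_, by simp⟩
  intro x hx y hy hxy
  rw [Walk.toSubgraph_map] at hx hy ⊢
  obtain ⟨i, -, rfl⟩ := hx
  obtain ⟨j, -, rfl⟩ := hy
  exact ⟨i, j, cycleGraph_cycle_toSubgraph_adj (φ.map_adj_iff.mp hxy), rfl, rfl⟩

lemma hasInducedCycleLen_of_seq {n : ℕ} {f : ℕ → V}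
    (hinj : ∀ i j, i < j → j < n + 3 → f i ≠ f j)
    (hadj : ∀ i j, i < j → j < n + 3 →
      (G.Adj (f i) (f j) ↔ j = i + 1 ∨ (i = 0 ∧ j = n + 2))) :
    HasInducedCycleLen G (n + 3) := by
  refine hasInducedCycleLen_of_embedding
    ⟨⟨fun i : Fin (n + 3) => f i, fun i j hij => ?_⟩, fun {i j} => ?_⟩
  · by_contra hne
    rcases lt_or_gt_of_ne hne with h | h
    · exact hinj i j h j.isLt hij
    · exact hinj j i h i.isLt hij.symm
  · change G.Adj (f i) (f j) ↔ _
    rcases lt_trichotomy i j with h | h | h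
    · rw [cycleGraph_adj_of_lt h, hadj i j h j.isLt]
    · simp [h]
    · rw [G.adj_comm, (cycleGraph (n + 3)).adj_comm, cycleGraph_adj_of_lt h, hadj j i h i.isLt]

/-- The sequence `p 0, …, p (k - 1)` is an induced path of `G`. -/
def IsInducedPath (G : SimpleGraph V) (p : ℕ → V) (k : ℕ) : Prop :=
  ∀ i j, i < j → j < k → p i ≠ p j ∧ (G.Adj (p i) (p j) ↔ j = i + 1)

lemma isInducedPath_getVert_of_length_eq_dist {a b : V} (w : G.Walk a b)
    (hw : w.length = G.dist a b) : IsInducedPath G w.getVert (w.length + 1) := by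
  intro i j hij hj
  refine ⟨fun h => ?_, fun h => ?_, fun h => ?_⟩
  · have := G.dist_le (((w.take i).copy rfl h).append (w.drop j))
    rw [Walk.length_append, Walk.length_copy, Walk.take_length, Walk.drop_length] at this
    omega
  · have := G.dist_le ((w.take i).append (Walk.cons h (w.drop j)))
    rw [Walk.length_append, Walk.length_cons, Walk.take_length, Walk.drop_length] at this
    omega
  · subst h
    exact w.adj_getVert_succ (by omega)

lemma exists_hasInducedCycleLen_of_not_isAcyclic (h : ¬ G.IsAcyclic) :
    ∃ ℓ, 3 ≤ ℓ ∧ HasInducedCycleLen G ℓ := by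
  rw [isAcyclic_iff_forall_adj_isBridge] at h
  push Not at h
  obtain ⟨a, b, hab, h⟩ := h
  rw [isBridge_iff, not_not] at h
  obtain ⟨w, hw⟩ := h.exists_walk_length_eq_dist
  have hp := isInducedPath_getVert_of_length_eq_dist w hw
  have hadj : ∀ x y, (G.deleteEdges {s(a, b)}).Adj x y ↔
      G.Adj x y ∧ ¬ (x = a ∧ y = b ∨ x = b ∧ y = a) := by
    intro x y
    simp [deleteEdges_adj]
  have h0 : w.getVert 0 = a := w.getVert_zero
  have h1 : w.getVert w.length = b := w.getVert_length
  have hlen : 2 ≤ w.length := by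
    by_contra hlt
    have : w.length = 0 ∨ w.length = 1 := by omega
    rcases this with h | h
    · rw [h, h0] at h1
      exact hab.ne h1
    · have := (hp 0 1 (by omega) (by omega)).2.mpr rfl
      rw [h] at h1
      rw [h0, h1, hadj] at this
      tauto
  obtain ⟨n, hn⟩ : ∃ n, w.length = n + 2 := ⟨w.length - 2, by omega⟩
  have hinj := fun i j hij hj => (hp i j hij hj).1
  refine ⟨n + 3, by omega, hasInducedCycleLen_of_seq (f := w.getVert)
    (fun i j hij hj => hinj i j hij (by omega)) fun i j hij hj => ?_⟩
  rw [← (hp i j hij (by omega)).2, hadj]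
  constructor
  · intro h
    by_contra hcon
    push Not at hcon
    rcases hcon.1 h with ⟨hi, hj'⟩ | ⟨hi, hj'⟩
    · have hi0 : i = 0 := by
        by_contra hne
        exact hinj 0 i (by omega) (by omega) (by rw [h0, hi])
      have hjl : j = w.length := by
        by_contra hne
        exact hinj j w.length (by omega) (by omega) (by rw [h1, hj'])
      exact hcon.2 hi0 (by omega)
    · exact hinj 0 j (by omega) (by omega) (by rw [h0, hj'])
  · rintro (h | ⟨rfl, rfl⟩)
    · exact h.1
    · rw [h0, ← hn, h1]
      exact hab

/-- An induced path whose ends are joined outside the closed neighbourhoods of its interior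
vertices extends to an induced cycle. -/
lemma exists_hasInducedCycleLen_of_isInducedPath {p : ℕ → V} {m : ℕ}
    (hp : IsInducedPath G p (m + 3)) {M : Set V}
    (hM : ∀ x ∈ M, x ≠ p 0 → x ≠ p (m + 2) →
      ∀ i, 0 < i → i < m + 2 → x ≠ p i ∧ ¬ G.Adj (p i) x)
    {H : SimpleGraph V} (hH : ∀ x y, H.Adj x y ↔ G.Adj x y ∧ x ∈ M ∧ y ∈ M)
    (hreach : H.Reachable (p 0) (p (m + 2))) :
    ∃ ℓ, m + 3 ≤ ℓ ∧ HasInducedCycleLen G ℓ := by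
  obtain ⟨w, hw⟩ := hreach.symm.exists_walk_length_eq_dist
  have hq := isInducedPath_getVert_of_length_eq_dist w hw
  have h0 : w.getVert 0 = p (m + 2) := w.getVert_zero
  have h1 : w.getVert w.length = p 0 := w.getVert_length
  have hends := hp 0 (m + 2) (by omega) (by omega)
  have hlen : 2 ≤ w.length := by
    by_contra hlt
    have : w.length = 0 ∨ w.length = 1 := by omega
    rcases this with h | h
    · rw [h, h0] at h1
      exact hends.1 h1.symm
    · have := (hq 0 1 (by omega) (by omega)).2.mpr rfl
      rw [h] at h1
      rw [h0, h1, hH] at this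
      have := hends.2.mp this.1.symm
      omega
  have hmem : ∀ i, i ≤ w.length → w.getVert i ∈ M := by
    intro i hi
    rcases Nat.lt_or_ge i w.length with h | h
    · exact ((hH _ _).mp (w.adj_getVert_succ h)).2.1
    · obtain rfl : i = w.length := by omega
      have := ((hH _ _).mp (w.adj_getVert_succ (i := w.length - 1) (by omega))).2.2
      rwa [Nat.sub_add_cancel (by omega)] at this
  have hqG : ∀ i j, i < j → j ≤ w.length → w.getVert i ≠ w.getVert j ∧
      (G.Adj (w.getVert i) (w.getVert j) ↔ j = i + 1) := by
    intro i j hij hj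
    refine ⟨(hq i j hij (by omega)).1, ?_⟩
    rw [← (hq i j hij (by omega)).2, hH]
    exact ⟨fun h => ⟨h, hmem _ (by omega), hmem _ hj⟩, fun h => h.1⟩
  have hcross : ∀ i j, 0 < i → i < m + 2 → 0 < j → j < w.length →
      p i ≠ w.getVert j ∧ ¬ G.Adj (p i) (w.getVert j) := by
    intro i j hi hi' hj hj'
    have := hM _ (hmem j (by omega)) (fun h => (hqG j _ hj' le_rfl).1 (h.trans h1.symm))
      (fun h => (hqG 0 j hj (by omega)).1 (h0.trans h.symm)) i hi hi'
    exact ⟨this.1.symm, this.2⟩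
  obtain ⟨t, ht⟩ : ∃ t, w.length = t + 2 := ⟨w.length - 2, by omega⟩
  have key : ∀ i j, i < j → j < (m + t + 1) + 3 →
      (if i ≤ m + 2 then p i else w.getVert (i - (m + 2))) ≠
        (if j ≤ m + 2 then p j else w.getVert (j - (m + 2))) ∧
      (G.Adj (if i ≤ m + 2 then p i else w.getVert (i - (m + 2)))
        (if j ≤ m + 2 then p j else w.getVert (j - (m + 2))) ↔
          j = i + 1 ∨ (i = 0 ∧ j = (m + t + 1) + 2)) := by
    intro i j hij hj
    by_cases hj2 : j ≤ m + 2
    · rw [if_pos (by omega), if_pos hj2]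
      refine ⟨(hp i j hij (by omega)).1, ?_⟩
      rw [(hp i j hij (by omega)).2]
      omega
    rw [if_neg hj2]
    by_cases hi2 : m + 2 ≤ i
    · have : (if i ≤ m + 2 then p i else w.getVert (i - (m + 2))) =
          w.getVert (i - (m + 2)) := by
        split_ifs with h
        · obtain rfl : i = m + 2 := by omega
          rw [Nat.sub_self, h0]
        · rfl
      rw [this]
      refine ⟨(hqG _ _ (by omega) (by omega)).1, ?_⟩
      rw [(hqG _ _ (by omega) (by omega)).2]
      omega
    rw [if_pos (by omega)]
    rcases Nat.eq_zero_or_pos i with rfl | hi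
    · have := hqG (j - (m + 2)) w.length (by omega) le_rfl
      rw [h1] at this
      refine ⟨this.1.symm, ?_⟩
      rw [G.adj_comm, this.2]
      omega
    · have := hcross i (j - (m + 2)) hi (by omega) (by omega) (by omega)
      refine ⟨this.1, iff_of_false this.2 (by omega)⟩
  exact ⟨(m + t + 1) + 3, by omega, hasInducedCycleLen_of_seq
    (f := fun i => if i ≤ m + 2 then p i else w.getVert (i - (m + 2)))
    (fun i j hij hj => (key i j hij hj).1) (fun i j hij hj => (key i j hij hj).2)⟩

end Sequences

section LongCycle

variable {V : Type} {G : SimpleGraph V}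

/-- No two distinct vertices of `G` have two distinct common neighbours. -/
def FourCycleFree (G : SimpleGraph V) : Prop :=
  ∀ a b x y, a ≠ b → G.Adj a x → G.Adj a y → G.Adj b x → G.Adj b y → x = y

variable [DecidableRel G.Adj]

lemma FourCycleFree.card_common_le (hC : FourCycleFree G) {a b : V} (hab : a ≠ b)
    (Y : Finset V) : #{y ∈ Y | G.Adj a y ∧ G.Adj b y} ≤ 1 := by
  rw [card_le_one]
  intro x hx y hy
  rw [mem_filter] at hx hy
  exact hC a b x y hab hx.2.1 hy.2.1 hx.2.2 hy.2.2

/-- The number of pairs `(x, y) ∈ X × Y` of adjacent vertices. -/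
def edgeCount (G : SimpleGraph V) [DecidableRel G.Adj] (X Y : Finset V) : ℕ :=
  ∑ x ∈ X, #{y ∈ Y | G.Adj x y}

lemma edgeCount_comm (X Y : Finset V) : edgeCount G X Y = edgeCount G Y X := by
  simp only [edgeCount, card_filter]
  rw [sum_comm]
  simp only [G.adj_comm]

lemma edgeCount_mono {X X' Y Y' : Finset V} (hX : X ⊆ X') (hY : Y ⊆ Y') :
    edgeCount G X Y ≤ edgeCount G X' Y' :=
  (sum_le_sum fun _ _ => card_le_card (filter_subset_filter _ hY)).trans
    (sum_le_sum_of_subset hX)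

lemma edgeCount_le_card_mul_card (X Y : Finset V) : edgeCount G X Y ≤ #X * #Y := by
  rw [← smul_eq_mul]
  exact sum_le_card_nsmul _ _ _ fun _ _ => card_filter_le _ _

lemma edgeCount_univ [Fintype V] {d : ℕ} (hG : ∀ v, #{y | G.Adj v y} = d) (X : Finset V) :
    edgeCount G X univ = d * #X := by
  rw [edgeCount, sum_congr rfl fun v _ => hG v, sum_const, smul_eq_mul, mul_comm]

lemma edgeCount_le [Fintype V] {d : ℕ} (hG : ∀ v, #{y | G.Adj v y} = d) (X Y : Finset V) :
    edgeCount G X Y ≤ d * #X :=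
  (edgeCount_mono subset_rfl (subset_univ Y)).trans (edgeCount_univ hG X).le

variable [DecidableEq V]

lemma edgeCount_union_left {X X' : Finset V} (h : Disjoint X X') (Y : Finset V) :
    edgeCount G (X ∪ X') Y = edgeCount G X Y + edgeCount G X' Y :=
  sum_union h

lemma edgeCount_union_right (X : Finset V) {Y Y' : Finset V} (h : Disjoint Y Y') :
    edgeCount G X (Y ∪ Y') = edgeCount G X Y + edgeCount G X Y' := by
  rw [edgeCount_comm, edgeCount_union_left h, edgeCount_comm Y, edgeCount_comm Y']

lemma FourCycleFree.edgeCount_sq_le (hC : FourCycleFree G) (X Y : Finset V) :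
    edgeCount G X Y ^ 2 ≤ #Y * (#X ^ 2 + edgeCount G X Y) := by
  have h1 : edgeCount G X Y ^ 2 ≤ #Y * ∑ y ∈ Y, #{x ∈ X | G.Adj y x} ^ 2 := by
    rw [edgeCount_comm]
    exact_mod_cast sq_sum_le_card_mul_sum_sq (s := Y) (f := fun y => #{x ∈ X | G.Adj y x})
  refine h1.trans (Nat.mul_le_mul_left _ ?_)
  have h2 : ∀ y ∈ Y, #{x ∈ X | G.Adj y x} ^ 2 =
      ∑ x ∈ X, ∑ x' ∈ X, if G.Adj x y ∧ G.Adj x' y then 1 else 0 := by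
    intro y _
    rw [card_filter, sq, sum_mul_sum]
    refine sum_congr rfl fun x _ => sum_congr rfl fun x' _ => ?_
    simp only [G.adj_comm y]
    split_ifs <;> simp_all
  have h3 : ∀ x ∈ X, ∑ x' ∈ X, #{y ∈ Y | G.Adj x y ∧ G.Adj x' y} ≤
      #X + #{y ∈ Y | G.Adj x y} := by
    intro x hx
    rw [← add_sum_erase _ _ hx, add_comm]
    refine add_le_add ?_ (by simp)
    refine (sum_le_card_nsmul _ _ 1 fun x' hx' => ?_).trans ?_
    · exact hC.card_common_le (ne_of_mem_erase hx').symm Y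
    · simpa using card_erase_le
  calc ∑ y ∈ Y, #{x ∈ X | G.Adj y x} ^ 2
      = ∑ y ∈ Y, ∑ x ∈ X, ∑ x' ∈ X, if G.Adj x y ∧ G.Adj x' y then 1 else 0 :=
        sum_congr rfl h2
    _ = ∑ x ∈ X, ∑ x' ∈ X, #{y ∈ Y | G.Adj x y ∧ G.Adj x' y} := by
        rw [sum_comm]
        refine sum_congr rfl fun x _ => ?_
        rw [sum_comm]
        simp only [card_filter]
    _ ≤ ∑ x ∈ X, (#X + #{y ∈ Y | G.Adj x y}) := sum_le_sum h3
    _ = #X ^ 2 + edgeCount G X Y := by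
        rw [sum_add_distrib, sum_const, smul_eq_mul, sq, edgeCount]

lemma FourCycleFree.seven_mul_card_le (hC : FourCycleFree G) {d : ℕ} (hd : 0 < d)
    {X Z : Finset V} (hZ : 32 * #Z ≤ d ^ 2) (hle : d * #X ≤ 2 * edgeCount G X Z)
    (hge : edgeCount G X Z ≤ d * #X) : 7 * #X ≤ d := by
  have h := hC.edgeCount_sq_le X Z
  rcases Nat.eq_zero_or_pos #X with h0 | h0
  · omega
  have h1 : 32 * edgeCount G X Z ^ 2 ≤ d ^ 2 * (#X ^ 2 + d * #X) :=
    calc 32 * edgeCount G X Z ^ 2 ≤ 32 * (#Z * (#X ^ 2 + edgeCount G X Z)) := by gcongr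
      _ = (32 * #Z) * (#X ^ 2 + edgeCount G X Z) := by ring
      _ ≤ d ^ 2 * (#X ^ 2 + d * #X) := by gcongr
  have h2 : (d * #X) ^ 2 ≤ (2 * edgeCount G X Z) ^ 2 := by gcongr
  have h3 : (d ^ 2 * #X) * (7 * #X) ≤ (d ^ 2 * #X) * d := by nlinarith
  exact Nat.le_of_mul_le_mul_left h3 (by positivity)

lemma FourCycleFree.two_mul_edgeCount_self_lt (hC : FourCycleFree G) {d : ℕ} (hd : 0 < d)
    {X : Finset V} (hX : X.Nonempty) (hcard : 64 * #X ≤ d ^ 2)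
    (hge : edgeCount G X X ≤ d * #X) : 2 * edgeCount G X X < d * #X := by
  by_contra hcon
  have h7 := hC.seven_mul_card_le hd (by omega) (not_lt.mp hcon) hge
  have h1 := edgeCount_le_card_mul_card (G := G) X X
  have := hX.card_pos
  nlinarith

/-- In a graph with large minimum degree inside `A`, induced paths can be grown greedily. -/
lemma FourCycleFree.exists_isInducedPath (hC : FourCycleFree G) {d : ℕ} {A : Finset V}
    (hne : A.Nonempty) (hA : ∀ v ∈ A, d ≤ 2 * #{y ∈ A | G.Adj v y}) (k : ℕ) (hk : 4 * k < d) :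
    ∃ p : ℕ → V, IsInducedPath G p (k + 1) ∧ ∀ i, i < k + 1 → p i ∈ A := by
  induction k with
  | zero =>
    obtain ⟨v, hv⟩ := hne
    exact ⟨fun _ => v, fun i j _ _ => by omega, fun _ _ => hv⟩
  | succ k ih =>
    obtain ⟨p, hp, hpA⟩ := ih (by omega)
    let E := (range k).biUnion fun i => insert (p i) {y ∈ A | G.Adj (p k) y ∧ G.Adj (p i) y}
    have hE : #E ≤ k * 2 := by
      refine (card_biUnion_le_card_mul _ _ 2 fun i hi => ?_).trans (by simp)
      rw [mem_range] at hi
      have := hC.card_common_le (hp i k hi (by omega)).1.symm A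
      exact (card_insert_le _ _).trans (by omega)
    obtain ⟨x, hx, hxE⟩ := exists_mem_notMem_of_card_lt_card
      (s := E) (t := {y ∈ A | G.Adj (p k) y}) (by have := hA _ (hpA k (by omega)); omega)
    rw [mem_filter] at hx
    have hxE' : ∀ i, i < k → p i ≠ x ∧ ¬ G.Adj (p i) x := by
      intro i hi
      simp only [E, mem_biUnion, mem_range, mem_insert, mem_filter, not_exists, not_and,
        not_or] at hxE
      exact ⟨fun h => (hxE i hi).1 h.symm, (hxE i hi).2 hx.1 hx.2⟩
    refine ⟨fun i => if i < k + 1 then p i else x, fun i j hij hj => ?_, fun i hi => ?_⟩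
    · simp only
      rw [if_pos (by omega : i < k + 1)]
      split_ifs with h
      · exact hp i j hij h
      · rcases Nat.lt_or_ge i k with hik | hik
        · exact ⟨(hxE' i hik).1, iff_of_false (hxE' i hik).2 (by omega)⟩
        · obtain rfl : i = k := by omega
          exact ⟨hx.2.ne, iff_of_true hx.2 (by omega)⟩
    · simp only
      split_ifs with h
      · exact hpA i h
      · exact hx.1

variable [Fintype V]

lemma edgeCount_self_add_compl {d : ℕ} (hG : ∀ v, #{y | G.Adj v y} = d) (X : Finset V) :
    edgeCount G X X + edgeCount G X Xᶜ = d * #X := by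
  rw [← edgeCount_univ hG, ← edgeCount_union_right X disjoint_compl_right, union_compl]

/-- A `C₄`-free `d`-regular graph has a vertex set of large minimum degree in which every sparse
cut has a small side. -/
lemma FourCycleFree.exists_wellConnected (hC : FourCycleFree G) [Nonempty V] {d : ℕ}
    (hd : 12 ≤ d) (hG : ∀ v, #{y | G.Adj v y} = d) :
    ∃ A : Finset V, A.Nonempty ∧ (∀ v ∈ A, d ≤ 2 * #{y ∈ A | G.Adj v y}) ∧
      ∀ U ⊆ A, 512 * edgeCount G U (A \ U) ≤ d ^ 3 →
        64 * #U ≤ d ^ 2 ∨ 64 * #(A \ U) ≤ d ^ 2 := by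
  let F : Finset (Finset V) :=
    {A | d ^ 2 < 64 * #A ∧ 256 * edgeCount G A Aᶜ ≤ d ^ 3}
  have hF : F.Nonempty := by
    refine ⟨univ, mem_filter.mpr ⟨mem_univ _, ?_, by simp [edgeCount]⟩⟩
    by_contra hcon
    have := hC.two_mul_edgeCount_self_lt (by omega) univ_nonempty (not_lt.mp hcon)
      (edgeCount_le hG _ _)
    rw [edgeCount_univ hG] at this
    omega
  obtain ⟨A, hAF, hmin⟩ := exists_min_image F card hF
  obtain ⟨-, hA1, hA2⟩ := mem_filter.mp hAF
  have hsmall : ∀ X ⊆ A, X ≠ A → 256 * edgeCount G X Xᶜ ≤ d ^ 3 → 64 * #X ≤ d ^ 2 := by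
    intro X hXA hne hX
    by_contra hcon
    have h1 := hmin X (mem_filter.mpr ⟨mem_univ _, not_le.mp hcon, hX⟩)
    exact hne (eq_of_subset_of_card_le hXA h1)
  refine ⟨A, card_pos.mp (by have := Nat.zero_le (d ^ 2); omega), fun v hv => ?_,
    fun U hUA hU => ?_⟩
  · by_contra hcon
    let X := A.erase v
    have hXA : insert v X = A := insert_erase hv
    have hvX : v ∉ X := notMem_erase v A
    have hcard : #A = #X + 1 := by rw [← hXA, card_insert_of_notMem hvX]
    have hdisj : Disjoint {v} X := disjoint_singleton_left.mpr hvX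
    have hvv : edgeCount G {v} A = #{y ∈ A | G.Adj v y} := by simp [edgeCount]
    have hv1 : edgeCount G {v} X ≤ #{y ∈ A | G.Adj v y} := by
      rw [← hvv]
      exact edgeCount_mono subset_rfl (erase_subset _ _)
    have hAA : edgeCount G A A = edgeCount G {v} A + (edgeCount G {v} X + edgeCount G X X) := by
      conv_lhs => rw [← hXA, insert_eq, edgeCount_union_left hdisj]
      rw [← insert_eq, hXA]
      congr 1
      conv_lhs => rw [← hXA, insert_eq, edgeCount_union_right X hdisj, edgeCount_comm X]
    have e1 := edgeCount_self_add_compl hG A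
    have e2 := edgeCount_self_add_compl hG X
    rw [hcard, mul_add, mul_one] at e1
    have hX : 256 * edgeCount G X Xᶜ ≤ d ^ 3 := by omega
    have h64 := hsmall X (erase_subset _ _) (fun h => hvX (h ▸ hv)) hX
    have hXne : X.Nonempty := card_pos.mp (by nlinarith)
    have h2 := hC.two_mul_edgeCount_self_lt (by omega) hXne h64 (edgeCount_le hG _ _)
    have h3 : d * (128 * #X) < d * d ^ 2 := by
      have : d * d ^ 2 = d ^ 3 := by ring
      nlinarith
    have h4 := Nat.lt_of_mul_lt_mul_left h3
    nlinarith
  · have hdisj : Disjoint U (A \ U) := disjoint_sdiff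
    have hunion : U ∪ A \ U = A := union_sdiff_of_subset hUA
    have c1 : Uᶜ = (A \ U) ∪ Aᶜ := by
      ext x
      have := @hUA x
      simp only [mem_compl, mem_union, mem_sdiff]
      tauto
    have c2 : (A \ U)ᶜ = U ∪ Aᶜ := by
      ext x
      have := @hUA x
      simp only [mem_compl, mem_union, mem_sdiff]
      tauto
    have e1 : edgeCount G U Uᶜ = edgeCount G U (A \ U) + edgeCount G U Aᶜ := by
      rw [c1, edgeCount_union_right]
      exact disjoint_compl_right.mono_left sdiff_subset
    have e2 : edgeCount G (A \ U) (A \ U)ᶜ = edgeCount G U (A \ U) + edgeCount G (A \ U) Aᶜ := by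
      rw [c2, edgeCount_union_right, edgeCount_comm _ U]
      exact disjoint_compl_right.mono_left hUA
    have e3 : edgeCount G A Aᶜ = edgeCount G U Aᶜ + edgeCount G (A \ U) Aᶜ := by
      rw [← edgeCount_union_left hdisj, hunion]
    rcases eq_or_ne U A with rfl | hUne
    · right
      simp
    rcases eq_or_ne (A \ U) A with hUe | hUe
    · left
      have : U = ∅ := by
        rw [Finset.sdiff_eq_self_iff_disjoint] at hUe
        exact disjoint_self.mp (hUe.mono_left hUA)
      simp [this]
    rcases le_total (edgeCount G U Uᶜ) (edgeCount G (A \ U) (A \ U)ᶜ) with h | h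
    · exact Or.inl (hsmall U hUA hUne (by omega))
    · exact Or.inr (hsmall _ sdiff_subset hUe (by omega))

lemma FourCycleFree.exists_long_hasInducedCycleLen (hC : FourCycleFree G) [Nonempty V] {d : ℕ}
    (hG : ∀ v, #{y | G.Adj v y} = d) {m : ℕ} (hm : 1024 * (m + 3) ≤ d) :
    ∃ ℓ, m + 3 ≤ ℓ ∧ HasInducedCycleLen G ℓ := by
  classical
  obtain ⟨A, hne, hdeg, hcut⟩ := hC.exists_wellConnected (by omega) hG
  obtain ⟨p, hp, hpA⟩ := hC.exists_isInducedPath hne hdeg (m + 2) (by omega)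
  let B : Finset V := (Ioo 0 (m + 2)).biUnion fun i => insert (p i) ({y | G.Adj (p i) y} : Finset V)
  have hB : #B ≤ (m + 1) * (d + 1) := by
    refine (card_biUnion_le_card_mul _ _ (d + 1) fun i _ => ?_).trans (by simp)
    exact (card_insert_le _ _).trans (by rw [hG])
  have hBd : 512 * #B ≤ d ^ 2 := by nlinarith
  let M : Set V := {x | x ∈ A ∧ (x ∉ B ∨ x = p 0 ∨ x = p (m + 2))}
  let H : SimpleGraph V :=
    { Adj := fun x y => G.Adj x y ∧ x ∈ M ∧ y ∈ M
      symm := ⟨fun _ _ h => ⟨h.1.symm, h.2.2, h.2.1⟩⟩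
      loopless := ⟨fun _ h => h.1.ne rfl⟩ }
  have hH : ∀ x y, H.Adj x y ↔ G.Adj x y ∧ x ∈ M ∧ y ∈ M := fun _ _ => Iff.rfl
  by_cases hreach : H.Reachable (p 0) (p (m + 2))
  · refine exists_hasInducedCycleLen_of_isInducedPath hp ?_ hH hreach
    rintro x ⟨-, hx⟩ h0 h1 i hi hi'
    have hxB : x ∉ B := by tauto
    simp only [B, mem_biUnion, mem_Ioo, mem_insert, mem_filter, mem_univ, true_and, not_exists,
      not_and, not_or] at hxB
    exact hxB i ⟨hi, hi'⟩
  exfalso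
  have hp0 : p 0 ∈ A := hpA 0 (by omega)
  have hp1 : p (m + 2) ∈ A := hpA _ (by omega)
  let U : V → Finset V := fun z => {x | H.Reachable z x}
  have hUM : ∀ z, z ∈ M → ∀ x ∈ U z, x ∈ M := by
    intro z hz x hx
    obtain ⟨w⟩ := (mem_filter.mp hx).2
    rcases w.reverse with _ | ⟨h, _⟩
    · exact hz
    · exact h.2.1
  have hclosed : ∀ z, z ∈ M → ∀ x ∈ U z, ∀ y ∈ A, G.Adj x y → y ∈ U z ∪ B := by
    intro z hz x hx y hy hxy
    rw [mem_union]
    by_contra hcon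
    rw [not_or] at hcon
    refine hcon.1 (mem_filter.mpr ⟨mem_univ _, (mem_filter.mp hx).2.trans ?_⟩)
    exact SimpleGraph.Adj.reachable ((hH x y).mpr ⟨hxy, hUM z hz x hx, hy, Or.inl hcon.2⟩)
  have hUcut : ∀ z, z ∈ M → 512 * edgeCount G (U z) (A \ U z) ≤ d ^ 3 := by
    intro z hz
    have h1 : edgeCount G (U z) (A \ U z) ≤ edgeCount G (U z) B := by
      refine sum_le_sum fun x hx => card_le_card fun y hy => ?_
      rw [mem_filter, mem_sdiff] at hy
      rw [mem_filter]
      have := mem_union.mp (hclosed z hz x hx y hy.1.1 hy.2)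
      exact ⟨this.resolve_left hy.1.2, hy.2⟩
    rw [edgeCount_comm _ B] at h1
    have h2 := edgeCount_le hG B (U z)
    have : d * (512 * #B) ≤ d * d ^ 2 := Nat.mul_le_mul_left _ hBd
    nlinarith
  have hlarge : ∀ z, z ∈ M → (∀ i, 0 < i → i < m + 2 → z ≠ p i) → ¬ 64 * #(U z) ≤ d ^ 2 := by
    intro z hz hzp hsmall
    have hcard : 32 * #(U z ∪ B) ≤ d ^ 2 := by
      have := card_union_le (U z) B
      omega
    have hle : d * #(U z) ≤ 2 * edgeCount G (U z) (U z ∪ B) := by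
      rw [edgeCount, mul_sum, mul_comm, ← smul_eq_mul]
      refine card_nsmul_le_sum _ _ _ fun x hx => (hdeg x (hUM z hz x hx).1).trans ?_
      refine Nat.mul_le_mul_left _ (card_le_card fun y hy => ?_)
      rw [mem_filter] at hy ⊢
      exact ⟨hclosed z hz x hx y hy.1 hy.2, hy.2⟩
    have h7 := hC.seven_mul_card_le (by omega) hcard hle (edgeCount_le hG _ _)
    have hzU : z ∈ U z := mem_filter.mpr ⟨mem_univ _, Reachable.refl z⟩
    let C : Finset V :=
      (Ioo 0 (m + 2)).biUnion fun i => insert (p i) {y ∈ A | G.Adj z y ∧ G.Adj (p i) y}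
    have hCc : #C ≤ (m + 1) * 2 := by
      refine (card_biUnion_le_card_mul _ _ 2 fun i hi => ?_).trans (by simp)
      rw [mem_Ioo] at hi
      have := hC.card_common_le (hzp i hi.1 hi.2) A
      exact (card_insert_le _ _).trans (by omega)
    have hsub : ({y ∈ A | G.Adj z y} : Finset V) ⊆ U z ∪ C := by
      intro y hy
      rw [mem_filter] at hy
      rcases mem_union.mp (hclosed z hz z hzU y hy.1 hy.2) with h | h
      · exact mem_union_left _ h
      · refine mem_union_right _ ?_
        simp only [B, mem_biUnion, mem_insert, mem_filter, mem_univ, true_and] at h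
        obtain ⟨i, hi, h⟩ := h
        refine mem_biUnion.mpr ⟨i, hi, ?_⟩
        rw [mem_insert, mem_filter]
        tauto
    have h1 := (card_le_card hsub).trans (card_union_le _ _)
    have h2 := hdeg z hz.1
    omega
  have hM0 : p 0 ∈ M := ⟨hp0, Or.inr (Or.inl rfl)⟩
  have hM1 : p (m + 2) ∈ M := ⟨hp1, Or.inr (Or.inr rfl)⟩
  have hL0 := hlarge _ hM0 fun i hi hi' => (hp 0 i hi (by omega)).1
  have hL1 := hlarge _ hM1 fun i hi hi' => (hp i _ hi' (by omega)).1.symm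
  have hsub : U (p (m + 2)) ⊆ A \ U (p 0) := by
    intro x hx
    refine mem_sdiff.mpr ⟨(hUM _ hM1 x hx).1, fun hx' => hreach ?_⟩
    exact (mem_filter.mp hx').2.trans (mem_filter.mp hx).2.symm
  have := card_le_card hsub
  rcases hcut (U (p 0)) (fun x hx => (hUM _ hM0 x hx).1) (hUcut _ hM0) with h | h
  · exact hL0 h
  · omega

lemma FourCycleFree.exists_hasInducedCycleLen (hC : FourCycleFree G) [Nonempty V] {d : ℕ}
    (hG : ∀ v, #{y | G.Adj v y} = d) (hcyc : ¬ G.IsAcyclic) :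
    ∃ ℓ, 3 ≤ ℓ ∧ d ≤ 2048 * ℓ ∧ HasInducedCycleLen G ℓ := by
  rcases Nat.lt_or_ge d 3072 with h | h
  · obtain ⟨ℓ, h3, hℓ⟩ := exists_hasInducedCycleLen_of_not_isAcyclic hcyc
    exact ⟨ℓ, h3, by omega, hℓ⟩
  · obtain ⟨ℓ, h3, hℓ⟩ :=
      hC.exists_long_hasInducedCycleLen hG (m := d / 1024 - 3) (by omega)
    exact ⟨ℓ, by omega, by omega, hℓ⟩

end LongCycle

section Coloring

variable {V : Type} [DecidableEq V] {k : ℕ}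

/-- Resampling the value at `u` uniformly: `σ u` lies in `L σ` with the expected frequency. -/
lemma mul_card_filter_mem_eq_sum_card {Q : Finset (V → Fin k)} {u : V}
    (hQ : ∀ σ ∈ Q, ∀ a, Function.update σ u a ∈ Q) {L : (V → Fin k) → Finset (Fin k)}
    (hL : ∀ σ a, L (Function.update σ u a) = L σ) :
    k * #{σ ∈ Q | σ u ∈ L σ} = ∑ σ ∈ Q, #(L σ) := by
  have h1 : ∑ σ ∈ Q, #(L σ) = #{x ∈ Q ×ˢ (univ : Finset (Fin k)) | x.2 ∈ L x.1} := by
    rw [card_filter, sum_product]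
    refine sum_congr rfl fun σ _ => ?_
    simp
  have h2 : k * #{σ ∈ Q | σ u ∈ L σ} =
      #{x ∈ Q ×ˢ (univ : Finset (Fin k)) | x.1 u ∈ L x.1} := by
    rw [card_filter, card_filter, sum_product, mul_sum]
    refine sum_congr rfl fun σ _ => ?_
    split_ifs <;> simp
  rw [h1, h2]
  refine card_nbij' (fun x => (Function.update x.1 u x.2, x.1 u))
    (fun x => (Function.update x.1 u x.2, x.1 u)) ?_ ?_ ?_ ?_
  · rintro ⟨σ, a⟩ h
    simp only [coe_filter, mem_product, mem_univ, and_true, Set.mem_ofPred_eq] at h ⊢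
    exact ⟨hQ _ h.1 _, by rw [hL]; exact h.2⟩
  · rintro ⟨σ, a⟩ h
    simp only [coe_filter, mem_product, mem_univ, and_true, Set.mem_ofPred_eq] at h ⊢
    exact ⟨hQ _ h.1 _, by rw [hL, Function.update_self]; exact h.2⟩
  · rintro ⟨σ, a⟩ _
    simp
  · rintro ⟨σ, a⟩ _
    simp

variable [Fintype V] (G : SimpleGraph V) [DecidableRel G.Adj]

/-- The maps `V → Fin k` which are proper colourings on `S`, with arbitrary values off `S`. -/
def properOn (k : ℕ) (S : Finset V) : Finset (V → Fin k) :=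
  {σ | ∀ u ∈ S, ∀ w ∈ S, G.Adj u w → σ u ≠ σ w}

/-- The colours which `σ` does not use on the neighbours of `u` in `S`. -/
def avail (S : Finset V) (σ : V → Fin k) (u : V) : Finset (Fin k) :=
  {c | ∀ w ∈ S, G.Adj u w → σ w ≠ c}

/-- The colourings in `properOn G k S` which agree with `τ` off `W` and avoid `D` on `W`. -/
def fiberAvoid (S : Finset V) (τ : V → Fin k) (W : Finset V) (D : Finset (Fin k)) :
    Finset (V → Fin k) :=
  {σ ∈ properOn G k S | (∀ x, x ∉ W → σ x = τ x) ∧ ∀ u ∈ W, σ u ∉ D}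

/-- The neighbours of `v` in `S` with at most five colours available outside that
neighbourhood. -/
def tightNeighbors (S : Finset V) (v : V) (σ : V → Fin k) : Finset V :=
  {u ∈ S | G.Adj v u ∧ #(avail G {w ∈ S | ¬ G.Adj v w} σ u) ≤ 5}

/-- The neighbours of `v` in `S` which are not tight. -/
def looseNeighbors (S : Finset V) (v : V) (σ : V → Fin k) : Finset V :=
  {u ∈ S | G.Adj v u ∧ ¬ #(avail G {w ∈ S | ¬ G.Adj v w} σ u) ≤ 5}

variable {G}

lemma mem_properOn {S : Finset V} {σ : V → Fin k} :
    σ ∈ properOn G k S ↔ ∀ u ∈ S, ∀ w ∈ S, G.Adj u w → σ u ≠ σ w := by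
  simp [properOn]

lemma mem_avail {S : Finset V} {σ : V → Fin k} {u : V} {c : Fin k} :
    c ∈ avail G S σ u ↔ ∀ w ∈ S, G.Adj u w → σ w ≠ c := by
  simp [avail]

lemma mem_fiberAvoid {S W : Finset V} {σ τ : V → Fin k} {D : Finset (Fin k)} :
    σ ∈ fiberAvoid G S τ W D ↔
      σ ∈ properOn G k S ∧ (∀ x, x ∉ W → σ x = τ x) ∧ ∀ u ∈ W, σ u ∉ D := by
  simp [fiberAvoid]

lemma avail_update_self (S : Finset V) (σ : V → Fin k) (u : V) (a : Fin k) :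
    avail G S (Function.update σ u a) u = avail G S σ u := by
  ext c
  simp only [mem_avail]
  refine forall_congr' fun w => forall_congr' fun _ => forall_congr' fun h => ?_
  rw [Function.update_of_ne h.ne']

lemma avail_congr {S : Finset V} {σ τ : V → Fin k} (h : ∀ w ∈ S, σ w = τ w) (u : V) :
    avail G S σ u = avail G S τ u := by
  ext c
  simp only [mem_avail]
  refine forall_congr' fun w => forall_congr' fun hw => ?_
  rw [h w hw]

lemma avail_erase_self (S : Finset V) (σ : V → Fin k) (u : V) :
    avail G (S.erase u) σ u = avail G S σ u := by
  ext c
  simp only [mem_avail, mem_erase]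
  exact ⟨fun h w hw huw => h w ⟨huw.ne', hw⟩ huw, fun h w hw huw => h w hw.2 huw⟩

lemma avail_anti {S T : Finset V} (h : S ⊆ T) (σ : V → Fin k) (u : V) :
    avail G T σ u ⊆ avail G S σ u := by
  intro c hc
  rw [mem_avail] at hc ⊢
  exact fun w hw => hc w (h hw)

lemma update_mem_properOn_erase {S : Finset V} {σ : V → Fin k} {u : V}
    (hσ : σ ∈ properOn G k (S.erase u)) (a : Fin k) :
    Function.update σ u a ∈ properOn G k (S.erase u) := by
  rw [mem_properOn] at hσ ⊢
  intro x hx y hy hxy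
  rw [Function.update_of_ne (ne_of_mem_erase hx), Function.update_of_ne (ne_of_mem_erase hy)]
  exact hσ x hx y hy hxy

lemma mem_properOn_iff_erase {S : Finset V} {σ : V → Fin k} {u : V} (hu : u ∈ S) :
    σ ∈ properOn G k S ↔ σ ∈ properOn G k (S.erase u) ∧ σ u ∈ avail G S σ u := by
  simp only [mem_properOn, mem_avail, mem_erase]
  constructor
  · intro h
    exact ⟨fun x hx y hy => h x hx.2 y hy.2, fun w hw huw => (h u hu w hw huw).symm⟩
  · rintro ⟨h1, h2⟩ x hx y hy hxy
    by_cases hxu : x = u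
    · subst hxu
      exact (h2 y hy hxy).symm
    by_cases hyu : y = u
    · subst hyu
      exact h2 x hx hxy.symm
    exact h1 x ⟨hxu, hx⟩ y ⟨hyu, hy⟩ hxy

lemma mul_card_properOn_insert {S : Finset V} {v : V} (hv : v ∉ S) :
    k * #(properOn G k (insert v S)) = ∑ σ ∈ properOn G k S, #(avail G S σ v) := by
  rw [← mul_card_filter_mem_eq_sum_card (u := v)]
  · congr 2
    ext σ
    rw [mem_filter, mem_properOn_iff_erase (mem_insert_self v S), ← avail_erase_self (insert v S),
      erase_insert hv]
  · intro σ hσ a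
    rw [← erase_insert hv] at hσ ⊢
    exact update_mem_properOn_erase hσ a
  · exact fun σ a => avail_update_self S σ v a

lemma mul_card_filter_card_avail_le {S : Finset V} {u : V} (hu : u ∈ S) (t : ℕ) :
    k * #{σ ∈ properOn G k S | #(avail G S σ u) ≤ t} ≤ t * #(properOn G k (S.erase u)) := by
  let Q : Finset (V → Fin k) := {σ ∈ properOn G k (S.erase u) | #(avail G S σ u) ≤ t}
  have h := mul_card_filter_mem_eq_sum_card (Q := Q) (u := u) (L := fun σ => avail G S σ u)
    (fun σ hσ a => by
      rw [mem_filter] at hσ ⊢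
      rw [avail_update_self]
      exact ⟨update_mem_properOn_erase hσ.1 a, hσ.2⟩)
    (fun σ a => avail_update_self S σ u a)
  have h1 : ({σ ∈ properOn G k S | #(avail G S σ u) ≤ t} : Finset (V → Fin k)) =
      {σ ∈ Q | σ u ∈ avail G S σ u} := by
    ext σ
    simp only [Q, mem_filter]
    rw [mem_properOn_iff_erase hu]
    tauto
  rw [h1, h]
  refine (sum_le_card_nsmul _ _ t fun σ hσ => (mem_filter.mp hσ).2).trans ?_
  rw [smul_eq_mul, mul_comm]
  exact Nat.mul_le_mul_left _ (card_filter_le _ _)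

lemma card_fiberAvoid_union {S W₁ W₂ : Finset V} {τ : V → Fin k} (hτ : τ ∈ properOn G k S)
    (hdisj : Disjoint W₁ W₂) (hno : ∀ x ∈ W₁, ∀ y ∈ W₂, ¬ G.Adj x y) (D : Finset (Fin k)) :
    #(fiberAvoid G S τ (W₁ ∪ W₂) D) = #(fiberAvoid G S τ W₁ D) * #(fiberAvoid G S τ W₂ D) := by
  have hd : ∀ x ∈ W₂, x ∉ W₁ := fun x h h' => disjoint_left.mp hdisj h' h
  have hpiece : ∀ (W W' : Finset V) (σ : V → Fin k), (∀ x ∈ W, ∀ y ∈ W', ¬ G.Adj x y) →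
      σ ∈ properOn G k S → (∀ x, x ∉ W ∪ W' → σ x = τ x) → W.piecewise σ τ ∈ properOn G k S := by
    intro W W' σ hWW hσ hστ
    rw [mem_properOn] at hσ hτ ⊢
    have key : ∀ u ∈ S, ∀ w ∈ S, G.Adj u w → u ∈ W → W.piecewise σ τ u ≠ W.piecewise σ τ w := by
      intro u hu w hw huw huW
      rw [piecewise_eq_of_mem _ _ _ huW]
      by_cases hwW : w ∈ W
      · rw [piecewise_eq_of_mem _ _ _ hwW]
        exact hσ u hu w hw huw
      · have hw' : w ∉ W' := fun h => hWW u huW w h huw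
        rw [piecewise_eq_of_notMem _ _ _ hwW, ← hστ w (by simp [hwW, hw'])]
        exact hσ u hu w hw huw
    intro u hu w hw huw
    by_cases huW : u ∈ W
    · exact key u hu w hw huw huW
    by_cases hwW : w ∈ W
    · exact (key w hw u hu huw.symm hwW).symm
    rw [piecewise_eq_of_notMem _ _ _ huW, piecewise_eq_of_notMem _ _ _ hwW]
    exact hτ u hu w hw huw
  rw [← card_product]
  refine card_nbij' (fun σ => (W₁.piecewise σ τ, W₂.piecewise σ τ))
    (fun x => W₁.piecewise x.1 x.2) ?_ ?_ ?_ ?_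
  · intro σ hσ
    rw [mem_coe, mem_fiberAvoid] at hσ
    rw [mem_coe, mem_product, mem_fiberAvoid, mem_fiberAvoid]
    refine ⟨⟨hpiece W₁ W₂ σ hno hσ.1 hσ.2.1, fun x hx => piecewise_eq_of_notMem _ _ _ hx,
      fun u hu => ?_⟩, ⟨hpiece W₂ W₁ σ (fun x hx y hy h => hno y hy x hx h.symm) hσ.1
        (by rw [union_comm]; exact hσ.2.1), fun x hx => piecewise_eq_of_notMem _ _ _ hx,
      fun u hu => ?_⟩⟩
    · simp only
      rw [piecewise_eq_of_mem _ _ _ hu]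
      exact hσ.2.2 u (mem_union_left _ hu)
    · simp only
      rw [piecewise_eq_of_mem _ _ _ hu]
      exact hσ.2.2 u (mem_union_right _ hu)
  · rintro ⟨σ₁, σ₂⟩ h
    rw [mem_coe, mem_product, mem_fiberAvoid, mem_fiberAvoid] at h
    obtain ⟨⟨h1, h1τ, h1D⟩, h2, h2τ, h2D⟩ := h
    rw [mem_coe, mem_fiberAvoid]
    simp only at h1 h1τ h1D h2 h2τ h2D ⊢
    refine ⟨?_, fun x hx => ?_, fun u hu => ?_⟩
    · rw [mem_properOn] at h1 h2 ⊢
      have key : ∀ u ∈ S, ∀ w ∈ S, G.Adj u w → u ∈ W₁ →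
          W₁.piecewise σ₁ σ₂ u ≠ W₁.piecewise σ₁ σ₂ w := by
        intro u hu w hw huw huW
        rw [piecewise_eq_of_mem _ _ _ huW]
        by_cases hwW : w ∈ W₁
        · rw [piecewise_eq_of_mem _ _ _ hwW]
          exact h1 u hu w hw huw
        · rw [piecewise_eq_of_notMem _ _ _ hwW, h2τ w (fun h => hno u huW w h huw),
            ← h1τ w hwW]
          exact h1 u hu w hw huw
      intro u hu w hw huw
      by_cases huW : u ∈ W₁
      · exact key u hu w hw huw huW
      by_cases hwW : w ∈ W₁
      · exact (key w hw u hu huw.symm hwW).symm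
      rw [piecewise_eq_of_notMem _ _ _ huW, piecewise_eq_of_notMem _ _ _ hwW]
      exact h2 u hu w hw huw
    · rw [mem_union, not_or] at hx
      rw [piecewise_eq_of_notMem _ _ _ hx.1, h2τ x hx.2]
    · by_cases huW : u ∈ W₁
      · rw [piecewise_eq_of_mem _ _ _ huW]
        exact h1D u huW
      · rw [piecewise_eq_of_notMem _ _ _ huW]
        exact h2D u ((mem_union.mp hu).resolve_left huW)
  · intro σ hσ
    rw [mem_coe, mem_fiberAvoid] at hσ
    funext x
    by_cases h1 : x ∈ W₁
    · simp [h1]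
    by_cases h2 : x ∈ W₂
    · simp [h1, h2]
    · simp [h1, h2, hσ.2.1 x (by simp [h1, h2])]
  · rintro ⟨σ₁, σ₂⟩ h
    rw [mem_coe, mem_product, mem_fiberAvoid, mem_fiberAvoid] at h
    simp only at h
    refine Prod.ext (funext fun x => ?_) (funext fun x => ?_)
    · by_cases h1 : x ∈ W₁
      · simp [h1]
      · simp [h1, h.1.2.1 x h1]
    · by_cases h2 : x ∈ W₂
      · simp [h2, hd x h2]
      · simp [h2, h.2.2.1 x h2]

end Coloring

section Averaging

variable {V : Type} [Fintype V] [DecidableEq V] {k : ℕ} {G : SimpleGraph V} [DecidableRel G.Adj]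

lemma FourCycleFree.mul_card_filter_eq_le (hC : FourCycleFree G) {S B : Finset V} {u v : V}
    {τ : V → Fin k} (hB : ∀ x ∈ B, x ∈ S ∧ G.Adj v x) (hu : u ∈ B) {c : Fin k} :
    (#(avail G {w ∈ S | ¬ G.Adj v w} τ u) - 1) * #{σ ∈ fiberAvoid G S τ B ∅ | σ u = c} ≤
      if c ∈ avail G {w ∈ S | ¬ G.Adj v w} τ u then #(fiberAvoid G S τ B ∅) else 0 := by
  have hL : ∀ σ : V → Fin k, (∀ x, x ∉ B → σ x = τ x) →
      avail G {w ∈ S | ¬ G.Adj v w} σ u = avail G {w ∈ S | ¬ G.Adj v w} τ u := fun σ hσ =>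
    avail_congr (fun w hw => hσ w fun h => absurd (hB w h).2 (mem_filter.mp hw).2) u
  split_ifs with hc
  · let Q : Finset (V → Fin k) := {σ ∈ properOn G k (S.erase u) | ∀ x, x ∉ B → σ x = τ x}
    have hQ : ∀ σ ∈ Q, ∀ a, Function.update σ u a ∈ Q := by
      intro σ hσ a
      rw [mem_filter] at hσ ⊢
      refine ⟨update_mem_properOn_erase hσ.1 a, fun x hx => ?_⟩
      rw [Function.update_of_ne (by rintro rfl; exact hx hu)]
      exact hσ.2 x hx
    have h1 := mul_card_filter_mem_eq_sum_card hQ (L := fun σ => avail G S σ u)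
      (fun σ a => avail_update_self S σ u a)
    have h2 := mul_card_filter_mem_eq_sum_card hQ (L := fun σ => avail G S σ u ∩ {c})
      (fun σ a => by rw [avail_update_self])
    have e1 : ({σ ∈ Q | σ u ∈ avail G S σ u} : Finset (V → Fin k)) = fiberAvoid G S τ B ∅ := by
      ext σ
      simp only [Q, mem_filter, mem_fiberAvoid, mem_properOn_iff_erase (hB u hu).1 (σ := σ),
        notMem_empty, not_false_eq_true, implies_true, and_true]
      tauto
    have e2 : ({σ ∈ Q | σ u ∈ avail G S σ u ∩ {c}} : Finset (V → Fin k)) =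
        {σ ∈ fiberAvoid G S τ B ∅ | σ u = c} := by
      rw [← e1]
      ext σ
      simp only [mem_filter, mem_inter, mem_singleton, and_assoc]
    rw [e1] at h1
    rw [e2] at h2
    have h3 : ∀ σ ∈ Q, #(avail G {w ∈ S | ¬ G.Adj v w} τ u) - 1 ≤ #(avail G S σ u) := by
      intro σ hσ
      rw [← hL σ (mem_filter.mp hσ).2, tsub_le_iff_right]
      have hsub : avail G {w ∈ S | ¬ G.Adj v w} σ u ⊆
          avail G S σ u ∪ image σ {y ∈ S | G.Adj v y ∧ G.Adj u y} := by
        intro a ha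
        rw [mem_union, or_iff_not_imp_left]
        intro ha'
        rw [mem_avail] at ha ha'
        push Not at ha'
        obtain ⟨w, hw, huw, rfl⟩ := ha'
        refine mem_image_of_mem _ (mem_filter.mpr ⟨hw, ?_, huw⟩)
        by_contra hvw
        exact ha w (mem_filter.mpr ⟨hw, hvw⟩) huw rfl
      refine (card_le_card hsub).trans ((card_union_le _ _).trans ?_)
      exact Nat.add_le_add_left
        (card_image_le.trans (hC.card_common_le (hB u hu).2.ne S)) _
    have h4 : (#(avail G {w ∈ S | ¬ G.Adj v w} τ u) - 1) * #Q ≤ k * #(fiberAvoid G S τ B ∅) := by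
      rw [h1, mul_comm]
      exact card_nsmul_le_sum _ _ _ h3
    have h5 : k * #{σ ∈ fiberAvoid G S τ B ∅ | σ u = c} ≤ #Q := by
      rw [h2]
      refine (sum_le_card_nsmul _ _ 1 fun σ _ => ?_).trans (by simp)
      exact (card_le_card inter_subset_right).trans (by simp)
    refine Nat.le_of_mul_le_mul_left ?_ c.pos
    calc _ = (#(avail G {w ∈ S | ¬ G.Adj v w} τ u) - 1) *
          (k * #{σ ∈ fiberAvoid G S τ B ∅ | σ u = c}) := by ring
      _ ≤ _ := (Nat.mul_le_mul_left _ h5).trans h4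
  · rw [Nat.le_zero, mul_eq_zero]
    right
    rw [card_eq_zero, filter_eq_empty_iff]
    rintro σ hσ rfl
    rw [mem_fiberAvoid] at hσ
    apply hc
    rw [← hL σ hσ.2.1]
    exact avail_anti (filter_subset _ _) σ u ((mem_properOn_iff_erase (hB u hu).1).mp hσ.1).2

/-- A bound for twice the probability that `u` receives the colour `c` within a fibre. -/
noncomputable def weight (G : SimpleGraph V) [DecidableRel G.Adj] (S : Finset V) (v : V)
    (τ : V → Fin k) (c : Fin k) (u : V) : ℝ :=
  if c ∈ avail G {w ∈ S | ¬ G.Adj v w} τ u then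
    2 / (#(avail G {w ∈ S | ¬ G.Adj v w} τ u) - 1 : ℝ) else 0

lemma weight_nonneg_and_le {S : Finset V} {v u : V} {τ : V → Fin k} (c : Fin k)
    (hu : 5 < #(avail G {w ∈ S | ¬ G.Adj v w} τ u)) :
    0 ≤ weight G S v τ c u ∧ weight G S v τ c u ≤ 2 / 5 := by
  have h : (6 : ℝ) ≤ #(avail G {w ∈ S | ¬ G.Adj v w} τ u) := by exact_mod_cast hu
  rw [weight]
  split_ifs
  · exact ⟨div_nonneg (by norm_num) (by linarith),
      div_le_div_of_nonneg_left (by norm_num) (by norm_num) (by linarith)⟩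
  · norm_num

lemma sum_weight_le {S : Finset V} {v u : V} {τ : V → Fin k}
    (hu : 5 < #(avail G {w ∈ S | ¬ G.Adj v w} τ u)) : ∑ c, weight G S v τ c u ≤ 3 := by
  have h : (6 : ℝ) ≤ #(avail G {w ∈ S | ¬ G.Adj v w} τ u) := by exact_mod_cast hu
  simp only [weight]
  rw [← sum_filter, filter_mem_eq_inter, univ_inter, sum_const, nsmul_eq_mul, mul_div_assoc',
    div_le_iff₀ (by linarith)]
  linarith

lemma FourCycleFree.card_filter_eq_le_weight (hC : FourCycleFree G) {S B : Finset V} {u v : V}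
    {τ : V → Fin k} (hB : ∀ x ∈ B, x ∈ S ∧ G.Adj v x) (hu : u ∈ B) (c : Fin k)
    (hp : 5 < #(avail G {w ∈ S | ¬ G.Adj v w} τ u)) :
    (#{σ ∈ fiberAvoid G S τ B ∅ | σ u = c} : ℝ) ≤
      weight G S v τ c u / 2 * #(fiberAvoid G S τ B ∅) := by
  have h := hC.mul_card_filter_eq_le (τ := τ) hB hu (c := c)
  have h6 : (6 : ℝ) ≤ #(avail G {w ∈ S | ¬ G.Adj v w} τ u) := by exact_mod_cast hp
  rw [weight]
  split_ifs at h ⊢ with hc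
  · have h' : ((#(avail G {w ∈ S | ¬ G.Adj v w} τ u) : ℝ) - 1) *
        #{σ ∈ fiberAvoid G S τ B ∅ | σ u = c} ≤ #(fiberAvoid G S τ B ∅) := by
      have := (Nat.cast_le (α := ℝ)).mpr h
      rwa [Nat.cast_mul, Nat.cast_sub (by omega), Nat.cast_one] at this
    rw [div_div, mul_comm _ (2 : ℝ), ← div_div, div_self two_ne_zero, one_div,
      le_inv_mul_iff₀ (by linarith)]
    exact h'
  · rw [Nat.le_zero, mul_eq_zero] at h
    rw [h.resolve_left (by omega)]
    simp

lemma FourCycleFree.exp_neg_sum_weight_mul_card_le (hC : FourCycleFree G) {S : Finset V} {v : V}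
    {τ : V → Fin k} (hτ : τ ∈ properOn G k S) (c : Fin k) (W : Finset V)
    (hW : ∀ u ∈ W, (u ∈ S ∧ G.Adj v u) ∧ 5 < #(avail G {w ∈ S | ¬ G.Adj v w} τ u)) :
    Real.exp (-∑ u ∈ W, weight G S v τ c u) * #(fiberAvoid G S τ W ∅) ≤
      #(fiberAvoid G S τ W {c}) := by
  induction W using Finset.strongInduction with
  | H W ih =>
  obtain rfl | ⟨u, hu⟩ := W.eq_empty_or_nonempty
  · simp [fiberAvoid]
  set B : Finset V := {w ∈ W | w = u ∨ G.Adj u w} with hBdef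
  have hBW : B ⊆ W := filter_subset _ _
  have huB : u ∈ B := mem_filter.mpr ⟨hu, Or.inl rfl⟩
  have hBcard : #B ≤ 2 := by
    have : B ⊆ insert u {y ∈ S | G.Adj v y ∧ G.Adj u y} := by
      intro w hw
      rw [mem_filter] at hw
      rw [mem_insert, mem_filter]
      exact hw.2.imp_right fun h => ⟨(hW w hw.1).1.1, (hW w hw.1).1.2, h⟩
    refine (card_le_card this).trans ((card_insert_le _ _).trans ?_)
    have := hC.card_common_le (hW u hu).1.2.ne S
    omega
  have hno : ∀ x ∈ B, ∀ y ∈ W \ B, ¬ G.Adj x y := by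
    intro x hx y hy hxy
    rw [mem_sdiff, hBdef, mem_filter, not_and, not_or] at hy
    have hy' := hy.2 hy.1
    rw [mem_filter] at hx
    obtain rfl | hux := hx.2
    · exact hy'.2 hxy
    · exact hy'.1 (hC v x u y (hW x hx.1).1.2.ne (hW u hu).1.2 (hW y hy.1).1.2 hux.symm hxy).symm
  have hrest := ih (W \ B) (sdiff_ssubset hBW ⟨u, huB⟩) fun w hw => hW w (mem_sdiff.mp hw).1
  have hsum0 : 0 ≤ ∑ w ∈ B, weight G S v τ c w :=
    sum_nonneg fun w hw => (weight_nonneg_and_le c (hW w (hBW hw)).2).1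
  have hsum1 : ∑ w ∈ B, weight G S v τ c w ≤ 4 / 5 := by
    refine (sum_le_card_nsmul _ _ (2 / 5) fun w hw =>
      (weight_nonneg_and_le c (hW w (hBW hw)).2).2).trans ?_
    have : (#B : ℝ) ≤ 2 := by exact_mod_cast hBcard
    rw [nsmul_eq_mul]
    linarith
  have hblock : Real.exp (-∑ w ∈ B, weight G S v τ c w) * #(fiberAvoid G S τ B ∅) ≤
      #(fiberAvoid G S τ B {c}) := by
    have hcover : fiberAvoid G S τ B ∅ ⊆ fiberAvoid G S τ B {c} ∪
        B.biUnion fun w => {σ ∈ fiberAvoid G S τ B ∅ | σ w = c} := by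
      intro σ hσ
      rw [mem_union, or_iff_not_imp_left]
      intro hσ'
      have hσ0 := hσ
      rw [mem_fiberAvoid] at hσ hσ'
      have : ¬ ∀ w ∈ B, σ w ∉ ({c} : Finset (Fin k)) := fun h => hσ' ⟨hσ.1, hσ.2.1, h⟩
      push Not at this
      obtain ⟨w, hw, hwc⟩ := this
      exact mem_biUnion.mpr ⟨w, hw, mem_filter.mpr ⟨hσ0, mem_singleton.mp hwc⟩⟩
    have h1 : #(fiberAvoid G S τ B ∅) ≤ #(fiberAvoid G S τ B {c}) +
        ∑ w ∈ B, #{σ ∈ fiberAvoid G S τ B ∅ | σ w = c} :=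
      (card_le_card hcover).trans ((card_union_le _ _).trans
        (Nat.add_le_add_left card_biUnion_le _))
    have h2 : (#(fiberAvoid G S τ B ∅) : ℝ) ≤ #(fiberAvoid G S τ B {c}) +
        ∑ w ∈ B, (#{σ ∈ fiberAvoid G S τ B ∅ | σ w = c} : ℝ) := by exact_mod_cast h1
    have h3 : ∑ w ∈ B, (#{σ ∈ fiberAvoid G S τ B ∅ | σ w = c} : ℝ) ≤
        (∑ w ∈ B, weight G S v τ c w) / 2 * #(fiberAvoid G S τ B ∅) := by
      rw [sum_div, sum_mul]
      exact sum_le_sum fun w hw => hC.card_filter_eq_le_weight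
        (fun x hx => (hW x (hBW hx)).1) hw c (hW w (hBW hw)).2
    set z := ∑ w ∈ B, weight G S v τ c w with hz
    have h4 : Real.exp (-z) ≤ 1 - z / 2 := by
      rw [Real.exp_neg, inv_le_iff_one_le_mul₀ (Real.exp_pos z)]
      have := Real.add_one_le_exp z
      nlinarith
    have h5 := mul_le_mul_of_nonneg_right h4 (Nat.cast_nonneg (α := ℝ) #(fiberAvoid G S τ B ∅))
    linarith
  have hWB : B ∪ W \ B = W := union_sdiff_of_subset hBW
  have hm := fun D => card_fiberAvoid_union hτ (disjoint_sdiff (s := B) (t := W)) hno D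
  rw [hWB] at hm
  rw [hm, hm, ← sum_sdiff hBW, neg_add, Real.exp_add, Nat.cast_mul, Nat.cast_mul]
  calc _ = (Real.exp (-∑ w ∈ B, weight G S v τ c w) * #(fiberAvoid G S τ B ∅)) *
        (Real.exp (-∑ w ∈ W \ B, weight G S v τ c w) * #(fiberAvoid G S τ (W \ B) ∅)) := by ring
    _ ≤ _ := mul_le_mul hblock hrest (by positivity) (by positivity)

lemma FourCycleFree.exp_mul_card_fiber_le (hC : FourCycleFree G) {S : Finset V} {v : V} {d : ℕ}
    (hd : #{y | G.Adj v y} = d) (hk : 0 < k) {τ : V → Fin k} (hτ : τ ∈ properOn G k S) :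
    Real.exp (-(3 * d / k)) * (k - #(tightNeighbors G S v τ) * (1 + 3 * d / k)) *
        #(fiberAvoid G S τ (looseNeighbors G S v τ) ∅) ≤
      ∑ σ ∈ fiberAvoid G S τ (looseNeighbors G S v τ) ∅, (#(avail G S σ v) : ℝ) := by
  set W := looseNeighbors G S v τ with hWdef
  set T := tightNeighbors G S v τ with hTdef
  set m : ℝ := 3 * d / k with hm
  have hk' : (0 : ℝ) < k := by exact_mod_cast hk
  have hm0 : 0 ≤ m := by positivity
  have hmk : m * k = 3 * d := by rw [hm]; field_simp
  have hW : ∀ u ∈ W, (u ∈ S ∧ G.Adj v u) ∧ 5 < #(avail G {w ∈ S | ¬ G.Adj v w} τ u) := by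
    intro u hu
    have := (mem_filter.mp hu)
    exact ⟨⟨this.1, this.2.1⟩, not_le.mp this.2.2⟩
  have hWd : #W ≤ d := by
    rw [← hd]
    exact card_le_card fun u hu => mem_filter.mpr ⟨mem_univ _, (hW u hu).1.2⟩
  let X : Finset (Fin k) := (image τ T)ᶜ
  have hX : (k : ℝ) - #T ≤ #X := by
    have h1 : #(image τ T) + #X = k := by rw [card_add_card_compl, Fintype.card_fin]
    have h2 : #(image τ T) ≤ #T := card_image_le
    have h3 : (#(image τ T) : ℝ) + #X = k := by exact_mod_cast h1
    have h4 : (#(image τ T) : ℝ) ≤ #T := by exact_mod_cast h2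
    linarith
  have hsub : ∀ c ∈ X, fiberAvoid G S τ W {c} ⊆
      {σ ∈ fiberAvoid G S τ W ∅ | c ∈ avail G S σ v} := by
    intro c hc σ hσ
    rw [mem_fiberAvoid] at hσ
    rw [mem_filter, mem_fiberAvoid, mem_avail]
    refine ⟨⟨hσ.1, hσ.2.1, by simp⟩, fun u hu hvu huc => ?_⟩
    by_cases huW : u ∈ W
    · exact hσ.2.2 u huW (mem_singleton.mpr huc)
    · rw [hσ.2.1 u huW] at huc
      have huT : u ∈ T := by
        rw [hWdef, looseNeighbors, mem_filter] at huW
        rw [hTdef, tightNeighbors, mem_filter]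
        tauto
      exact mem_compl.mp hc (mem_image.mpr ⟨u, huT, huc⟩)
  have hcount : ∑ c ∈ X, (#(fiberAvoid G S τ W {c}) : ℝ) ≤
      ∑ σ ∈ fiberAvoid G S τ W ∅, (#(avail G S σ v) : ℝ) := by
    have : ∑ c ∈ X, #(fiberAvoid G S τ W {c}) ≤
        ∑ σ ∈ fiberAvoid G S τ W ∅, #(avail G S σ v) := by
      calc _ ≤ ∑ c ∈ X, #{σ ∈ fiberAvoid G S τ W ∅ | c ∈ avail G S σ v} :=
            sum_le_sum fun c hc => card_le_card (hsub c hc)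
        _ = ∑ σ ∈ fiberAvoid G S τ W ∅, #{c ∈ X | c ∈ avail G S σ v} := by
            simp only [card_filter]
            exact sum_comm
        _ ≤ _ := sum_le_sum fun σ _ => card_le_card fun c hc => (mem_filter.mp hc).2
    exact_mod_cast this
  have hexp : ∀ c ∈ X, Real.exp (-m) * (1 + m - ∑ u ∈ W, weight G S v τ c u) *
      #(fiberAvoid G S τ W ∅) ≤ #(fiberAvoid G S τ W {c}) := by
    intro c _
    refine le_trans ?_ (hC.exp_neg_sum_weight_mul_card_le hτ c W hW)
    refine mul_le_mul_of_nonneg_right ?_ (Nat.cast_nonneg _)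
    set y := ∑ u ∈ W, weight G S v τ c u
    have h1 := Real.add_one_le_exp (m - y)
    calc _ ≤ Real.exp (-m) * Real.exp (m - y) :=
          mul_le_mul_of_nonneg_left (by linarith) (Real.exp_pos _).le
      _ = Real.exp (-y) := by rw [← Real.exp_add]; congr 1; ring
  have hweights : ∑ c ∈ X, ∑ u ∈ W, weight G S v τ c u ≤ m * k := by
    calc _ ≤ ∑ c, ∑ u ∈ W, weight G S v τ c u :=
          sum_le_univ_sum_of_nonneg fun c => sum_nonneg fun u hu =>
            (weight_nonneg_and_le c (hW u hu).2).1
      _ = ∑ u ∈ W, ∑ c, weight G S v τ c u := sum_comm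
      _ ≤ #W • (3 : ℝ) := sum_le_card_nsmul _ _ _ fun u hu => sum_weight_le (hW u hu).2
      _ ≤ m * k := by
          rw [nsmul_eq_mul, hmk]
          have : (#W : ℝ) ≤ d := by exact_mod_cast hWd
          linarith
  refine le_trans ?_ ((sum_le_sum hexp).trans hcount)
  rw [← sum_mul, ← mul_sum, sum_sub_distrib, sum_const, nsmul_eq_mul]
  refine mul_le_mul_of_nonneg_right (mul_le_mul_of_nonneg_left ?_ (Real.exp_pos _).le)
    (Nat.cast_nonneg _)
  nlinarith [mul_le_mul_of_nonneg_right hX (by linarith : 0 ≤ 1 + m)]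

lemma FourCycleFree.exp_mul_sub_le_sum_card_avail (hC : FourCycleFree G) (S : Finset V) {v : V}
    {d : ℕ} (hd : #{y | G.Adj v y} = d) (hk : 0 < k) :
    Real.exp (-(3 * d / k)) * (k * #(properOn G k S) -
        (∑ σ ∈ properOn G k S, (#(tightNeighbors G S v σ) : ℝ)) * (1 + 3 * d / k)) ≤
      ∑ σ ∈ properOn G k S, (#(avail G S σ v) : ℝ) := by
  let g : (V → Fin k) → Finset (V → Fin k) := fun τ =>
    fiberAvoid G S τ (looseNeighbors G S v τ) ∅
  have hconst : ∀ τ, ∀ σ ∈ g τ, tightNeighbors G S v σ = tightNeighbors G S v τ ∧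
      looseNeighbors G S v σ = looseNeighbors G S v τ := by
    intro τ σ hσ
    have hσ' := (mem_fiberAvoid.mp hσ).2.1
    have h : ∀ u, avail G {w ∈ S | ¬ G.Adj v w} σ u = avail G {w ∈ S | ¬ G.Adj v w} τ u :=
      avail_congr fun w hw => hσ' w fun hw' =>
        (mem_filter.mp hw).2 (mem_filter.mp hw').2.1
    simp only [tightNeighbors, looseNeighbors, h, and_self]
  have hfib : ∀ τ ∈ properOn G k S, ({σ ∈ properOn G k S | g σ = g τ} : Finset _) = g τ := by
    intro τ _
    ext σ
    rw [mem_filter]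
    constructor
    · rintro ⟨hσ, h⟩
      rw [← h]
      exact mem_fiberAvoid.mpr ⟨hσ, fun _ _ => rfl, by simp⟩
    · intro hσ
      have hσ' := mem_fiberAvoid.mp hσ
      refine ⟨hσ'.1, ?_⟩
      ext ρ
      simp only [g, mem_fiberAvoid, (hconst τ σ hσ).2]
      refine and_congr_right fun _ => and_congr_left fun _ => forall_congr' fun x =>
        forall_congr' fun hx => ?_
      rw [hσ'.2.1 x hx]
  have hnonneg : 0 ≤ ∑ σ ∈ properOn G k S, ((#(avail G S σ v) : ℝ) -
      Real.exp (-(3 * d / k)) * (k - #(tightNeighbors G S v σ) * (1 + 3 * d / k))) := by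
    rw [← sum_fiberwise_of_maps_to (g := g) (t := image g (properOn G k S))
      (fun σ hσ => mem_image_of_mem g hσ)]
    refine sum_nonneg fun F hF => ?_
    obtain ⟨τ, hτ, rfl⟩ := mem_image.mp hF
    rw [hfib τ hτ, sum_sub_distrib, sub_nonneg]
    refine le_trans (le_of_eq ?_) (hC.exp_mul_card_fiber_le hd hk hτ)
    rw [mul_comm _ (#(fiberAvoid G S τ (looseNeighbors G S v τ) ∅) : ℝ), ← nsmul_eq_mul]
    exact sum_eq_card_nsmul fun σ hσ => by rw [(hconst τ σ hσ).1]
  rw [sum_sub_distrib, sub_nonneg, ← mul_sum, sum_sub_distrib, ← sum_mul, sum_const,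
    nsmul_eq_mul, mul_comm (#(properOn G k S) : ℝ)] at hnonneg
  exact hnonneg

lemma FourCycleFree.mul_card_properOn_le (hC : FourCycleFree G) {d : ℕ}
    (hG : ∀ v, #{y | G.Adj v y} = d) (hk : 0 < k) {ℓ : ℝ} (hℓ : 0 < ℓ)
    (h : ℓ ≤ Real.exp (-(3 * d / k)) * (k - 5 * d / ℓ * (1 + 3 * d / k))) (S : Finset V) :
    ∀ v ∉ S, ℓ * #(properOn G k S) ≤ k * #(properOn G k (insert v S)) := by
  induction S using Finset.strongInduction with
  | H S ih =>
  intro v hv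
  set P : ℝ := (#(properOn G k S) : ℝ)
  have htight : ∑ σ ∈ properOn G k S, (#(tightNeighbors G S v σ) : ℝ) ≤ 5 * d / ℓ * P := by
    have h1 : ∑ σ ∈ properOn G k S, #(tightNeighbors G S v σ) ≤
        ∑ u ∈ S with G.Adj v u, #{σ ∈ properOn G k S | #(avail G S σ u) ≤ 5} := by
      calc _ = ∑ u ∈ S with G.Adj v u,
            #{σ ∈ properOn G k S | #(avail G {w ∈ S | ¬ G.Adj v w} σ u) ≤ 5} := by
            simp only [tightNeighbors, ← filter_filter]
            simp only [card_filter _ (filter _ _), card_filter _ (properOn G k S)]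
            exact sum_comm
        _ ≤ _ := sum_le_sum fun u _ => card_le_card fun σ hσ => by
            rw [mem_filter] at hσ ⊢
            exact ⟨hσ.1, (card_le_card (avail_anti (filter_subset _ _) σ u)).trans hσ.2⟩
    have h2 : ∀ u ∈ S.filter (G.Adj v),
        (#{σ ∈ properOn G k S | #(avail G S σ u) ≤ 5} : ℝ) ≤ 5 / ℓ * P := by
      intro u hu
      have huS := (mem_filter.mp hu).1
      have h3 := ih (S.erase u) (erase_ssubset huS) u (notMem_erase u S)
      rw [insert_erase huS] at h3
      have h4 : (k : ℝ) * #{σ ∈ properOn G k S | #(avail G S σ u) ≤ 5} ≤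
          5 * #(properOn G k (S.erase u)) := by
        exact_mod_cast mul_card_filter_card_avail_le (k := k) huS 5
      have hk' : (0 : ℝ) < k := by exact_mod_cast hk
      rw [div_mul_eq_mul_div, le_div_iff₀ hℓ]
      refine le_of_mul_le_mul_left ?_ hk'
      nlinarith
    calc _ ≤ ∑ u ∈ S with G.Adj v u,
          (#{σ ∈ properOn G k S | #(avail G S σ u) ≤ 5} : ℝ) := by exact_mod_cast h1
      _ ≤ #(S.filter (G.Adj v)) • (5 / ℓ * P) := sum_le_card_nsmul _ _ _ h2
      _ ≤ (d : ℝ) * (5 / ℓ * P) := by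
          rw [nsmul_eq_mul]
          refine mul_le_mul_of_nonneg_right ?_ (by positivity)
          have : #(S.filter (G.Adj v)) ≤ d := by
            rw [← hG v]
            exact card_le_card (filter_subset_filter _ (subset_univ S))
          exact_mod_cast this
      _ = _ := by ring
  have h5 := hC.exp_mul_sub_le_sum_card_avail S (hG v) hk
  have h6 : (k : ℝ) * #(properOn G k (insert v S)) =
      ∑ σ ∈ properOn G k S, (#(avail G S σ v) : ℝ) := by
    exact_mod_cast mul_card_properOn_insert hv
  rw [h6]
  refine le_trans ?_ h5
  calc ℓ * P ≤ Real.exp (-(3 * d / k)) * (k - 5 * d / ℓ * (1 + 3 * d / k)) * P :=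
        mul_le_mul_of_nonneg_right h (Nat.cast_nonneg _)
    _ = Real.exp (-(3 * d / k)) * (k * P - 5 * d / ℓ * P * (1 + 3 * d / k)) := by ring
    _ ≤ _ := by
        refine mul_le_mul_of_nonneg_left (sub_le_sub_left ?_ _) (Real.exp_pos _).le
        exact mul_le_mul_of_nonneg_right htight (by positivity)

lemma FourCycleFree.colorable (hC : FourCycleFree G) {d : ℕ}
    (hG : ∀ v, #{y | G.Adj v y} = d) (hk : 0 < k) (h : 60 * Real.exp (5 * d / k) ≤ k) :
    G.Colorable k := by
  have hk' : (0 : ℝ) < k := by exact_mod_cast hk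
  set x : ℝ := d / k with hx
  have hx0 : 0 ≤ x := by positivity
  have h5 : 5 * d / k = 5 * x := by rw [hx]; ring
  have h3 : (3 * d / k : ℝ) = 3 * x := by rw [hx]; ring
  rw [h5] at h
  set ℓ : ℝ := 30 * Real.exp (2 * x) with hℓ
  have hℓ0 : 0 < ℓ := by positivity
  have hmain : ℓ ≤ Real.exp (-(3 * d / k)) * (k - 5 * d / ℓ * (1 + 3 * d / k)) := by
    have e5 : Real.exp (5 * x) = Real.exp (3 * x) * Real.exp (2 * x) := by
      rw [← Real.exp_add]; congr 1; ring
    have h1 : 5 * d / ℓ * (1 + 3 * x) ≤ k / 2 := by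
      have hd : (d : ℝ) = x * k := by rw [hx]; field_simp
      have := Real.quadratic_le_exp_of_nonneg (x := 2 * x) (by linarith)
      rw [div_mul_eq_mul_div, div_le_iff₀ hℓ0, hd, hℓ]
      nlinarith
    rw [h3, Real.exp_neg, le_inv_mul_iff₀ (Real.exp_pos _)]
    rw [e5] at h
    rw [hℓ] at h1 ⊢
    nlinarith
  have hpos : ∀ S : Finset V, 0 < #(properOn G k S) := by
    intro S
    induction S using Finset.induction_on with
    | empty =>
      exact card_pos.mpr ⟨fun _ => ⟨0, hk⟩, by simp [properOn]⟩
    | insert v S hv ih =>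
      have h1 := hC.mul_card_properOn_le hG hk hℓ0 hmain S v hv
      have h2 : (0 : ℝ) < #(properOn G k S) := by exact_mod_cast ih
      have h4 : (0 : ℝ) < k * #(properOn G k (insert v S)) := (mul_pos hℓ0 h2).trans_le h1
      exact_mod_cast pos_of_mul_pos_right h4 hk'.le
  obtain ⟨σ, hσ⟩ := card_pos.mp (hpos univ)
  rw [mem_properOn] at hσ
  exact ⟨Coloring.mk σ fun {u w} huw => hσ u (mem_univ u) w (mem_univ w) huw⟩

end Averaging

lemma fourCycleFree_of_not_exists_hom {V : Type} {G : SimpleGraph V}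
    (h : ¬ ∃ φ : cycleGraph 4 →g G, Function.Injective φ) : FourCycleFree G := by
  intro a b x y hab hax hay hbx hby
  by_contra hxy
  refine h ⟨⟨![a, x, b, y], ?_⟩, ?_⟩
  · intro i j hij
    fin_cases i <;> fin_cases j <;>
      first
      | exact absurd hij (by decide)
      | exact hax
      | exact hay
      | exact hbx
      | exact hby
      | exact hax.symm
      | exact hay.symm
      | exact hbx.symm
      | exact hby.symm
  · intro i j hij
    have hij' : ![a, x, b, y] i = ![a, x, b, y] j := hij
    have := hax.ne
    have := hay.ne
    have := hbx.ne
    have := hby.ne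
    fin_cases i <;> fin_cases j <;> simp_all [eq_comm]

lemma mul_log_le_of_lt_exp {χ d ℓ : ℕ} (hχ : 2 < χ)
    (h : ((χ - 1 : ℕ) : ℝ) < 60 * Real.exp (5 * d / (χ - 1 : ℕ))) (hℓ3 : 3 ≤ ℓ)
    (hℓd : d ≤ 2048 * ℓ) : (1 / 10 ^ 7 : ℝ) * χ * Real.log χ ≤ ℓ := by
  have hℓ3' : (3 : ℝ) ≤ ℓ := by exact_mod_cast hℓ3
  have hℓd' : (d : ℝ) ≤ 2048 * ℓ := by exact_mod_cast hℓd
  have hχ' : (3 : ℝ) ≤ χ := by exact_mod_cast hχ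
  have hcast : ((χ - 1 : ℕ) : ℝ) = χ - 1 := by
    rw [Nat.cast_sub (by omega), Nat.cast_one]
  rw [hcast] at h
  set X : ℝ := (χ : ℝ)
  have hlog0 : 0 ≤ Real.log X := Real.log_nonneg (by linarith)
  obtain hsmall | hbig := le_total X 4000
  · have := Real.log_le_self (x := X) (by linarith)
    nlinarith
  · set k : ℝ := X - 1 with hk
    have hk0 : 0 < k := by linarith
    have h1 : Real.log k < Real.log 60 + 5 * d / k := by
      have := Real.log_lt_log hk0 h
      rwa [Real.log_mul (by norm_num) (Real.exp_pos _).ne', Real.log_exp] at this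
    have h2 : 2 * Real.log 60 ≤ Real.log k := by
      rw [← Real.log_rpow (by norm_num)]
      exact Real.log_le_log (by positivity) (by norm_num; linarith)
    have h3 : Real.log X ≤ 2 * Real.log k := by
      rw [← Real.log_rpow hk0]
      refine Real.log_le_log (by linarith) ?_
      norm_num
      nlinarith
    have h4 : Real.log X / 4 < 5 * d / k := by linarith
    rw [lt_div_iff₀ hk0] at h4
    have h5 : X / 2 * Real.log X ≤ k * Real.log X :=
      mul_le_mul_of_nonneg_right (by linarith) hlog0
    nlinarith [mul_nonneg (by linarith : 0 ≤ X) hlog0]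

end InducedCycle

/-- There exists c > 0 such that every regular graph with no C₄ subgraph and
chromatic number χ > 2 contains an induced cycle of length at least c·χ·log χ. -/
theorem regular_c4free_long_induced_cycle :
    ∃ c : ℝ, 0 < c ∧
      ∀ (V : Type) [Fintype V] (G : SimpleGraph V) [DecidableRel G.Adj] (d χ : ℕ),
        G.IsRegularOfDegree d →
        (¬ ∃ φ : SimpleGraph.cycleGraph 4 →g G, Function.Injective φ) →
        G.chromaticNumber = χ → 2 < χ →
        ∃ ℓ : ℕ, HasInducedCycleLen G ℓ ∧ c * χ * Real.log χ ≤ ℓ := by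
  classical
  refine ⟨1 / 10 ^ 7, by norm_num, fun V _ G _ d χ hreg hC4 hχ hχ2 => ?_⟩
  have hC := InducedCycle.fourCycleFree_of_not_exists_hom hC4
  have hG : ∀ v, (Finset.univ.filter (G.Adj v)).card = d := fun v => by
    rw [← hreg v, ← G.card_neighborFinset_eq_degree, G.neighborFinset_eq_filter]
  have hnot : ∀ k < χ, ¬ G.Colorable k := fun k hk hcol => by
    have := hcol.chromaticNumber_le
    rw [hχ, Nat.cast_le] at this
    omega
  have hne : Nonempty V := by
    by_contra h
    rw [not_nonempty_iff] at h
    exact hnot 0 (by omega) (SimpleGraph.colorable_zero_iff.mpr h)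
  obtain ⟨ℓ, hℓ3, hℓd, hℓ⟩ := hC.exists_hasInducedCycleLen hG
    fun h => hnot 2 hχ2 h.colorable_two
  refine ⟨ℓ, hℓ, ?_⟩
  refine InducedCycle.mul_log_le_of_lt_exp hχ2 (d := d) ?_ hℓ3 hℓd
  by_contra! h
  exact hnot (χ - 1) (by omega) (hC.colorable hG (by omega) h)
end

section
/- For each integer g ≥ 5, every graph G of girth at least g and chromatic number χ = χ(G) > 2 contains an induced cycle of length at least 3 + (χ−1)·(χ−2)^{⌊(g−5)/16⌋}. -/
open SimpleGraph Finset

section ShortCycles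

variable {V : Type*} {G : SimpleGraph V}

theorem egirth_le_of_walk {u v : V} (h : G.Adj u v) (w : G.Walk u v) (hw : s(u, v) ∉ w.edges) :
    G.egirth ≤ (w.length + 1 : ℕ) := by
  classical
  have hc : (Walk.cons h.symm w.bypass).IsCycle := by
    rw [Walk.cons_isCycle_iff]
    refine ⟨w.bypass_isPath, fun hmem ↦ hw ?_⟩
    rw [Sym2.eq_swap]
    exact w.edges_bypass_subset_edges hmem
  refine (egirth_le_length hc).trans ?_
  have := w.length_bypass_le_length
  simp only [Walk.length_cons]
  exact_mod_cast Nat.succ_le_succ this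

end ShortCycles

/-- Closing a geodesic of the graph obtained from `G[S]` by deleting the edge `uv` with that edge
gives an induced cycle of `G`. -/
theorem hasInducedCycleLen_of_dist {V : Type} {G G' : SimpleGraph V} {S : Set V} {u v : V}
    (huv : G.Adj u v)
    (hG' : ∀ x y, G'.Adj x y ↔ G.Adj x y ∧ x ∈ S ∧ y ∈ S ∧ s(x, y) ≠ s(u, v))
    (hr : G'.Reachable u v) : HasInducedCycleLen G (G'.dist u v + 1) := by
  obtain ⟨p, hp, hlen⟩ := hr.exists_path_of_dist
  have hle : G' ≤ G := fun x y h ↦ ((hG' x y).1 h).1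
  have hne : ¬ p.Nil := fun h ↦ huv.ne h.eq
  have hS : ∀ a ∈ p.support, a ∈ S := by
    intro a ha
    obtain ⟨e, he, hae⟩ := (Walk.mem_support_iff_exists_mem_edges_of_not_nil hne).1 ha
    obtain ⟨b, rfl⟩ := hae
    exact ((hG' a b).1 (p.adj_of_mem_edges he)).2.1
  have hclose : ∀ i j, i ≤ j → j ≤ p.length → G'.Adj (p.getVert i) (p.getVert j) → j ≤ i + 1 := by
    intro i j hij hj hadj
    have h1 := dist_le ((p.take i).append (Walk.cons hadj (p.drop j)))
    simp only [Walk.length_append, Walk.take_length, Walk.length_cons, Walk.drop_length] at h1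
    omega
  have hstep : ∀ i j, i ≤ j → j ≤ p.length → G'.Adj (p.getVert i) (p.getVert j) →
      s(p.getVert i, p.getVert j) ∈ p.edges := by
    intro i j hij hj hadj
    have h1 := hclose i j hij hj hadj
    have hne : i ≠ j := by rintro rfl; exact hadj.ne rfl
    obtain rfl : j = i + 1 := by omega
    rw [← Walk.adj_toSubgraph_iff_mem_edges]
    exact p.toSubgraph_adj_getVert (by omega)
  refine ⟨v, Walk.cons huv.symm (p.mapLe hle), ?_, ?_, by simp [hlen]⟩
  · rw [Walk.cons_isCycle_iff]
    refine ⟨hp.mapLe hle, fun hmem ↦ ?_⟩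
    rw [Walk.edges_mapLe_eq_edges, Sym2.eq_swap] at hmem
    exact ((hG' u v).1 (p.adj_of_mem_edges hmem)).2.2.2 rfl
  · intro a ha b hb hab
    rw [Walk.mem_verts_toSubgraph] at ha hb
    rw [Walk.adj_toSubgraph_iff_mem_edges]
    have hsup : ∀ a ∈ (Walk.cons huv.symm (p.mapLe hle)).support, a ∈ p.support := by
      intro a ha
      simp only [Walk.support_cons, Walk.support_mapLe_eq_support, List.mem_cons] at ha
      rcases ha with rfl | ha
      exacts [p.end_mem_support, ha]
    have ha := hsup a ha
    have hb := hsup b hb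
    simp only [Walk.edges_cons, Walk.edges_mapLe_eq_edges, List.mem_cons]
    by_cases he : s(a, b) = s(u, v)
    · left; rw [he, Sym2.eq_swap]
    · right
      have hadj : G'.Adj a b := (hG' a b).2 ⟨hab, hS a ha, hS b hb, he⟩
      obtain ⟨i, rfl, hi⟩ := Walk.mem_support_iff_exists_getVert.1 ha
      obtain ⟨j, rfl, hj⟩ := Walk.mem_support_iff_exists_getVert.1 hb
      rcases le_total i j with hij | hij
      · exact hstep i j hij hj hadj
      · rw [Sym2.eq_swap]; exact hstep j i hij hi hadj.symm

theorem HasInducedCycleLen.map {V W : Type} {K : SimpleGraph W} {G : SimpleGraph V} (e : K ↪g G)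
    {ℓ : ℕ} (h : HasInducedCycleLen K ℓ) : HasInducedCycleLen G ℓ := by
  obtain ⟨v, w, hw, hind, hlen⟩ := h
  refine ⟨_, w.map e.toHom, hw.map e.injective, ?_, by simpa using hlen⟩
  rw [Walk.toSubgraph_map]
  rintro _ ⟨a, ha, rfl⟩ _ ⟨b, hb, rfl⟩ hab
  exact ⟨a, b, hind ha hb (e.map_adj_iff.1 hab), rfl, rfl⟩

section MinDegree

theorem colorable_induce_of_forall_exists_card_lt {V : Type*} {G : SimpleGraph V}
    [DecidableEq V] [DecidableRel G.Adj] {n : ℕ}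
    (h : ∀ s : Finset V, s.Nonempty → ∃ v ∈ s, #{w ∈ s | G.Adj v w} < n) (s : Finset V) :
    (G.induce (s : Set V)).Colorable n := by
  suffices H : ∃ c : V → ℕ, (∀ x ∈ s, c x < n) ∧
      ∀ x ∈ s, ∀ y ∈ s, G.Adj x y → c x ≠ c y by
    obtain ⟨c, hc, hadj⟩ := H
    exact ⟨Coloring.mk (fun x ↦ ⟨c x, hc x x.2⟩)
      fun {x y} hxy heq ↦ hadj x x.2 y y.2 hxy (congrArg Fin.val heq)⟩
  induction s using Finset.strongInduction with
  | H s ih =>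
    rcases s.eq_empty_or_nonempty with rfl | hs
    · exact ⟨fun _ ↦ 0, by simp, by simp⟩
    obtain ⟨v, hv, hcard⟩ := h s hs
    obtain ⟨c, hc, hadj⟩ := ih _ (Finset.erase_ssubset hv)
    obtain ⟨a, ha, ha'⟩ : ∃ a ∈ range n, a ∉ ({w ∈ s | G.Adj v w}).image c := by
      apply Finset.exists_mem_notMem_of_card_lt_card
      rw [card_range]
      exact card_image_le.trans_lt hcard
    have hne : ∀ y ∈ s, G.Adj v y → c y ≠ a := fun y hy hvy hya ↦
      ha' (mem_image.2 ⟨y, mem_filter.2 ⟨hy, hvy⟩, hya⟩)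
    refine ⟨Function.update c v a, fun x hx ↦ ?_, fun x hx y hy hxy ↦ ?_⟩
    · by_cases hxv : x = v
      · subst hxv; simpa using ha
      · simpa [hxv] using hc x (mem_erase.2 ⟨hxv, hx⟩)
    · by_cases hxv : x = v
      · subst hxv
        simpa [hxy.ne'] using (hne y hy hxy).symm
      · by_cases hyv : y = v
        · subst hyv
          simpa [hxv] using hne x hx hxy.symm
        · simpa [hxv, hyv] using hadj x (mem_erase.2 ⟨hxv, hx⟩) y (mem_erase.2 ⟨hyv, hy⟩) hxy

/-- A graph that is not `n`-colorable has a finite connected induced subgraph of minimum degree at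
least `n`. -/
theorem exists_finite_connected_minDegree {V : Type*} {G : SimpleGraph V} {n : ℕ}
    (hG : ¬ G.Colorable n) :
    ∃ s : Set V, s.Finite ∧ (G.induce s).Connected ∧
      ∀ v ∈ s, n ≤ {w | w ∈ s ∧ G.Adj v w}.ncard := by
  classical
  obtain ⟨s, ⟨v, hv⟩, hs⟩ : ∃ s : Finset V, s.Nonempty ∧
      ∀ v ∈ s, n ≤ #{w ∈ s | G.Adj v w} := by
    by_contra! hcon
    have hcol := colorable_induce_of_forall_exists_card_lt hcon
    refine hG (nonempty_hom_of_forall_finite_subgraph_hom fun G' hfin ↦ ?_)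
    have c : (G.induce (hfin.toFinset : Set V)).Coloring (Fin n) := (hcol hfin.toFinset).some
    exact c.comp ⟨fun x ↦ ⟨x, by simp⟩, fun h ↦ h.adj_sub⟩
  let C := (G.induce (s : Set V)).connectedComponentMk ⟨v, hv⟩
  have hmem : ∀ a b, a ∈ Subtype.val '' C.supp → b ∈ s → G.Adj a b →
      b ∈ Subtype.val '' C.supp := by
    rintro _ b ⟨a, ha, rfl⟩ hb hab
    exact ⟨⟨b, hb⟩, C.mem_supp_of_adj_mem_supp ha hab, rfl⟩
  refine ⟨Subtype.val '' C.supp, s.finite_toSet.subset ?_, ?_, fun a ha ↦ ?_⟩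
  · rintro _ ⟨a, -, rfl⟩
    exact a.2
  · have e : C.toSimpleGraph ≃g G.induce (Subtype.val '' C.supp) :=
      { toEquiv := Equiv.Set.image _ C.supp Subtype.val_injective
        map_rel_iff' := Iff.rfl }
    exact e.connected_iff.1 C.connected_toSimpleGraph
  · have has : a ∈ s := by obtain ⟨a, -, rfl⟩ := ha; exact a.2
    rw [show {w | w ∈ Subtype.val '' C.supp ∧ G.Adj a w} =
        (({w ∈ s | G.Adj a w} : Finset V) : Set V) from ?_, Set.ncard_coe_finset]
    · exact hs a has
    · ext b
      simp only [Set.mem_ofPred_eq, coe_filter]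
      refine ⟨fun ⟨hb, hab⟩ ↦ ⟨?_, hab⟩, fun ⟨hb, hab⟩ ↦ ⟨hmem a b ha hb hab, hab⟩⟩
      obtain ⟨b, -, rfl⟩ := hb
      exact b.2

end MinDegree
/-- A finite graph without cycles of length 3 or 4 in which every degree is at least `D` has an
induced cycle, with vertices `c 0, …, c m`, of length `m + 1 ≥ D + 3`. -/
theorem exists_long_induced_cycle_of_minDegree {ι : Type*} [Fintype ι] [Nonempty ι]
    [DecidableEq ι] {H : SimpleGraph ι} [DecidableRel H.Adj] {D : ℕ} (hD : 2 ≤ D)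
    (h3 : ∀ a b c, H.Adj a b → H.Adj b c → ¬ H.Adj a c)
    (h4 : ∀ a b c d, a ≠ c → b ≠ d → H.Adj a b → H.Adj b c → H.Adj c d → ¬ H.Adj d a)
    (hdeg : ∀ v, D ≤ H.degree v) :
    ∃ (m : ℕ) (c : ℕ → ι), D + 2 ≤ m ∧ ∀ i j, i < j → j ≤ m →
      c i ≠ c j ∧ (H.Adj (c i) (c j) ↔ i + 1 = j ∨ (i = 0 ∧ j = m)) := by
  let P : ℕ → (ℕ → ι) → Prop := fun n p ↦ ∀ i j, i < j → j < n →
    p i ≠ p j ∧ (H.Adj (p i) (p j) ↔ i + 1 = j)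
  have hbound : ∀ n p, P n p → n ≤ Fintype.card ι := by
    intro n p hp
    have hinj : Function.Injective (fun i : Fin n ↦ p i) := by
      intro i j hij
      by_contra hne
      rcases lt_or_gt_of_ne (Fin.val_ne_of_ne hne) with hlt | hlt
      · exact (hp i j hlt j.2).1 hij
      · exact (hp j i hlt i.2).1 hij.symm
    simpa using Fintype.card_le_of_injective _ hinj
  obtain ⟨n, ⟨p, hp⟩, hmax⟩ : ∃ n, (∃ p, P n p) ∧ ∀ k, (∃ q, P k q) → k ≤ n := by
    have hbdd : BddAbove {n | ∃ p, P n p} :=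
      ⟨Fintype.card ι, by rintro n ⟨p, hp⟩; exact hbound n p hp⟩
    have hnonempty : {n | ∃ p, P n p}.Nonempty :=
      ⟨0, fun _ ↦ Classical.arbitrary ι, fun i j _ hj ↦ by omega⟩
    exact ⟨_, Nat.sSup_mem hnonempty hbdd,
      fun k hk ↦ le_csSup hbdd hk⟩
  let cons : ι → ℕ → ι := fun u i ↦ if i = 0 then u else p (i - 1)
  have hn : 1 ≤ n := hmax 1 ⟨fun _ ↦ Classical.arbitrary ι, fun i j hij hj ↦ by omega⟩
  have hne : ∀ u, H.Adj (p 0) u → u ≠ p 1 → ∀ j < n, u ≠ p j := by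
    rintro u hu hu1 j hj rfl
    rcases j with _ | _ | j
    · exact hu.ne rfl
    · exact hu1 rfl
    · exact absurd ((hp 0 (j + 2) (by omega) hj).2.1 hu) (by omega)
  have hex : ∀ u, H.Adj (p 0) u → u ≠ p 1 → ∃ j, 1 ≤ j ∧ j < n ∧ H.Adj u (p j) := by
    intro u hu hu1
    by_contra! hcon
    have : n + 1 ≤ n := by
      refine hmax _ ⟨cons u, fun i j hij hj ↦ ?_⟩
      obtain ⟨j, rfl⟩ : ∃ k, j = k + 1 := ⟨j - 1, by omega⟩
      rcases i with _ | i
      · refine ⟨by simpa [cons] using hne u hu hu1 j (by omega), ?_⟩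
        rcases j with _ | j
        · simpa [cons] using hu.symm
        · simpa [cons] using hcon (j + 1) (by omega) (by omega)
      · simpa [cons] using hp i j (by omega) (by omega)
    omega
  have hJ : ∀ u, ∃ j, H.Adj (p 0) u → u ≠ p 1 → 3 ≤ j ∧ j < n ∧ H.Adj u (p j) ∧
      ∀ i, 1 ≤ i → i < j → ¬ H.Adj u (p i) := by
    intro u
    by_cases hu : H.Adj (p 0) u ∧ u ≠ p 1
    · have hx := hex u hu.1 hu.2
      refine ⟨Nat.find hx, fun _ _ ↦ ?_⟩
      obtain ⟨h1, hlt, hadj⟩ := Nat.find_spec hx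
      refine ⟨?_, hlt, hadj, fun i hi hij hui ↦ Nat.find_min hx hij ⟨hi, hij.trans hlt, hui⟩⟩
      by_contra! hlt3
      obtain h | h : Nat.find hx = 1 ∨ Nat.find hx = 2 := by omega
      · rw [h] at hadj hlt
        exact h3 _ _ _ hu.1 hadj ((hp 0 1 (by omega) hlt).2.2 rfl)
      · rw [h] at hadj hlt
        exact h4 (p 0) u (p 2) (p 1) (hp 0 2 (by omega) hlt).1 hu.2 hu.1 hadj
          ((hp 1 2 (by omega) hlt).2.2 rfl).symm ((hp 0 1 (by omega) (by omega)).2.2 rfl).symm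
    · exact ⟨0, fun h h' ↦ absurd ⟨h, h'⟩ hu⟩
  choose J hJ using hJ
  obtain ⟨u, hu, hu1, hDJ⟩ : ∃ u, H.Adj (p 0) u ∧ u ≠ p 1 ∧ D + 1 ≤ J u := by
    by_contra! hcon
    have hcard : #((H.neighborFinset (p 0)).erase (p 1)) ≤ #(Ico 3 (D + 1)) := by
      refine card_le_card_of_injOn J (fun u hu ↦ ?_) (fun u hu u' hu' heq ↦ ?_)
      · simp only [coe_erase, Set.mem_sdiff, mem_coe, mem_neighborFinset,
          Set.mem_singleton_iff] at hu
        exact mem_coe.2 (mem_Ico.2 ⟨(hJ u hu.1 hu.2).1, hcon u hu.1 hu.2⟩)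
      · simp only [coe_erase, Set.mem_sdiff, mem_coe, mem_neighborFinset,
          Set.mem_singleton_iff] at hu hu'
        by_contra hne'
        obtain ⟨h1, h2, h5, -⟩ := hJ u hu.1 hu.2
        obtain ⟨-, -, h6, -⟩ := hJ u' hu'.1 hu'.2
        rw [← heq] at h6
        exact h4 u (p 0) u' (p (J u)) hne' (hp 0 _ (by omega) h2).1 hu.1.symm hu'.1 h6 h5.symm
    have := pred_card_le_card_erase (s := H.neighborFinset (p 0)) (a := p 1)
    have := hdeg (p 0)
    rw [← card_neighborFinset_eq_degree] at this
    rw [Nat.card_Ico] at hcard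
    omega
  obtain ⟨h1, h2, h5, h6⟩ := hJ u hu hu1
  refine ⟨J u + 1, cons u, by omega, fun i j hij hj ↦ ?_⟩
  obtain ⟨j, rfl⟩ : ∃ k, j = k + 1 := ⟨j - 1, by omega⟩
  rcases i with _ | i
  · refine ⟨by simpa [cons] using hne u hu hu1 j (by omega), ?_⟩
    rcases j with _ | j
    · simpa [cons] using hu.symm
    · rcases (show j + 1 ≤ J u by omega).lt_or_eq with hlt | heq
      · have := h6 (j + 1) (by omega) hlt
        simp [cons, this]; omega
      · simpa [cons, heq] using h5
  · have := hp i j (by omega) (by omega)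
    simpa [cons] using this

section Contraction

/-- Any two vertices in a common fiber of `f` are joined by a walk of length at most `s` inside
that fiber. -/
def FibersJoinedWithin {V ι : Type*} (G : SimpleGraph V) (f : V → ι) (s : ℕ) : Prop :=
  ∀ u v, f u = f v → ∃ w : G.Walk u v, w.length ≤ s ∧ ∀ y ∈ w.support, f y = f u

section

variable {V ι : Type*} {G : SimpleGraph V} {f : V → ι} {s : ℕ}

theorem isDiag_map_of_forall_mem_support {u v : V} {w : G.Walk u v} {a : ι}
    (hw : ∀ y ∈ w.support, f y = a) {e : Sym2 V} (he : e ∈ w.edges) : (e.map f).IsDiag := by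
  induction e using Sym2.ind with
  | _ x y =>
    rw [Sym2.map_mk, Sym2.mk_isDiag_iff, hw x (w.fst_mem_support_of_mem_edges he),
      hw y (w.snd_mem_support_of_mem_edges he)]

theorem FibersJoinedWithin.exists_walk_lift (hf : FibersJoinedWithin G f s) {a b : ι}
    (q : (G.map f).Walk a b) {u v : V} (hu : f u = a) (hv : f v = b) :
    ∃ w : G.Walk u v, w.length ≤ q.length + (q.length + 1) * s ∧
      ∀ e ∈ w.edges, (e.map f).IsDiag ∨ e.map f ∈ q.edges := by
  induction q generalizing u with
  | nil =>
    obtain ⟨w, hw, hsup⟩ := hf u v (hu.trans hv.symm)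
    exact ⟨w, by simpa using hw, fun e he ↦ .inl (isDiag_map_of_forall_mem_support hsup he)⟩
  | cons h q ih =>
    obtain ⟨-, x, y, hxy, hx, hy⟩ := (map_adj' ..).1 h
    obtain ⟨w, hw, hsup⟩ := hf u x (hu.trans hx.symm)
    obtain ⟨w', hw', hedge⟩ := ih hy hv
    refine ⟨w.append (Walk.cons hxy w'), ?_, fun e he ↦ ?_⟩
    · simp only [Walk.length_append, Walk.length_cons]
      linarith
    · rw [Walk.edges_append, Walk.edges_cons, List.mem_append, List.mem_cons] at he
      rw [Walk.edges_cons, List.mem_cons]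
      rcases he with he | rfl | he
      · exact .inl (isDiag_map_of_forall_mem_support hsup he)
      · right; left; rw [Sym2.map_mk, hx, hy]
      · exact (hedge e he).imp_right .inr

theorem FibersJoinedWithin.egirth_le (hf : FibersJoinedWithin G f s) {a b : ι}
    (hab : (G.map f).Adj a b) (q : (G.map f).Walk a b) (hq : s(a, b) ∉ q.edges) :
    G.egirth ≤ ((q.length + 1) * (s + 1) : ℕ) := by
  obtain ⟨hne, u, v, huv, rfl, rfl⟩ := (map_adj' ..).1 hab
  obtain ⟨w, hw, hedge⟩ := hf.exists_walk_lift q rfl rfl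
  refine (egirth_le_of_walk huv w fun hmem ↦ ?_).trans ?_
  · rcases hedge _ hmem with h | h
    · exact hne h
    · exact hq h
  · exact_mod_cast (by linarith : w.length + 1 ≤ (q.length + 1) * (s + 1))

/-- In large girth, adjacent fibers are joined by a single edge. -/
theorem FibersJoinedWithin.eq_of_adj (hf : FibersJoinedWithin G f s)
    (hg : ((2 * s + 2 : ℕ) : ℕ∞) < G.egirth) {u v u' v' : V} (h : G.Adj u v) (h' : G.Adj u' v')
    (hu : f u = f u') (hv : f v = f v') (hne : f u ≠ f v) : u = u' ∧ v = v' := by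
  obtain ⟨w, hw, hsup⟩ := hf u u' hu
  obtain ⟨w', hw', hsup'⟩ := hf v' v hv.symm
  by_contra hcon
  refine hg.not_ge ((egirth_le_of_walk h (w.append (Walk.cons h' w')) fun hmem ↦ ?_).trans ?_)
  · rw [Walk.edges_append, Walk.edges_cons, List.mem_append, List.mem_cons] at hmem
    rcases hmem with he | he | he
    · exact hne (isDiag_map_of_forall_mem_support hsup he)
    · rcases Sym2.eq_iff.1 he with he | ⟨rfl, rfl⟩
      · exact hcon he
      · exact hne hv.symm
    · exact hne (isDiag_map_of_forall_mem_support hsup' he)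
  · simp only [Walk.length_append, Walk.length_cons]
    exact_mod_cast (by omega : w.length + (w'.length + 1) + 1 ≤ 2 * s + 2)

end

/-- An induced cycle of the contraction, with vertices `c 0, …, c m`, gives an induced cycle of
`G` that is at least as long. -/
theorem FibersJoinedWithin.exists_hasInducedCycleLen {V : Type} {ι : Type*} {G : SimpleGraph V}
    {f : V → ι} {s m : ℕ} (hf : FibersJoinedWithin G f s)
    (hg : ((2 * s + 2 : ℕ) : ℕ∞) < G.egirth) (hm : 2 ≤ m) {c : ℕ → ι}
    (hc : ∀ i j, i < j → j ≤ m →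
      c i ≠ c j ∧ ((G.map f).Adj (c i) (c j) ↔ i + 1 = j ∨ (i = 0 ∧ j = m))) :
    ∃ ℓ, HasInducedCycleLen G ℓ ∧ m + 1 ≤ ℓ := by
  obtain ⟨hne, u, v, huv, hu, hv⟩ := (map_adj' ..).1 ((hc 0 m (by omega) le_rfl).2.2 (by simp))
  let S : Set V := {x | ∃ i ≤ m, f x = c i}
  let G' : SimpleGraph V :=
    { Adj := fun x y ↦ G.Adj x y ∧ x ∈ S ∧ y ∈ S ∧ s(x, y) ≠ s(u, v)
      symm := ⟨fun x y h ↦ ⟨h.1.symm, h.2.2.1, h.2.1, Sym2.eq_swap ▸ h.2.2.2⟩⟩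
      loopless := ⟨fun x h ↦ h.1.ne rfl⟩ }
  have hfiber : ∀ i ≤ m, ∀ x y, f x = c i → f y = c i → G'.Reachable x y := by
    intro i hi x y hx hy
    obtain ⟨w, -, hsup⟩ := hf x y (hx.trans hy.symm)
    refine ⟨w.transfer G' fun e he ↦ ?_⟩
    have hdiag := isDiag_map_of_forall_mem_support hsup he
    induction e using Sym2.ind with
    | _ a b =>
      refine ⟨w.adj_of_mem_edges he, ⟨i, hi, ?_⟩, ⟨i, hi, ?_⟩, fun heq ↦ ?_⟩
      · rw [hsup a (w.fst_mem_support_of_mem_edges he), hx]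
      · rw [hsup b (w.snd_mem_support_of_mem_edges he), hx]
      · rw [heq, Sym2.map_mk, Sym2.mk_isDiag_iff, hu, hv] at hdiag
        exact hne hdiag
  have hreach : ∀ i ≤ m, ∀ x, f x = c i → G'.Reachable u x := by
    intro i
    induction i with
    | zero => exact fun _ x hx ↦ hfiber 0 (by omega) u x hu hx
    | succ i ih =>
      intro hi x hx
      obtain ⟨-, a, b, hab, ha, hb⟩ :=
        (map_adj' ..).1 ((hc i (i + 1) (by omega) hi).2.2 (.inl rfl))
      refine (ih (by omega) a ha).trans (Reachable.trans (Adj.reachable ?_) (hfiber _ hi b x hb hx))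
      refine ⟨hab, ⟨i, by omega, ha⟩, ⟨i + 1, hi, hb⟩, fun heq ↦ ?_⟩
      rcases Sym2.eq_iff.1 heq with ⟨rfl, rfl⟩ | ⟨rfl, rfl⟩
      · rcases hi.lt_or_eq with hlt | heq
        · exact (hc (i + 1) m hlt le_rfl).1 (hb.symm.trans hv)
        · exact (hc 0 i (by omega) (by omega)).1 (hu.symm.trans ha)
      · exact (hc 0 (i + 1) (by omega) hi).1 (hu.symm.trans hb)
  have hinj : Set.InjOn c (Set.Iic m) := by
    intro i hi j hj hij
    rcases lt_trichotomy i j with h | h | h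
    exacts [((hc i j h hj).1 hij).elim, h, ((hc j i h hi).1 hij.symm).elim]
  obtain ⟨ψ, hψ⟩ : ∃ ψ : ι → ℕ, ∀ i ≤ m, ψ (c i) = i :=
    ⟨Function.invFunOn c (Set.Iic m), fun i hi ↦ hinj.leftInvOn_invFunOn hi⟩
  have hadj_lt : ∀ x y i j, i < j → j ≤ m → f x = c i → f y = c j → G'.Adj x y → j = i + 1 := by
    intro x y i j hij hj hx hy hxy
    have hne' : f x ≠ f y := by rw [hx, hy]; exact (hc i j hij hj).1
    have hH : (G.map f).Adj (c i) (c j) := (map_adj' ..).2 ⟨hx ▸ hy ▸ hne', x, y, hxy.1, hx, hy⟩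
    rcases (hc i j hij hj).2.1 hH with h | ⟨rfl, rfl⟩
    · exact h.symm
    · obtain ⟨rfl, rfl⟩ := hf.eq_of_adj hg hxy.1 huv (hx.trans hu.symm) (hy.trans hv.symm) hne'
      exact (hxy.2.2.2 rfl).elim
  have hstep : ∀ x y, G'.Adj x y → ψ (f y) ≤ ψ (f x) + 1 := by
    intro x y hxy
    obtain ⟨i, hi, hx⟩ := hxy.2.1
    obtain ⟨j, hj, hy⟩ := hxy.2.2.1
    rw [hx, hy, hψ i hi, hψ j hj]
    rcases lt_or_ge i j with h | h
    · exact (hadj_lt x y i j h hj hx hy hxy).le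
    · omega
  have hwalk : ∀ x y (w : G'.Walk x y), ψ (f y) ≤ ψ (f x) + w.length := by
    intro x y w
    induction w with
    | nil => simp
    | cons h w ih =>
      have := hstep _ _ h
      rw [Walk.length_cons]
      omega
  have hr := hreach m le_rfl v hv
  refine ⟨_, hasInducedCycleLen_of_dist (G' := G') huv (fun x y ↦ Iff.rfl) hr, ?_⟩
  obtain ⟨w, hw⟩ := hr.exists_walk_length_eq_dist
  have := hwalk u v w
  rw [hu, hv, hψ m le_rfl, hψ 0 (by omega), hw] at this
  omega

end Contraction

section Growth

variable {V : Type*} {G : SimpleGraph V}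

/-- In large girth, a vertex has at most one neighbor that is no further from `x`. -/
theorem eq_of_adj_of_dist_le (hG : G.Connected) {x t w w' : V}
    (hg : ((2 * G.dist x t + 2 : ℕ) : ℕ∞) < G.egirth) (hw : G.Adj t w) (hw' : G.Adj t w')
    (hd : G.dist x w ≤ G.dist x t) (hd' : G.dist x w' ≤ G.dist x t) : w = w' := by
  classical
  by_contra hne
  have havoid : ∀ y (p : G.Walk y x), G.Adj t y → p.length = G.dist y x →
      G.dist x y ≤ G.dist x t → t ∉ p.support := by
    intro y p hty hp hdy ht
    have h1 := congrArg Walk.length (p.take_spec ht)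
    rw [Walk.length_append] at h1
    have h2 := dist_le (p.dropUntil t ht)
    have h3 : 0 < (p.takeUntil t ht).length := by
      by_contra! h0
      exact hty.ne (Walk.eq_of_length_eq_zero (Nat.le_zero.1 h0)).symm
    rw [G.dist_comm] at hdy h2
    rw [hp] at h1
    rw [G.dist_comm (u := x) (v := t)] at hdy
    rw [G.dist_comm (u := x) (v := t)] at h2
    omega
  obtain ⟨p, hp⟩ := hG.exists_walk_length_eq_dist w x
  obtain ⟨p', hp'⟩ := hG.exists_walk_length_eq_dist w' x
  refine hg.not_ge ((egirth_le_of_walk hw (Walk.cons hw' (p'.append p.reverse))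
    fun hmem ↦ ?_).trans ?_)
  · rw [Walk.edges_cons, Walk.edges_append, Walk.edges_reverse, List.mem_cons, List.mem_append,
      List.mem_reverse] at hmem
    rcases hmem with h | h | h
    · exact hne (Sym2.congr_right.1 h)
    · exact havoid w' p' hw' hp' hd' (p'.fst_mem_support_of_mem_edges h)
    · exact havoid w p hw hp hd (p.fst_mem_support_of_mem_edges h)
  · simp only [Walk.length_cons, Walk.length_append, Walk.length_reverse, hp, hp']
    rw [G.dist_comm] at hd hd'
    exact_mod_cast (by omega : G.dist w' x + G.dist w x + 1 + 1 ≤ 2 * G.dist x t + 2)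

variable [Fintype V] [DecidableEq V] [DecidableRel G.Adj]

/-- A vertex set inside a ball that induces a forest sends out many edges. -/
theorem mul_card_add_two_le_sum_card_adj_compl (hG : G.Connected) {e r : ℕ}
    (hg : ((2 * r + 2 : ℕ) : ℕ∞) < G.egirth) (hdeg : ∀ v, e + 2 ≤ G.degree v)
    {T : Finset V} {x : V} (hx : x ∈ T) (hT : ∀ t ∈ T, G.dist x t ≤ r) :
    e * #T + 2 ≤ ∑ t ∈ T, #{w ∈ Tᶜ | G.Adj t w} := by
  have hsplit : ∀ t, G.degree t = #{w ∈ T | G.Adj t w} + #{w ∈ Tᶜ | G.Adj t w} := by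
    intro t
    rw [← card_neighborFinset_eq_degree, ← card_union_of_disjoint]
    · congr 1
      ext w
      simp only [mem_neighborFinset, mem_union, mem_filter, mem_compl]
      tauto
    · exact disjoint_filter_filter disjoint_compl_right
  have hlow : ∀ t ∈ T, #{w ∈ T | G.Adj t w ∧ G.dist x w ≤ G.dist x t} ≤
      if t = x then 0 else 1 := by
    intro t ht
    split_ifs with htx
    · subst htx
      rw [Nat.le_zero, card_eq_zero, filter_eq_empty_iff]
      rintro w - ⟨hadj, hd⟩
      rw [dist_self, Nat.le_zero, hG.dist_eq_zero_iff] at hd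
      exact hadj.ne hd
    · rw [card_le_one]
      intro w hw w' hw'
      rw [mem_filter] at hw hw'
      refine eq_of_adj_of_dist_le hG (lt_of_le_of_lt ?_ hg) hw.2.1 hw'.2.1 hw.2.2 hw'.2.2
      have := hT t ht
      exact_mod_cast (by omega : 2 * G.dist x t + 2 ≤ 2 * r + 2)
  have hsumlow : ∑ t ∈ T, #{w ∈ T | G.Adj t w ∧ G.dist x w ≤ G.dist x t} + 1 ≤ #T := by
    have h1 := sum_le_sum hlow
    have h2 : ∑ t ∈ T, (if t = x then 0 else 1) + 1 = #T := by
      rw [← add_sum_erase _ _ hx, sum_congr rfl fun t ht ↦ if_neg (ne_of_mem_erase ht)]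
      simp [card_erase_of_mem hx, Nat.sub_add_cancel (card_pos.2 ⟨x, hx⟩)]
    omega
  have hswap : ∑ t ∈ T, #{w ∈ T | G.Adj t w ∧ G.dist x t ≤ G.dist x w} =
      ∑ t ∈ T, #{w ∈ T | G.Adj t w ∧ G.dist x w ≤ G.dist x t} := by
    refine (sum_card_bipartiteAbove_eq_sum_card_bipartiteBelow
      (fun t w ↦ G.Adj t w ∧ G.dist x t ≤ G.dist x w)).trans (sum_congr rfl fun t _ ↦ ?_)
    simp only [bipartiteBelow, G.adj_comm]
  have hinner : ∑ t ∈ T, #{w ∈ T | G.Adj t w} ≤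
      ∑ t ∈ T, #{w ∈ T | G.Adj t w ∧ G.dist x w ≤ G.dist x t} +
      ∑ t ∈ T, #{w ∈ T | G.Adj t w ∧ G.dist x t ≤ G.dist x w} := by
    rw [← sum_add_distrib]
    refine sum_le_sum fun t _ ↦ (card_le_card fun w hw ↦ ?_).trans (card_union_le _ _)
    rw [mem_filter] at hw
    rw [mem_union, mem_filter, mem_filter]
    rcases le_total (G.dist x w) (G.dist x t) with h | h
    exacts [.inl ⟨hw.1, hw.2, h⟩, .inr ⟨hw.1, hw.2, h⟩]
  have htotal : (e + 2) * #T ≤ ∑ t ∈ T, G.degree t := by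
    rw [mul_comm, ← smul_eq_mul]
    exact card_nsmul_le_sum _ _ _ fun t _ ↦ hdeg t
  simp only [hsplit, sum_add_distrib] at htotal
  linarith

theorem mul_pow_le_mul_card_dist_le (hG : G.Connected) {e k : ℕ}
    (hg : ((2 * k + 2 : ℕ) : ℕ∞) < G.egirth) (hdeg : ∀ v, e + 2 ≤ G.degree v) (x : V) :
    (e + 2) * (e + 1) ^ k ≤ e * #{v | G.dist x v ≤ k} + 2 := by
  induction k with
  | zero =>
    have : 1 ≤ #{v | G.dist x v ≤ 0} := card_pos.2 ⟨x, by simp⟩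
    nlinarith
  | succ k ih =>
    have hle : ((2 * k + 2 : ℕ) : ℕ∞) < G.egirth :=
      lt_of_le_of_lt (by exact_mod_cast (by omega : 2 * k + 2 ≤ 2 * (k + 1) + 2)) hg
    have h1 := mul_card_add_two_le_sum_card_adj_compl hG hle hdeg
      (T := {v | G.dist x v ≤ k}) (x := x) (by simp) (fun t ht ↦ (mem_filter.1 ht).2)
    set B : Finset V := {v | G.dist x v ≤ k} with hB
    set B' : Finset V := {v | G.dist x v ≤ k + 1} with hB'
    have hBB' : B ⊆ B' := fun v hv ↦ by
      rw [hB, mem_filter] at hv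
      exact mem_filter.2 ⟨mem_univ _, hv.2.trans (Nat.le_succ k)⟩
    have h2 : ∑ t ∈ B, #{w ∈ Bᶜ | G.Adj t w} ≤ #(B' \ B) := by
      rw [show ∑ t ∈ B, #{w ∈ Bᶜ | G.Adj t w} = ∑ w ∈ Bᶜ, #{t ∈ B | G.Adj t w} from
        sum_card_bipartiteAbove_eq_sum_card_bipartiteBelow G.Adj]
      have h3 : ∀ w ∈ Bᶜ, #{t ∈ B | G.Adj t w} ≤ if w ∈ B' then 1 else 0 := by
        intro w hw
        rw [mem_compl, hB, mem_filter] at hw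
        split_ifs with hwB'
        · rw [hB', mem_filter] at hwB'
          rw [card_le_one]
          intro t ht t' ht'
          rw [mem_filter, hB, mem_filter] at ht ht'
          have hw' : k < G.dist x w := by simpa using hw
          refine eq_of_adj_of_dist_le (t := w) hG (lt_of_le_of_lt ?_ hg) ht.2.symm ht'.2.symm
            (ht.1.2.trans hw'.le) (ht'.1.2.trans hw'.le)
          exact_mod_cast (by omega : 2 * G.dist x w + 2 ≤ 2 * (k + 1) + 2)
        · rw [Nat.le_zero, card_eq_zero, filter_eq_empty_iff]
          intro t ht htw
          rw [hB, mem_filter] at ht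
          refine hwB' (mem_filter.2 ⟨mem_univ _, ?_⟩)
          have h4 := hG.dist_triangle (u := x) (v := t) (w := w)
          rw [dist_eq_one_iff_adj.2 htw] at h4
          omega
      refine (sum_le_sum h3).trans (le_of_eq ?_)
      rw [← sum_filter, sum_const, smul_eq_mul, mul_one]
      congr 1
      ext w
      simp only [mem_filter, mem_compl, mem_sdiff]
      tauto
    have h5 := card_sdiff_add_card_eq_card hBB'
    calc (e + 2) * (e + 1) ^ (k + 1) = (e + 1) * ((e + 2) * (e + 1) ^ k) := by ring
      _ ≤ (e + 1) * (e * #B + 2) := Nat.mul_le_mul_left _ (ih hle)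
      _ = e * ((e * #B + 2) + #B) + 2 := by ring
      _ ≤ e * #B' + 2 := by gcongr; omega

end Growth

/-- A partition of the vertices into connected cells of radius at most `2 * k` such that each cell
contains the ball of radius `k` around its center. -/
theorem exists_cells {V : Type*} [Fintype V] [DecidableEq V] {G : SimpleGraph V}
    (hG : G.Connected) (k : ℕ) :
    ∃ (X : Finset V) (f : V → X),
      (∀ v, ∃ w : G.Walk v (f v), w.length ≤ 2 * k ∧ ∀ y ∈ w.support, f y = f v) ∧
      ∀ (x : X) v, G.dist x v ≤ k → f v = x := by
  let Sep : Finset V → Prop := fun X ↦ ∀ x ∈ X, ∀ y ∈ X, G.dist x y ≤ 2 * k → x = y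
  obtain ⟨X, hX⟩ : ∃ X, Maximal Sep X := Set.Finite.exists_maximal (Set.toFinite {X | Sep X})
    ⟨∅, fun x hx ↦ by simp at hx⟩
  have hcover : ∀ v, ∃ x ∈ X, G.dist v x ≤ 2 * k := by
    intro v
    by_contra! hcon
    have hv : v ∉ X := fun hv ↦ by simpa using hcon v hv
    refine hv (hX.2 (y := insert v X) ?_ (subset_insert v X) (mem_insert_self v X))
    intro x hx y hy hxy
    rw [mem_insert] at hx hy
    rcases hx with rfl | hx <;> rcases hy with rfl | hy
    · rfl
    · exact absurd hxy (hcon y hy).not_ge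
    · exact absurd (G.dist_comm ▸ hxy) (hcon x hx).not_ge
    · exact hX.1 x hx y hy hxy
  have : Nonempty X := by
    obtain ⟨x, hx, -⟩ := hcover hG.nonempty.some
    exact ⟨⟨x, hx⟩⟩
  let N := Fintype.card V
  let idx : V ≃ Fin N := Fintype.equivFin V
  let cost : V → X → ℕ := fun v x ↦ N * G.dist v x + idx x
  have hcost : ∀ v x y, cost v x ≤ cost v y → G.dist v x ≤ G.dist v y := by
    intro v x y h
    by_contra! hlt
    have h1 : N * (G.dist v y + 1) ≤ N * G.dist v x := Nat.mul_le_mul_left _ hlt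
    have h2 := (idx y).2
    simp only [cost] at h
    linarith [(idx x).1.zero_le]
  have hcost_inj : ∀ v x y, cost v x = cost v y → x = y := by
    intro v x y h
    have h1 : G.dist v x = G.dist v y := le_antisymm (hcost v x y h.le) (hcost v y x h.ge)
    simp only [cost, h1, Nat.add_left_cancel_iff] at h
    exact Subtype.ext (idx.injective (Fin.ext h))
  have hmin : ∀ v, ∃ x, ∀ y, cost v x ≤ cost v y := fun v ↦ Finite.exists_min (cost v)
  choose f hf using hmin
  have hdist : ∀ v (x : X), G.dist v (f v) ≤ G.dist v x := fun v x ↦ hcost _ _ _ (hf v x)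
  have hstep : ∀ v v', G.Adj v v' → G.dist v (f v) = G.dist v' (f v) + 1 → f v' = f v := by
    intro v v' hadj hd
    refine hcost_inj v' _ _ (le_antisymm (hf v' _) ?_)
    have h1 := hf v (f v')
    have h2 : G.dist v (f v') ≤ G.dist v' (f v') + 1 := by
      have h3 := hG.dist_triangle (u := v) (v := v') (w := f v')
      rw [dist_eq_one_iff_adj.2 hadj] at h3
      omega
    have h4 := Nat.mul_le_mul_left N h2
    simp only [cost, hd] at h1 ⊢
    linarith
  have hwalk : ∀ n v, G.dist v (f v) = n →
      ∃ w : G.Walk v (f v), w.length = n ∧ ∀ y ∈ w.support, f y = f v := by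
    intro n
    induction n with
    | zero =>
      intro v hv
      rw [hG.dist_eq_zero_iff] at hv
      refine ⟨Walk.nil.copy rfl hv, by simp, fun y hy ↦ ?_⟩
      simp only [Walk.support_copy, Walk.support_nil, List.mem_singleton] at hy
      rw [hy]
    | succ n ih =>
      intro v hv
      obtain ⟨p, hp⟩ := hG.exists_walk_length_eq_dist v (f v)
      obtain ⟨v', hadj, hd⟩ : ∃ v', G.Adj v v' ∧ G.dist v (f v) = G.dist v' (f v) + 1 := by
        generalize f v = z at *
        cases p with
        | nil => simp at hv
        | @cons _ v' _ h q =>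
          refine ⟨v', h, ?_⟩
          have h1 := dist_le q
          have h2 := hG.dist_triangle (u := v) (v := v') (w := z)
          rw [dist_eq_one_iff_adj.2 h] at h2
          rw [Walk.length_cons] at hp
          omega
      have hfv := hstep v v' hadj hd
      obtain ⟨w, hw, hsup⟩ := ih v' (by rw [hfv]; omega)
      refine ⟨Walk.cons hadj (w.copy rfl (by rw [hfv])), by simp [hw], fun y hy ↦ ?_⟩
      simp only [Walk.support_cons, Walk.support_copy, List.mem_cons] at hy
      rcases hy with rfl | hy
      · rfl
      · rw [hsup y hy, hfv]
  refine ⟨X, f, fun v ↦ ?_, fun x v hxv ↦ ?_⟩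
  · obtain ⟨w, hw, hsup⟩ := hwalk _ v rfl
    obtain ⟨x, hx, hd⟩ := hcover v
    exact ⟨w, hw.trans_le ((hdist v ⟨x, hx⟩).trans hd), hsup⟩
  · refine Subtype.ext (hX.1 _ (f v).2 _ x.2 ?_)
    have h1 := hdist v x
    have h2 := hG.dist_triangle (u := (f v : V)) (v := v) (w := x)
    rw [G.dist_comm (u := (f v : V)) (v := v)] at h2
    rw [G.dist_comm] at hxv
    omega

/-- A finite connected graph of minimum degree at least `e + 2` and girth at least `16 * k + 5`
has an induced cycle of length at least `3 + (e + 2) * (e + 1) ^ k`. -/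
theorem exists_long_induced_cycle_of_egirth {V : Type} [Fintype V] [DecidableEq V]
    {G : SimpleGraph V} [DecidableRel G.Adj] (hG : G.Connected) {e k : ℕ}
    (hg : ((16 * k + 5 : ℕ) : ℕ∞) ≤ G.egirth) (hdeg : ∀ v, e + 2 ≤ G.degree v) :
    ∃ ℓ, HasInducedCycleLen G ℓ ∧ 3 + (e + 2) * (e + 1) ^ k ≤ ℓ := by
  classical
  have hlt : ∀ n, n ≤ 16 * k + 4 → ((n : ℕ) : ℕ∞) < G.egirth := fun n hn ↦
    lt_of_lt_of_le (by exact_mod_cast (by omega : n < 16 * k + 5)) hg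
  obtain ⟨X, f, hwalk, hball⟩ := exists_cells hG k
  have hf : FibersJoinedWithin G f (4 * k) := by
    intro u v huv
    obtain ⟨p, hp, hsup⟩ := hwalk u
    obtain ⟨q, hq, hsup'⟩ := hwalk v
    refine ⟨p.append (q.reverse.copy (by rw [huv]) rfl), ?_, fun y hy ↦ ?_⟩
    · simp only [Walk.length_append, Walk.length_copy, Walk.length_reverse]
      omega
    · rw [Walk.mem_support_append_iff, Walk.support_copy, Walk.support_reverse,
        List.mem_reverse] at hy
      rcases hy with hy | hy
      · exact hsup y hy
      · rw [hsup' y hy, huv]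
  have hshort : ∀ {a b : X} (_ : (G.map f).Adj a b) (q : (G.map f).Walk a b), q.length ≤ 3 →
      s(a, b) ∈ q.edges := by
    intro a b hab q hq
    by_contra hmem
    refine (hlt ((q.length + 1) * (4 * k + 1)) ?_).not_ge (hf.egirth_le hab q hmem)
    nlinarith
  have hmapdeg : ∀ x, (e + 2) * (e + 1) ^ k ≤ (G.map f).degree x := by
    intro x
    have hfx : f x = x := hball x x (by simp)
    set T : Finset V := {v | f v = x} with hT
    have h1 := mul_pow_le_mul_card_dist_le hG (hlt (2 * k + 2) (by omega)) hdeg (x : V)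
    have h2 : #{v | G.dist x v ≤ k} ≤ #T :=
      card_le_card fun v hv ↦ mem_filter.2 ⟨mem_univ _, hball x v (mem_filter.1 hv).2⟩
    have h3 := mul_card_add_two_le_sum_card_adj_compl hG (r := 2 * k)
      (hlt (2 * (2 * k) + 2) (by omega)) hdeg (T := T) (x := x)
      (mem_filter.2 ⟨mem_univ _, hfx⟩) (fun t ht ↦ by
        obtain ⟨w, hw, -⟩ := hwalk t
        rw [hT, mem_filter] at ht
        rw [G.dist_comm, ← ht.2]
        exact (dist_le w).trans hw)
    have h4 : ∑ t ∈ T, #{w ∈ Tᶜ | G.Adj t w} ≤ (G.map f).degree x := by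
      rw [← card_sigma, ← card_neighborFinset_eq_degree]
      have hmem : ∀ t w, (⟨t, w⟩ : (_ : V) × V) ∈ T.sigma (fun t ↦ {w ∈ Tᶜ | G.Adj t w}) →
          f t = x ∧ f w ≠ x ∧ G.Adj t w := by
        intro t w h
        simpa [hT] using h
      refine card_le_card_of_injOn (fun p ↦ f p.2) ?_ ?_
      · rintro ⟨t, w⟩ h
        obtain ⟨ht, hw, hadj⟩ := hmem t w h
        rw [mem_coe, mem_neighborFinset, map_adj']
        exact ⟨hw.symm, t, w, hadj, ht, rfl⟩
      · rintro ⟨t, w⟩ h ⟨t', w'⟩ h' heq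
        obtain ⟨ht, hw, hadj⟩ := hmem t w h
        obtain ⟨ht', hw', hadj'⟩ := hmem t' w' h'
        obtain ⟨rfl, rfl⟩ := hf.eq_of_adj (hlt _ (by omega)) hadj hadj' (ht.trans ht'.symm) heq
          (fun h ↦ hw (h.symm.trans ht))
        rfl
    have h5 := Nat.mul_le_mul_left e h2
    omega
  have : Nonempty X := hG.nonempty.map f
  obtain ⟨m, c, hm, hc⟩ := exists_long_induced_cycle_of_minDegree (H := G.map f)
    (D := (e + 2) * (e + 1) ^ k) (by nlinarith [Nat.one_le_pow k (e + 1) (by omega)])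
    (fun a b c hab hbc hac ↦ by
      have hmem := hshort hac (.cons hab (.cons hbc .nil)) (by simp)
      simp only [Walk.edges_cons, Walk.edges_nil, List.mem_cons, List.not_mem_nil,
        Sym2.eq_iff] at hmem
      grind [hab.ne, hbc.ne])
    (fun a b c d hac hbd hab hbc hcd hda ↦ by
      have hmem := hshort hda.symm (.cons hab (.cons hbc (.cons hcd .nil))) (by simp)
      simp only [Walk.edges_cons, Walk.edges_nil, List.mem_cons, List.not_mem_nil,
        Sym2.eq_iff] at hmem
      grind [hab.ne, hda.ne, hcd.ne])
    hmapdeg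
  obtain ⟨ℓ, hℓ, hle⟩ := hf.exists_hasInducedCycleLen (hlt _ (by omega)) (by omega) hc
  exact ⟨ℓ, hℓ, by omega⟩

/-- For each g ≥ 5, every graph of girth at least g and chromatic number χ > 2
contains an induced cycle of length at least 3 + (χ−1)·(χ−2)^⌊(g−5)/16⌋. -/
theorem girth_long_induced_cycle (g : ℕ) (hg : 5 ≤ g)
    {V : Type} (G : SimpleGraph V) (hgirth : (g : ℕ∞) ≤ G.egirth)
    (χ : ℕ) (hχ : G.chromaticNumber = χ) (h2 : 2 < χ) :
    ∃ ℓ : ℕ, HasInducedCycleLen G ℓ ∧ 3 + (χ - 1) * (χ - 2) ^ ((g - 5) / 16) ≤ ℓ := by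
  classical
  obtain ⟨e, rfl⟩ : ∃ e, χ = e + 3 := ⟨χ - 3, by omega⟩
  have hcol : ¬ G.Colorable (e + 2) := by
    rw [← chromaticNumber_le_iff_colorable, hχ, not_le]
    exact_mod_cast (by omega : e + 2 < e + 3)
  obtain ⟨S, hS, hconn, hdeg⟩ := exists_finite_connected_minDegree hcol
  have := hS.fintype
  have hgS : ((16 * ((g - 5) / 16) + 5 : ℕ) : ℕ∞) ≤ (G.induce S).egirth :=
    le_trans (by exact_mod_cast (by omega : 16 * ((g - 5) / 16) + 5 ≤ g))
      (hgirth.trans (Embedding.induce S).isContained.egirth_le)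
  obtain ⟨ℓ, hℓ, hle⟩ := exists_long_induced_cycle_of_egirth hconn hgS (e := e) fun v ↦ by
    refine (hdeg v v.2).trans ?_
    rw [← card_neighborFinset_eq_degree, ← Set.ncard_coe_finset, coe_neighborFinset,
      ← Set.ncard_image_of_injective _ Subtype.val_injective]
    refine Set.ncard_le_ncard ?_ (Set.toFinite _)
    rintro w ⟨hw, hadj⟩
    exact ⟨⟨w, hw⟩, hadj, rfl⟩
  exact ⟨ℓ, hℓ.map (Embedding.induce S), hle⟩
end

section
/- Every graph G of girth at least 5 with chromatic number χ(G) > 2 contains an induced cycle of length at least χ(G) + 2. -/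
namespace SimpleGraph

variable {V : Type*} {G : SimpleGraph V}

/-- A finite set of vertices, all of whose nonempty subsets contain a vertex of degree less than
`n` within the subset, has a proper colouring by the colours `0, …, n - 1`. -/
theorem exists_coloring_of_forall_subset_exists_degree_lt [DecidableEq V] [DecidableRel G.Adj]
    (n : ℕ) (s : Finset V)
    (h : ∀ t ⊆ s, t.Nonempty → ∃ v ∈ t, (t.filter (G.Adj v)).card < n) :
    ∃ c : V → ℕ, (∀ v ∈ s, c v < n) ∧ ∀ u ∈ s, ∀ v ∈ s, G.Adj u v → c u ≠ c v := by
  induction s using Finset.strongInduction with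
  | H s ih =>
    obtain rfl | hs := s.eq_empty_or_nonempty
    · exact ⟨fun _ => 0, by simp⟩
    obtain ⟨v, hv, hdeg⟩ := h s subset_rfl hs
    obtain ⟨c, hc, hproper⟩ := ih (s.erase v) (Finset.erase_ssubset hv)
      fun t ht => h t (ht.trans (s.erase_subset v))
    obtain ⟨i, hi, hfree⟩ : ∃ i ∈ Finset.range n, i ∉ (s.filter (G.Adj v)).image c := by
      refine Finset.exists_mem_notMem_of_card_lt_card ?_
      rw [Finset.card_range]
      exact Finset.card_image_le.trans_lt hdeg
    have hfree' : ∀ u ∈ s, G.Adj v u → c u ≠ i := fun u hu huv hcu =>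
      hfree (Finset.mem_image.2 ⟨u, Finset.mem_filter.2 ⟨hu, huv⟩, hcu⟩)
    refine ⟨Function.update c v i, fun u hu => ?_, fun u hu w hw huw => ?_⟩
    · by_cases huv : u = v
      · subst huv; simpa using hi
      · simpa [huv] using hc u (Finset.mem_erase.2 ⟨huv, hu⟩)
    · by_cases huv : u = v
      · subst huv
        simpa [huw.ne'] using (hfree' w hw huw).symm
      · by_cases hwv : w = v
        · subst hwv
          simpa [huv] using hfree' u hu huw.symm
        · simpa [huv, hwv] using hproper u (Finset.mem_erase.2 ⟨huv, hu⟩) w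
            (Finset.mem_erase.2 ⟨hwv, hw⟩) huw

/-- A graph that is not `n`-colourable has a finite nonempty set of vertices inducing a subgraph
of minimum degree at least `n`. -/
theorem exists_finset_forall_le_degree_of_not_colorable [DecidableEq V] [DecidableRel G.Adj]
    {n : ℕ} (h : ¬ G.Colorable n) :
    ∃ s : Finset V, s.Nonempty ∧ ∀ v ∈ s, n ≤ (s.filter (G.Adj v)).card := by
  by_contra! hcon
  refine h (nonempty_hom_of_forall_finite_subgraph_hom fun G' hfin => ?_)
  have hc := exists_coloring_of_forall_subset_exists_degree_lt (G := G) n hfin.toFinset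
    fun t _ ht => hcon t ht
  choose c hlt hproper using hc
  exact
    { toFun := fun v => ⟨c v, hlt v (hfin.mem_toFinset.2 v.2)⟩
      map_rel' := fun {a b} hab heq => hproper a (hfin.mem_toFinset.2 a.2) b
        (hfin.mem_toFinset.2 b.2) (G'.adj_sub hab) (congrArg Fin.val heq) }

namespace Walk

/-- A path is induced if adjacent vertices on it are consecutive. -/
def IsInducedPath {a b : V} (w : G.Walk a b) : Prop :=
  w.IsPath ∧ ∀ i j, i < j → j ≤ w.length → G.Adj (w.getVert i) (w.getVert j) → j = i + 1

theorem IsInducedPath.cons {u a b : V} {w : G.Walk a b} (hw : w.IsInducedPath) (h : G.Adj u a)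
    (hu : u ∉ w.support) (hadj : ∀ j, 1 ≤ j → j ≤ w.length → ¬ G.Adj u (w.getVert j)) :
    (w.cons h).IsInducedPath := by
  refine ⟨hw.1.cons hu, fun i j hij hj huv => ?_⟩
  obtain ⟨j, rfl⟩ : ∃ k, j = k + 1 := ⟨j - 1, by lia⟩
  rw [length_cons] at hj
  cases i with
  | zero =>
    by_contra hne
    exact hadj j (by lia) (by lia) (by simpa using huv)
  | succ i =>
    have := hw.2 i j (by lia) (by lia) (by simpa using huv)
    lia

/-- A vertex off an induced path, adjacent to its start and to a further vertex of the path,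
closes an initial segment of the path to an induced cycle. -/
theorem IsInducedPath.exists_isInduced_isCycle {u a b : V} {w : G.Walk a b}
    (hw : w.IsInducedPath) (h : G.Adj u a) (hu : u ∉ w.support)
    (hex : ∃ j, 1 ≤ j ∧ j ≤ w.length ∧ G.Adj u (w.getVert j)) :
    ∃ j, 1 ≤ j ∧ j ≤ w.length ∧ G.Adj u (w.getVert j) ∧
      ∃ c : G.Walk u u, c.IsCycle ∧ c.toSubgraph.IsInduced ∧ c.length = j + 2 := by
  classical
  obtain ⟨hj1, hjl, hadj⟩ := Nat.find_spec hex
  have hmin : ∀ i < Nat.find hex, 1 ≤ i → ¬ G.Adj u (w.getVert i) :=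
    fun i hi h1 hui => Nat.find_min hex hi ⟨h1, by lia, hui⟩
  generalize Nat.find hex = j at hj1 hjl hadj hmin
  have hlen : (w.take j).length = j := by rw [take_length]; lia
  have hvert : ∀ i ≤ j, (w.take j).getVert i = w.getVert i := fun i hi => by
    rw [take_getVert]; congr 1; lia
  have hsupp : u ∉ (w.take j).support := fun hmem => by
    obtain ⟨i, hi, hil⟩ := mem_support_iff_exists_getVert.1 hmem
    rw [hvert i (by lia)] at hi
    exact hu (hi ▸ w.getVert_mem_support i)
  refine ⟨j, hj1, hjl, hadj, .cons h ((w.take j).concat hadj.symm), ?_, ?_, by simp [hlen]⟩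
  · rw [cons_isCycle_iff]
    refine ⟨(hw.1.take j).concat hsupp _, fun hmem => ?_⟩
    rw [edges_concat, List.concat_eq_append, List.mem_append, List.mem_singleton] at hmem
    obtain hmem | hmem := hmem
    · exact hsupp (fst_mem_support_of_mem_edges _ hmem)
    · have haj : w.getVert 0 = w.getVert j := by
        rw [getVert_zero]
        rw [Sym2.eq_swap] at hmem
        simpa [h.ne, h.ne'] using hmem
      have := hw.1.getVert_injOn (by simp) hjl haj
      lia
  · have hsub : ∀ x y, ((w.take j).toSubgraph.Adj x y ∨ s(u, a) = s(x, y) ∨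
        s(w.getVert j, u) = s(x, y)) →
        (Walk.cons h ((w.take j).concat hadj.symm)).toSubgraph.Adj x y := by
      intro x y hxy
      rw [← Subgraph.mem_edgeSet, mem_edges_toSubgraph]
      rw [← Subgraph.mem_edgeSet, mem_edges_toSubgraph] at hxy
      simp only [edges_cons, edges_concat, List.concat_eq_append, List.mem_cons, List.mem_append,
        List.not_mem_nil, or_false]
      grind
    have hverts : ∀ x ∈ (Walk.cons h ((w.take j).concat hadj.symm)).toSubgraph.verts,
        x = u ∨ ∃ i ≤ j, w.getVert i = x := by
      intro x hx
      rw [mem_verts_toSubgraph, support_cons, support_concat,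
        List.mem_cons, List.mem_append, List.mem_singleton] at hx
      obtain hx | hx | hx := hx
      · exact .inl hx
      · obtain ⟨i, hi, hil⟩ := mem_support_iff_exists_getVert.1 hx
        exact .inr ⟨i, by lia, by rw [← hvert i (by lia), hi]⟩
      · exact .inl hx
    have hapex : ∀ i ≤ j, G.Adj u (w.getVert i) →
        (Walk.cons h ((w.take j).concat hadj.symm)).toSubgraph.Adj u (w.getVert i) := by
      intro i hi hui
      obtain rfl | hi0 := Nat.eq_zero_or_pos i
      · exact hsub _ _ (.inr (.inl (by simp)))
      · obtain rfl : i = j := by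
          by_contra hne
          exact hmin i (by lia) hi0 hui
        exact hsub _ _ (.inr (.inr Sym2.eq_swap))
    have hpath : ∀ i k, i < k → k ≤ j → G.Adj (w.getVert i) (w.getVert k) →
        (Walk.cons h ((w.take j).concat hadj.symm)).toSubgraph.Adj
          (w.getVert i) (w.getVert k) := by
      intro i k hik hk hadj'
      obtain rfl := hw.2 i k hik (by lia) hadj'
      have := (w.take j).toSubgraph_adj_getVert (i := i) (by lia)
      rw [hvert i (by lia), hvert (i + 1) hk] at this
      exact hsub _ _ (.inl this)
    intro x hx y hy hxy
    obtain rfl | ⟨i, hi, rfl⟩ := hverts x hx <;> obtain rfl | ⟨k, hk, rfl⟩ := hverts y hy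
    · exact (G.irrefl hxy).elim
    · exact hapex k hk hxy
    · exact (hapex i hi hxy.symm).symm
    · obtain hik | rfl | hik := lt_trichotomy i k
      · exact hpath i k hik hk hxy
      · exact (G.irrefl hxy).elim
      · exact (hpath k i hik hi hxy.symm).symm

end Walk

/-- In a graph of girth at least five, two distinct vertices have at most one common neighbour. -/
theorem eq_of_adj_of_five_le_egirth (hG : 5 ≤ G.egirth) {a b u v : V} (hab : a ≠ b)
    (hua : G.Adj u a) (hub : G.Adj u b) (hva : G.Adj v a) (hvb : G.Adj v b) : u = v := by
  by_contra huv
  have hc : (Walk.cons hua (.cons hva.symm (.cons hvb (.cons hub.symm .nil)))).IsCycle := by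
    rw [Walk.cons_isCycle_iff]
    simp [Walk.cons_isPath_iff, hab, hua.ne, hua.ne', hub.ne, hub.ne', hva.ne', hvb.ne,
      huv, Ne.symm huv]
  have := le_egirth.1 hG _ _ hc
  simp only [Walk.length_cons, Walk.length_nil] at this
  norm_cast at this

/-- A nonempty finite set of vertices contains an induced path that cannot be extended, within the
set, to an induced path by prepending a vertex. -/
theorem exists_isInducedPath_maximal {s : Finset V} (hs : s.Nonempty) :
    ∃ (a b : V) (w : G.Walk a b), w.IsInducedPath ∧ (∀ x ∈ w.support, x ∈ s) ∧
      ∀ u ∈ s, G.Adj u a → u ∉ w.support →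
        ∃ j, 1 ≤ j ∧ j ≤ w.length ∧ G.Adj u (w.getVert j) := by
  classical
  let P : ℕ → Prop := fun m => ∃ (a b : V) (w : G.Walk a b), w.IsInducedPath ∧
    (∀ x ∈ w.support, x ∈ s) ∧ w.length = m
  have hbound : ∀ m, P m → m ≤ s.card := by
    rintro _ ⟨a, b, w, hw, hws, rfl⟩
    have : w.support.toFinset.card ≤ s.card :=
      Finset.card_le_card fun x hx => hws x (by simpa using hx)
    rw [List.toFinset_card_of_nodup hw.1.support_nodup, Walk.length_support] at this
    lia
  obtain ⟨v, hv⟩ := hs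
  have h0 : P 0 := ⟨v, v, .nil, ⟨.nil, fun i j hij hj => by simp at hj; lia⟩, by simpa, rfl⟩
  obtain ⟨a, b, w, hw, hws, hlen⟩ := Nat.findGreatest_spec (Nat.zero_le s.card) h0
  refine ⟨a, b, w, hw, hws, fun u hu hua husupp => ?_⟩
  by_contra! hcon
  have hP : P (w.length + 1) := ⟨u, b, .cons hua w, hw.cons hua husupp hcon,
    by simpa [hu] using hws, rfl⟩
  have := Nat.le_findGreatest (hbound _ hP) hP
  lia

end SimpleGraph

open SimpleGraph

/-- Every graph of girth at least 5 with chromatic number χ > 2 contains an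
induced cycle of length at least χ + 2. -/
theorem girth5_induced_cycle_chromatic {V : Type} (G : SimpleGraph V)
    (hgirth : (5 : ℕ∞) ≤ G.egirth)
    (χ : ℕ) (hχ : G.chromaticNumber = χ) (h2 : 2 < χ) :
    ∃ ℓ : ℕ, HasInducedCycleLen G ℓ ∧ χ + 2 ≤ ℓ := by
  classical
  have hnc : ¬ G.Colorable (χ - 1) := fun hc => by
    have := chromaticNumber_le_iff_colorable.2 hc
    rw [hχ, Nat.cast_le] at this
    lia
  obtain ⟨s, hs, hdeg⟩ := exists_finset_forall_le_degree_of_not_colorable hnc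
  obtain ⟨a, b, w, hw, hws, hmax⟩ := exists_isInducedPath_maximal (G := G) hs
  let N := (s.filter (G.Adj a)).erase (w.getVert 1)
  have hN : χ - 2 ≤ N.card := by
    have h1 := hdeg a (hws a w.start_mem_support)
    have h2 := Finset.pred_card_le_card_erase (s := s.filter (G.Adj a)) (a := w.getVert 1)
    lia
  have hcycle : ∀ u ∈ N, ∃ j, 3 ≤ j ∧ j ≤ w.length ∧ G.Adj u (w.getVert j) ∧
      HasInducedCycleLen G (j + 2) := by
    intro u hu
    obtain ⟨hu1, hus, hau⟩ : u ≠ w.getVert 1 ∧ u ∈ s ∧ G.Adj a u := by simpa [N] using hu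
    have husupp : u ∉ w.support := fun hmem => by
      obtain ⟨i, rfl, hil⟩ := Walk.mem_support_iff_exists_getVert.1 hmem
      have hi : i ≠ 0 := fun hi => by simp [hi] at hau
      have := hw.2 0 i (by lia) hil (by simpa using hau)
      exact hu1 (by rw [this])
    obtain ⟨j, -, hjl, hadj, c, hc, hind, hlen⟩ :=
      hw.exists_isInduced_isCycle hau.symm husupp (hmax u hus hau.symm husupp)
    have h5 := le_egirth.1 hgirth _ c hc
    rw [hlen] at h5
    norm_cast at h5
    exact ⟨j, by lia, hjl, hadj, u, c, hc, hind, hlen⟩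
  choose! f hf3 hfl hfadj hfcyc using hcycle
  by_contra! hcon
  have hmaps : ∀ u ∈ N, f u ∈ Finset.Ico 3 χ := fun u hu => by
    have := hcon _ (hfcyc u hu)
    have := hf3 u hu
    simp only [Finset.mem_Ico]
    lia
  obtain ⟨u, hu, v, hv, huv, hfuv⟩ := Finset.exists_ne_map_eq_of_card_lt_of_maps_to
    (t := Finset.Ico 3 χ) (by rw [Nat.card_Ico]; lia) hmaps
  have hav : a ≠ w.getVert (f u) := fun h => by
    have := hw.1.getVert_injOn (by simp) (hfl u hu) (w.getVert_zero.trans h)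
    have := hf3 u hu
    lia
  have hadj : ∀ x ∈ N, G.Adj x a := fun x hx =>
    (Finset.mem_filter.1 (Finset.mem_of_mem_erase hx)).2.symm
  exact huv (eq_of_adj_of_five_le_egirth hgirth hav (hadj u hu) (hfadj u hu) (hadj v hv)
    (hfuv ▸ hfadj v hv))
end

section
/- Every triangle-free graph G of chromatic number χ = χ(G) ≥ 1, equipped with any proper colouring, contains a rainbow induced subgraph H on exactly χ vertices whose chromatic number satisfies χ(H) ≤ log₂ χ + 1. -/
namespace SimpleGraph

variable {V α : Type*} {G : SimpleGraph V}

theorem Colorable.induce_mono {A B : Set V} {n : ℕ} (hAB : A ⊆ B)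
    (h : (G.induce B).Colorable n) : (G.induce A).Colorable n :=
  h.of_hom (induceHomOfLE G hAB).toHom

theorem Colorable.induce_union {A B : Set V} {m n : ℕ}
    (hA : (G.induce A).Colorable m) (hB : (G.induce B).Colorable n) :
    (G.induce (A ∪ B)).Colorable (m + n) := by
  classical
  obtain ⟨f⟩ := hA
  obtain ⟨g⟩ := hB
  let C : (G.induce (A ∪ B)).Coloring (Fin m ⊕ Fin n) := Coloring.mk
    (fun v => if hv : v.1 ∈ A then Sum.inl (f ⟨v.1, hv⟩)
      else Sum.inr (g ⟨v.1, v.2.resolve_left hv⟩)) (by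
    rintro ⟨u, hu⟩ ⟨v, hv⟩ huv
    by_cases huA : u ∈ A <;> by_cases hvA : v ∈ A <;> simp only [huA, hvA, dite_true, dite_false,
      ne_eq, Sum.inl.injEq, Sum.inr.injEq, reduceCtorEq, not_false_eq_true]
    · exact f.valid (v := ⟨u, huA⟩) (w := ⟨v, hvA⟩) huv
    · exact g.valid (v := ⟨u, hu.resolve_left huA⟩) (w := ⟨v, hv.resolve_left hvA⟩) huv)
  simpa using C.colorable

theorem IsIndepSet.colorable_induce {A : Set V} (h : G.IsIndepSet A) :
    (G.induce A).Colorable 1 :=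
  ⟨Coloring.mk (fun _ => 0) fun {u v} huv => (h u.2 v.2 (Adj.ne huv ∘ Subtype.ext) huv).elim⟩

theorem colorable_induce_biUnion {ι : Type*} (S : Finset ι) (B : ι → Set V)
    (h : ∀ i ∈ S, G.IsIndepSet (B i)) : (G.induce (⋃ i ∈ S, B i)).Colorable S.card := by
  classical
  induction S using Finset.induction_on with
  | empty =>
    simp
  | insert a S ha ih =>
    rw [Finset.set_biUnion_insert, Finset.card_insert_of_notMem ha, Nat.add_comm]
    exact (h a (by simp)).colorable_induce.induce_union
      (ih fun i hi => h i (Finset.mem_insert_of_mem hi))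

/-- A properly coloured triangle-free graph contains a rainbow independent set of every size up to
half its chromatic number: the colour classes and neighbourhoods of the vertices of a smaller one do
not cover the graph. -/
theorem CliqueFree.exists_rainbow_isIndepSet (hG : G.CliqueFree 3) {c : V → α}
    (hc : ∀ {u v : V}, G.Adj u v → c u ≠ c v) {W : Set V} {n : ℕ}
    (hW : ∀ m < n, ¬ (G.induce W).Colorable m) (t : ℕ) (ht : 2 * t ≤ n + 1) :
    ∃ S : Finset V, ↑S ⊆ W ∧ S.card = t ∧ Set.InjOn c S ∧ G.IsIndepSet S := by
  classical
  induction t with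
  | zero => exact ⟨∅, by simp [IsIndepSet]⟩
  | succ t ih =>
    obtain ⟨S, hSW, hSt, hSc, hSi⟩ := ih (by omega)
    obtain ⟨w, hwW, hw⟩ : ∃ w ∈ W, ∀ v ∈ S, c w ≠ c v ∧ ¬ G.Adj v w := by
      by_contra! hcon
      have h1 := colorable_induce_biUnion (G := G) S (fun v => {w | c w = c v})
        fun v _ x hx y hy _ hxy => hc hxy (hx.trans hy.symm)
      have h2 := colorable_induce_biUnion (G := G) S G.neighborSet
        fun v _ => isIndepSet_neighborSet_of_triangleFree G hG v
      refine hW (S.card + S.card) (by omega) ((h1.induce_union h2).induce_mono fun w hw => ?_)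
      obtain ⟨v, hv, hvw⟩ := hcon w hw
      by_cases h : c w = c v
      · exact Or.inl (Set.mem_biUnion hv h)
      · exact Or.inr (Set.mem_biUnion hv (hvw h))
    have hwS : w ∉ S := fun h => (hw w h).1 rfl
    refine ⟨insert w S, ?_, by rw [Finset.card_insert_of_notMem hwS, hSt], ?_, ?_⟩
    · rw [Finset.coe_insert]
      exact Set.insert_subset hwW hSW
    · rw [Finset.coe_insert, Set.injOn_insert (by exact_mod_cast hwS)]
      refine ⟨hSc, ?_⟩
      rintro ⟨v, hv, hvw⟩
      exact (hw v hv).1 hvw.symm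
    · rw [Finset.coe_insert]
      refine Set.Pairwise.insert hSi fun v hv _ => ⟨fun h => (hw v hv).2 h.symm, (hw v hv).2⟩

theorem CliqueFree.exists_rainbow_colorable (hG : G.CliqueFree 3) {c : V → α}
    (hc : ∀ {u v : V}, G.Adj u v → c u ≠ c v) (k : ℕ) {W : Set V} {n : ℕ}
    (hW : ∀ m < n, ¬ (G.induce W).Colorable m) (hn : n < 2 ^ k) :
    ∃ s : Finset V, ↑s ⊆ W ∧ s.card = n ∧ Set.InjOn c s ∧
      (G.induce (s : Set V)).Colorable k := by
  classical
  induction k generalizing W n with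
  | zero =>
    refine ⟨∅, by simp, by simp at hn; simp [hn], by simp, ?_⟩
    rw [Finset.coe_empty]
    exact Colorable.of_isEmpty 0
  | succ k ih =>
    obtain ⟨S, hSW, hSt, hSc, hSi⟩ := hG.exists_rainbow_isIndepSet hc hW ((n + 1) / 2) (by omega)
    obtain ⟨s, hsW, hsn, hsc, hsk⟩ := ih (W := {w ∈ W | ∀ v ∈ S, c w ≠ c v}) (n := n / 2) (by
      intro m hm hcol
      have h1 := colorable_induce_biUnion (G := G) S (fun v => {w | c w = c v})
        fun v _ x hx y hy _ hxy => hc hxy (hx.trans hy.symm)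
      refine hW (m + S.card) (by omega) ((hcol.induce_union h1).induce_mono fun w hw => ?_)
      by_cases h : ∀ v ∈ S, c w ≠ c v
      · exact Or.inl ⟨hw, h⟩
      · push Not at h
        obtain ⟨v, hv, hvw⟩ := h
        exact Or.inr (Set.mem_biUnion hv hvw)) (by rw [pow_succ] at hn; omega)
    have hdisj : Disjoint s S := Finset.disjoint_left.2 fun v hv hvS => (hsW hv).2 v hvS rfl
    refine ⟨s ∪ S, ?_, by rw [Finset.card_union_of_disjoint hdisj]; omega, ?_, ?_⟩
    · rw [Finset.coe_union]
      exact Set.union_subset (fun v hv => (hsW hv).1) hSW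
    · rw [Finset.coe_union, Set.injOn_union (by exact_mod_cast hdisj)]
      exact ⟨hsc, hSc, fun u hu v hv => (hsW hu).2 v hv⟩
    · rw [Finset.coe_union]
      exact hsk.induce_union hSi.colorable_induce

end SimpleGraph

/-- Every triangle-free graph of chromatic number χ ≥ 1, equipped with any proper
colouring, contains a rainbow induced subgraph on exactly χ vertices of chromatic number at
most log₂ χ + 1. -/
theorem triangleFree_rainbow_low_chromatic_subgraph
    {V : Type} [Fintype V] (G : SimpleGraph V) (hG : G.CliqueFree 3)
    (χ : ℕ) (hχ : G.chromaticNumber = χ) (h1 : 1 ≤ χ)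
    {α : Type} (c : V → α) (hc : ∀ {u v : V}, G.Adj u v → c u ≠ c v) :
    ∃ s : Finset V, s.card = χ ∧ Set.InjOn c ↑s ∧
      (((G.induce (↑s : Set V)).chromaticNumber.toNat : ℝ) ≤ Real.logb 2 χ + 1) := by
  have hW : ∀ m < χ, ¬ (G.induce Set.univ).Colorable m := by
    intro m hm hcol
    have hle := (hcol.of_hom G.induceUnivIso.symm.toHom).chromaticNumber_le
    rw [hχ] at hle
    exact absurd (Nat.cast_le.1 hle) (by omega)
  obtain ⟨s, -, hs, hsc, hcol⟩ := hG.exists_rainbow_colorable hc (Nat.log 2 χ + 1) hW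
    (Nat.lt_pow_succ_log_self one_lt_two χ)
  refine ⟨s, hs, hsc, ?_⟩
  have hnat : (G.induce (s : Set V)).chromaticNumber.toNat ≤ Nat.log 2 χ + 1 :=
    ENat.toNat_le_of_le_natCast hcol.chromaticNumber_le
  calc ((G.induce (s : Set V)).chromaticNumber.toNat : ℝ) ≤ (Nat.log 2 χ : ℝ) + 1 := by
        exact_mod_cast hnat
    _ ≤ Real.logb 2 χ + 1 := by
        gcongr
        exact_mod_cast Real.natLog_le_logb χ 2
end
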